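/- arXiv:2507.10467 — 3 statements merged into one kernel-verified Lean document; each statement's English description precedes it below -/
import Mathlib

section
/- For all positive integers k and ℓ, every finite simple graph G, and all vertex sets X_1,…,X_ℓ, Y ⊆ V(G), at least one of the following holds: (1) there exists a linkage P of order k·ℓ in G such that for every i ∈ [ℓ] there is an X_i–Y-linkage P_i ⊆ P of order k, and P = ⋃_{i∈[ℓ]} P_i; or (2) there exists a non-empty set I ⊆ [ℓ] and a set S ⊆ V(G) with |S| < k·ℓ such that S is a (⋃_{i∈I} X_i)–Y-separator in G. -/
open SimpleGraph

/-- `S` is an `X`–`Y`-separator in `G`: every walk from a vertex of `X` to a vertex of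
`Y` meets `S` (equivalently, no component of `G − S` contains both a vertex of `X` and
a vertex of `Y`). -/
def Separates {n : ℕ} (G : SimpleGraph (Fin n)) (S X Y : Set (Fin n)) : Prop :=
  ∀ x ∈ X, ∀ y ∈ Y, ∀ p : G.Walk x y, ∃ v ∈ p.support, v ∈ S

structure MWalk {V : Type*} (E : Finset (V × V)) (A B : Finset V) (l : List V) : Prop where
  chain : l.IsChain (fun u v => (u, v) ∈ E)
  hd : ∃ a ∈ A, ∃ t, l = a :: t
  lt : ∃ b ∈ B, ∃ s, l = s ++ [b]

theorem m_reindex {V : Type*} {k : ℕ} (P : Finset V) (h : Fin k → V)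
    (hinj : Function.Injective h) (hP : ∀ i, h i ∈ P) (hc : P.card = k) :
    ∃ e : V → Fin k → Prop, (∀ p ∈ P, ∃ i, e p i) ∧ ∀ p i, e p i → h i = p := by
  classical
  refine ⟨fun p i => h i = p, ?_, fun _ _ h => h⟩
  have : Finset.univ.image h = P := by
    apply Finset.eq_of_subset_of_card_le
    · intro v hv
      simp only [Finset.mem_image, Finset.mem_univ, true_and] at hv
      obtain ⟨i, rfl⟩ := hv
      exact hP i
    · rw [Finset.card_image_of_injective _ hinj, hc]; simp
  intro p hp
  rw [← this] at hp
  simpa using hp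

theorem m_first {V : Type*} (Q : V → Prop) (l : List V) (h : ∃ v ∈ l, Q v) :
    ∃ s p t, l = s ++ p :: t ∧ Q p ∧ ∀ v ∈ s, ¬ Q v := by
  induction l with
  | nil => simp at h
  | cons a l ih =>
    by_cases ha : Q a
    · exact ⟨[], a, l, rfl, ha, by simp⟩
    · obtain ⟨v, hv, hq⟩ := h
      rcases List.mem_cons.1 hv with rfl | hv
      · exact absurd hq ha
      · obtain ⟨s, p, t, rfl, hp, hs⟩ := ih ⟨v, hv, hq⟩
        refine ⟨a :: s, p, t, rfl, hp, ?_⟩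
        intro w hw
        rcases List.mem_cons.1 hw with rfl | hw
        · exact ha
        · exact hs w hw

theorem m_last {V : Type*} (Q : V → Prop) (l : List V) (h : ∃ v ∈ l, Q v) :
    ∃ s p t, l = s ++ p :: t ∧ Q p ∧ ∀ v ∈ t, ¬ Q v := by
  obtain ⟨s, p, t, h1, h2, h3⟩ := m_first Q l.reverse (by simpa using h)
  refine ⟨t.reverse, p, s.reverse, ?_, h2, by simpa using h3⟩
  have := congrArg List.reverse h1
  simpa using this

theorem m_chain_src {V : Type*} [DecidableEq V] (E : Finset (V × V)) (x y : V) (s : List V) (p : V)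
    (h : (s ++ [p]).IsChain (fun u v => (u, v) ∈ insert (x, y) E)) (hx : ∀ v ∈ s, v ≠ x) :
    (s ++ [p]).IsChain (fun u v => (u, v) ∈ E) := by
  induction s with
  | nil => simp
  | cons a s ih =>
    simp only [List.cons_append, List.isChain_cons] at h ⊢
    refine ⟨fun z hz => ?_, ih h.2 (fun v hv => hx v (by simp [hv]))⟩
    have := h.1 z hz
    have ha := hx a (by simp)
    simp only [Finset.mem_insert, Prod.mk.injEq] at this
    tauto

theorem m_chain_tgt {V : Type*} [DecidableEq V] (E : Finset (V × V)) (x y : V) (s : List V) (p : V)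
    (h : (p :: s).IsChain (fun u v => (u, v) ∈ insert (x, y) E)) (hx : ∀ v ∈ s, v ≠ y) :
    (p :: s).IsChain (fun u v => (u, v) ∈ E) := by
  induction s generalizing p with
  | nil => simp
  | cons a s ih =>
    rw [List.isChain_cons_cons] at h ⊢
    refine ⟨?_, ih a h.2 (fun v hv => hx v (by simp [hv]))⟩
    have := h.1
    have ha := hx a (by simp)
    simp only [Finset.mem_insert, Prod.mk.injEq] at this
    tauto

theorem m_menger {V : Type*} [DecidableEq V] (E : Finset (V × V)) :
    ∀ (k : ℕ) (A B : Finset V),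
      (∀ S : Finset V, (∀ l, MWalk E A B l → ∃ v ∈ l, v ∈ S) → k ≤ S.card) →
      ∃ f : Fin k → List V, (∀ i, MWalk E A B (f i)) ∧ (∀ i, (f i).Nodup) ∧
        ∀ i j v, v ∈ f i → v ∈ f j → i = j := by
  induction E using Finset.induction_on with
  | empty =>
    intro k A B h
    have := h (A ∩ B) (by
      rintro l ⟨hc, ⟨a, ha, t, rfl⟩, ⟨b, hb, s, hs⟩⟩
      cases t with
      | cons c t => simp at hc
      | nil =>
        refine ⟨a, by simp, ?_⟩
        cases s with
        | nil => simp at hs; subst hs; simp [ha, hb]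
        | cons c s => simp at hs)
    obtain ⟨T, hT, hTc⟩ := Finset.exists_subset_card_eq this
    let e := T.equivFinOfCardEq hTc
    have he : ∀ i, (e.symm i : V) ∈ A ∩ B := fun i => hT (e.symm i).2
    refine ⟨fun i => [(e.symm i : V)], fun i => ⟨by simp, ⟨_, (Finset.mem_inter.1 (he i)).1, [], rfl⟩,
      ⟨_, (Finset.mem_inter.1 (he i)).2, [], rfl⟩⟩, by simp, ?_⟩
    intro i j v hi hj
    simp only [List.mem_singleton] at hi hj
    exact e.symm.injective (Subtype.ext (hi.symm.trans hj))
  | insert e E _ ih =>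
    obtain ⟨x, y⟩ := e
    intro k A B h
    have hmono : ∀ {l : List V}, l.IsChain (fun u v => (u, v) ∈ E) →
        l.IsChain (fun u v => (u, v) ∈ insert (x, y) E) :=
      fun hl => hl.imp (fun _ _ hh => Finset.mem_insert_of_mem hh)
    by_cases hS : ∀ S : Finset V, (∀ l, MWalk E A B l → ∃ v ∈ l, v ∈ S) → k ≤ S.card
    · obtain ⟨f, h1, h2, h3⟩ := ih k A B hS
      exact ⟨f, fun i => ⟨hmono (h1 i).chain, (h1 i).hd, (h1 i).lt⟩, h2, h3⟩
    push Not at hS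
    obtain ⟨S, hsep, hcard⟩ := hS
    have sepP : ∀ l, MWalk (insert (x, y) E) A B l → ∃ v ∈ l, v ∈ insert x S := by
      intro l hl
      by_contra hcon
      push Not at hcon
      obtain ⟨b, hb, s, rfl⟩ := hl.lt
      obtain ⟨v, hv, hvS⟩ := hsep _ ⟨m_chain_src E x y s b hl.chain (fun v hv hvx =>
        hcon v (by simp [hv]) (by simp [hvx])), hl.hd, hl.lt⟩
      exact hcon v hv (by simp [hvS])
    have sepQ : ∀ l, MWalk (insert (x, y) E) A B l → ∃ v ∈ l, v ∈ insert y S := by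
      intro l hl
      by_contra hcon
      push Not at hcon
      obtain ⟨b, hb, s, rfl⟩ := hl.hd
      obtain ⟨v, hv, hvS⟩ := hsep _ ⟨m_chain_tgt E x y s b hl.chain (fun v hv hvx =>
        hcon v (by simp [hv]) (by simp [hvx])), hl.hd, hl.lt⟩
      exact hcon v hv (by simp [hvS])
    have cP := h _ sepP
    have cQ := h _ sepQ
    have hxS : x ∉ S := fun hx => by rw [Finset.insert_eq_of_mem hx] at cP; omega
    have hyS : y ∉ S := fun hx => by rw [Finset.insert_eq_of_mem hx] at cQ; omega
    have cP' : (insert x S).card = k := by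
      rw [Finset.card_insert_of_notMem hxS] at cP ⊢; omega
    have cQ' : (insert y S).card = k := by
      rw [Finset.card_insert_of_notMem hyS] at cQ ⊢; omega
    obtain ⟨f, f1, f2, f3⟩ := ih k A (insert x S) (by
      intro T hT
      apply h
      intro l hl
      obtain ⟨s, p, t, rfl, hp, hs⟩ := m_first (· ∈ insert x S) l (sepP l hl)
      obtain ⟨v, hv, hvT⟩ := hT (s ++ [p]) ⟨m_chain_src E x y s p (List.isChain_split.1 hl.chain).1
        (fun v hv hvx => hs v hv (by simp [hvx])), by
          obtain ⟨a, ha, t', ht'⟩ := hl.hd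
          cases s with
          | nil => simp at ht'; exact ⟨a, ha, [], by simp [ht'.1]⟩
          | cons c s => simp at ht'; exact ⟨a, ha, s ++ [p], by simp [ht'.1]⟩, ⟨p, hp, s, rfl⟩⟩
      refine ⟨v, ?_, hvT⟩
      simp at hv ⊢; tauto)
    obtain ⟨g, g1, g2, g3⟩ := ih k (insert y S) B (by
      intro T hT
      apply h
      intro l hl
      obtain ⟨s, p, t, rfl, hp, hs⟩ := m_last (· ∈ insert y S) l (sepQ l hl)
      obtain ⟨v, hv, hvT⟩ := hT (p :: t) ⟨m_chain_tgt E x y t p (List.isChain_split.1 hl.chain).2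
        (fun v hv hvx => hs v hv (by simp [hvx])), ⟨p, hp, t, rfl⟩, by
          obtain ⟨b, hb, t', ht'⟩ := hl.lt
          rcases List.eq_nil_or_concat t with rfl | ⟨t2, c, rfl⟩
          · have := (List.append_inj' ht' rfl).2
            exact ⟨b, hb, [], by simpa using this⟩
          · rw [List.concat_eq_append, ← List.cons_append, ← List.append_assoc] at ht'
            have := (List.append_inj' ht' rfl).2
            exact ⟨b, hb, p :: t2, by simpa using this⟩⟩
      refine ⟨v, ?_, hvT⟩
      simp at hv ⊢; tauto)
    choose fl fl1 fs fl2 using fun i => (f1 i).lt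
    choose gh gh1 gt gh2 using fun i => (g1 i).hd
    have flinj : Function.Injective fl := fun i j hij => f3 i j (fl i) (by simp [fl2 i])
      (by rw [hij]; simp [fl2 j])
    have ghinj : Function.Injective gh := fun i j hij => g3 i j (gh i) (by simp [gh2 i])
      (by rw [hij]; simp [gh2 j])
    obtain ⟨eP, eP1, eP2⟩ := m_reindex _ fl flinj fl1 cP'
    obtain ⟨eQ, eQ1, eQ2⟩ := m_reindex _ gh ghinj gh1 cQ'
    -- vertices of P on f i
    have fP : ∀ i v, v ∈ f i → v ∈ insert x S → v = fl i := by
      intro i v hv hvP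
      obtain ⟨j, hj⟩ := eP1 v hvP
      have hj := eP2 _ _ hj
      have : i = j := f3 i j v hv (by rw [fl2 j, ← hj]; simp)
      rw [this, hj]
    have gQ : ∀ i v, v ∈ g i → v ∈ insert y S → v = gh i := by
      intro i v hv hvP
      obtain ⟨j, hj⟩ := eQ1 v hvP
      have hj := eQ2 _ _ hj
      have : i = j := g3 i j v hv (by rw [gh2 j, ← hj]; simp)
      rw [this, hj]
    have key : ∀ i j v, v ∈ f i → v ∈ g j → v ∈ S ∧ v = fl i ∧ v = gh j := by
      intro i j v hi hj
      obtain ⟨s1, t1, e1⟩ := List.append_of_mem hi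
      obtain ⟨s2, t2, e2⟩ := List.append_of_mem hj
      have c1 := (f1 i).chain
      have c2 := (g1 j).chain
      have n1 := f2 i
      have n2 := g2 j
      rw [e1] at c1 n1
      rw [e2] at c2 n2
      obtain ⟨w, hw, hwS⟩ := hsep (s1 ++ v :: t2) ⟨List.isChain_split.2
        ⟨(List.isChain_split.1 c1).1, (List.isChain_split.1 c2).2⟩, by
          obtain ⟨a, ha, t, ht⟩ := (f1 i).hd
          rw [e1] at ht
          cases s1 with
          | nil => simp at ht; exact ⟨a, ha, t2, by simp [ht.1]⟩
          | cons c s => simp at ht; exact ⟨a, ha, s ++ v :: t2, by simp [ht.1]⟩, by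
          obtain ⟨b, hb, t, ht⟩ := (g1 j).lt
          rw [e2] at ht
          rcases List.eq_nil_or_concat t2 with rfl | ⟨t2, c, rfl⟩
          · have := (List.append_inj' ht rfl).2
            exact ⟨b, hb, s1, by simpa using this⟩
          · rw [List.concat_eq_append, ← List.cons_append, ← List.append_assoc] at ht
            have := (List.append_inj' ht rfl).2
            exact ⟨b, hb, s1 ++ v :: t2, by simpa using this⟩⟩
      have hwv : w = v := by
        simp only [List.mem_append, List.mem_cons] at hw
        rcases hw with hw | hw | hw
        · exfalso
          have := fP i w (by rw [e1]; simp [hw]) (by simp [hwS])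
          have hl : fl i ∈ v :: t1 := by
            have h5 : (f i).getLast? = some (fl i) := by rw [fl2 i]; simp
            rw [e1] at h5
            rw [List.getLast?_append_of_ne_nil _ (by simp)] at h5
            exact List.mem_of_getLast? h5
          rw [List.nodup_append] at n1
          exact n1.2.2 w hw _ hl this
        · exact hw
        · exfalso
          have := gQ j w (by rw [e2]; simp [hw]) (by simp [hwS])
          have hl : gh j ∈ s2 ++ [v] := by
            have h5 := gh2 j
            rw [e2] at h5
            cases s2 with
            | nil => simp at h5; simp [h5.1]
            | cons c s => simp at h5; simp [h5.1]
          have n3 : ((s2 ++ [v]) ++ t2).Nodup := by simpa using n2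
          rw [List.nodup_append] at n3
          exact n3.2.2 _ hl w hw this.symm
      subst hwv
      exact ⟨hwS, fP i w hi (by simp [hwS]), gQ j w hj (by simp [hwS])⟩
    -- matching
    have hm : ∀ i, ∃ j, ∃ D : List V, (fl i = gh j ∧ D = gt j ∨ fl i = x ∧ gh j = y ∧ D = g j) := by
      intro i
      rcases Finset.mem_insert.1 (fl1 i) with hx | hx
      · obtain ⟨j, hj⟩ := eQ1 y (by simp)
        exact ⟨j, g j, Or.inr ⟨hx, eQ2 _ _ hj, rfl⟩⟩
      · obtain ⟨j, hj⟩ := eQ1 (fl i) (by simp [hx])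
        exact ⟨j, gt j, Or.inl ⟨(eQ2 _ _ hj).symm, rfl⟩⟩
    choose m D hD using hm
    have hDg : ∀ i v, v ∈ D i → v ∈ g (m i) := by
      intro i v hv
      rcases hD i with ⟨_, h2⟩ | ⟨_, _, h2⟩
      · rw [gh2]; rw [h2] at hv; simp [hv]
      · rwa [← h2]
    have hDf : ∀ i i' v, v ∈ D i → v ∈ f i' → False := by
      intro i i' v hv hf
      obtain ⟨k1, k2, k3⟩ := key i' (m i) v hf (hDg i v hv)
      rcases hD i with ⟨h1, h2⟩ | ⟨_, h1, h2⟩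
      · have := g2 (m i)
        rw [gh2, ← h2, ← k3] at this
        exact (List.nodup_cons.1 this).1 hv
      · rw [h1] at k3
        exact hyS (k3 ▸ k1)
    have minj : ∀ i i', m i = m i' → i = i' := by
      intro i i' hii
      apply flinj
      rcases hD i with ⟨h1, -⟩ | ⟨h0, h1, -⟩ <;> rcases hD i' with ⟨h1', -⟩ | ⟨h0', h1', -⟩
      · rw [h1, h1', hii]
      · rw [hii, h1'] at h1
        rcases Finset.mem_insert.1 (fl1 i) with h | h
        · rw [h, h0']
        · exact absurd (h1 ▸ h) hyS
      · rw [← hii, h1] at h1'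
        rcases Finset.mem_insert.1 (fl1 i') with h | h
        · rw [h, h0]
        · exact absurd (h1' ▸ h) hyS
      · rw [h0, h0']
    refine ⟨fun i => f i ++ D i, fun i => ⟨?_, ?_, ?_⟩, ?_, ?_⟩
    · beta_reduce
      have c1 := hmono (f1 i).chain
      have c2 := hmono (g1 (m i)).chain
      rw [fl2 i] at c1 ⊢
      rw [List.append_assoc, List.singleton_append, List.isChain_split]
      refine ⟨c1, ?_⟩
      rcases hD i with ⟨h1, h2⟩ | ⟨h0, h1, h2⟩
      · rw [h1, h2, ← gh2]; exact c2
      · rw [h2, h0]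
        rw [gh2, h1] at c2 ⊢
        rw [List.isChain_cons_cons]
        exact ⟨by simp, c2⟩
    · obtain ⟨a, ha, t, ht⟩ := (f1 i).hd
      exact ⟨a, ha, t ++ D i, by beta_reduce; rw [ht]; simp⟩
    · beta_reduce
      obtain ⟨b, hb, s, hs⟩ := (g1 (m i)).lt
      rcases hD i with ⟨h1, h2⟩ | ⟨h0, h1, h2⟩
      · refine ⟨b, hb, fs i ++ s, ?_⟩
        rw [List.append_assoc, ← hs, gh2, h2, fl2, h1]; simp
      · exact ⟨b, hb, f i ++ s, by rw [h2, List.append_assoc, ← hs]⟩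
    · intro i
      rw [List.nodup_append]
      refine ⟨f2 i, ?_, fun v hv w hw hvw => hDf i i v (hvw ▸ hw) hv⟩
      have := g2 (m i)
      rcases hD i with ⟨h1, h2⟩ | ⟨h0, h1, h2⟩
      · rw [gh2, ← h2] at this
        exact (List.nodup_cons.1 this).2
      · rwa [h2]
    · intro i j v hi hj
      rcases List.mem_append.1 hi with hi | hi <;> rcases List.mem_append.1 hj with hj | hj
      · exact f3 i j v hi hj
      · exact (hDf _ _ _ hj hi).elim
      · exact (hDf _ _ _ hi hj).elim
      · exact minj _ _ (g3 _ _ v (hDg _ _ hi) (hDg _ _ hj))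

theorem m_trim {V : Type*} [DecidableEq V] (G : SimpleGraph V) (X Y : Set V) (N : ℕ) :
    ∀ (x y : V) (p : G.Walk x y), p.length ≤ N → x ∈ X → y ∈ Y →
    ∃ (a b : V) (q : G.Walk a b), q.IsPath ∧ a ∈ X ∧ b ∈ Y ∧
      (∀ v ∈ q.support, v ∈ X ∪ Y → v = a ∨ v = b) ∧ ∀ v ∈ q.support, v ∈ p.support := by
  induction N with
  | zero =>
    intro x y p hp hx hy
    cases p with
    | nil => exact ⟨x, x, .nil, by simp, hx, hy, by simp, by simp⟩
    | cons h p => simp at hp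
  | succ N ih =>
    intro x y p hp hx hy
    by_cases hc : ∀ v ∈ p.bypass.support, v ∈ X ∪ Y → v = x ∨ v = y
    · exact ⟨x, y, p.bypass, p.bypass_isPath, hx, hy, hc, fun v hv => p.support_bypass_subset_support hv⟩
    push Not at hc
    obtain ⟨v, hv, hvXY, hvx, hvy⟩ := hc
    have hv' := p.support_bypass_subset_support hv
    have hsum := congrArg SimpleGraph.Walk.length (p.take_spec hv')
    rw [SimpleGraph.Walk.length_append] at hsum
    rcases hvXY with hvX | hvY
    · have : (p.takeUntil v hv').length ≠ 0 := fun h =>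
        hvx (SimpleGraph.Walk.eq_of_length_eq_zero h).symm
      obtain ⟨a, b, q, h1, h2, h3, h4, h5⟩ := ih v y (p.dropUntil v hv') (by omega) hvX hy
      exact ⟨a, b, q, h1, h2, h3, h4, fun w hw => p.support_dropUntil_subset_support hv' (h5 w hw)⟩
    · have : (p.dropUntil v hv').length ≠ 0 := fun h =>
        hvy (SimpleGraph.Walk.eq_of_length_eq_zero h)
      obtain ⟨a, b, q, h1, h2, h3, h4, h5⟩ := ih x v (p.takeUntil v hv') (by omega) hx hvY
      exact ⟨a, b, q, h1, h2, h3, h4, fun w hw => p.support_takeUntil_subset_support hv' (h5 w hw)⟩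

/-- Auxiliary edges. -/
def MAdj {n k ℓ : ℕ} (G : SimpleGraph (Fin n)) (X : Fin ℓ → Set (Fin n)) :
    (Fin n ⊕ (Fin ℓ × Fin k)) × (Fin n ⊕ (Fin ℓ × Fin k)) → Prop
  | (Sum.inl u, Sum.inl v) => G.Adj u v
  | (Sum.inr i, Sum.inl v) => v ∈ X i.1
  | _ => False

theorem m_walk {n k ℓ : ℕ} (G : SimpleGraph (Fin n)) (X : Fin ℓ → Set (Fin n)) (y : Fin n)
    (t : List (Fin n ⊕ (Fin ℓ × Fin k))) :
    ∀ (c : Fin n) (s : List (Fin n ⊕ (Fin ℓ × Fin k))),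
    (Sum.inl c :: t).IsChain (fun u v => MAdj G X (u, v)) → Sum.inl c :: t = s ++ [Sum.inl y] →
    ∃ p : G.Walk c y, ∀ v ∈ p.support, Sum.inl v ∈ Sum.inl c :: t := by
  induction t with
  | nil =>
    intro c s _ hs
    have : c = y := by
      have := congrArg List.getLast? hs
      simpa using this
    subst this
    exact ⟨.nil, by simp⟩
  | cons d t ih =>
    intro c s h hs
    rw [List.isChain_cons_cons] at h
    obtain d | d := d
    · have h1 : G.Adj c d := h.1
      cases s with
      | nil => simp at hs
      | cons e s =>
        simp only [List.cons_append, List.cons.injEq] at hs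
        obtain ⟨p, hp⟩ := ih d s h.2 hs.2
        refine ⟨.cons h1 p, ?_⟩
        intro v hv
        rw [SimpleGraph.Walk.support_cons] at hv
        rcases List.mem_cons.1 hv with rfl | hv
        · simp
        · exact List.mem_cons_of_mem _ (hp v hv)
    · exact h.1.elim

theorem m_unwalk {n k ℓ : ℕ} (G : SimpleGraph (Fin n)) (X : Fin ℓ → Set (Fin n)) {x y : Fin n}
    (p : G.Walk x y) :
    ∃ t s, p.support.map (Sum.inl : _ → Fin n ⊕ (Fin ℓ × Fin k)) = Sum.inl x :: t ∧
      Sum.inl x :: t = s ++ [Sum.inl y] ∧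
      (Sum.inl x :: t).IsChain (fun u v => MAdj G X (u, v)) := by
  induction p with
  | nil => exact ⟨[], [], by simp, by simp, by simp⟩
  | cons h p ih =>
    obtain ⟨t, s, h1, h2, h3⟩ := ih
    rename_i u v w
    refine ⟨Sum.inl v :: t, Sum.inl u :: s, by rw [SimpleGraph.Walk.support_cons, List.map_cons, h1], ?_, ?_⟩
    · rw [h2]; rfl
    · rw [List.isChain_cons_cons]
      exact ⟨h, h3⟩

/-- For all positive integers `k` and `ℓ`, every graph `G` and all vertex sets
`X₁, …, X_ℓ, Y`, either there is a linkage of order `k·ℓ` consisting, for every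
`i ∈ [ℓ]`, of an `Xᵢ`–`Y`-linkage of order `k`, or some union of the `Xᵢ`'s can be
separated from `Y` by fewer than `k·ℓ` vertices. -/
theorem multicolor_linkage {n : ℕ} (k ℓ : ℕ) (hk : 0 < k) (hℓ : 0 < ℓ)
    (G : SimpleGraph (Fin n)) (X : Fin ℓ → Set (Fin n)) (Y : Set (Fin n)) :
    (∃ (a b : Fin ℓ → Fin k → Fin n) (P : ∀ i j, G.Walk (a i j) (b i j)),
      (∀ i j, (P i j).IsPath) ∧
      (∀ i j, a i j ∈ X i) ∧
      (∀ i j, b i j ∈ Y) ∧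
      (∀ i j, ∀ v ∈ (P i j).support, v ∈ X i ∪ Y → v = a i j ∨ v = b i j) ∧
      (Pairwise fun s t : Fin ℓ × Fin k =>
        ∀ v, v ∈ (P s.1 s.2).support → v ∉ (P t.1 t.2).support)) ∨
    (∃ I : Set (Fin ℓ), I.Nonempty ∧
      ∃ S : Set (Fin n), S.ncard < k * ℓ ∧ Separates G S (⋃ i ∈ I, X i) Y) := by
  classical
  let V := Fin n ⊕ (Fin ℓ × Fin k)
  let E : Finset (V × V) := Finset.univ.filter (MAdj G X)
  let A : Finset V := Finset.univ.image Sum.inr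
  let B : Finset V := Finset.univ.filter (fun v => ∃ y ∈ Y, v = Sum.inl y)
  have hE : (fun u v : V => (u, v) ∈ E) = fun u v => MAdj G X (u, v) := by
    funext u v; simp [E]
  have hA : A.card = k * ℓ := by
    rw [Finset.card_image_of_injective _ Sum.inr_injective]
    simp [mul_comm]
  by_cases hM : ∀ S : Finset V, (∀ l, MWalk E A B l → ∃ v ∈ l, v ∈ S) → k * ℓ ≤ S.card
  · left
    obtain ⟨f, f1, -, f3⟩ := m_menger E (k * ℓ) A B hM
    choose fh fh1 ft fh2 using fun i => (f1 i).hd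
    have fhinj : Function.Injective fh := fun i j hij => f3 i j (fh i) (by simp [fh2 i])
      (by rw [hij]; simp [fh2 j])
    obtain ⟨e, e1, e2⟩ := m_reindex _ fh fhinj fh1 hA
    have main : ∀ s : Fin ℓ × Fin k, ∃ i, fh i = Sum.inr s ∧ ∃ (a b : Fin n) (q : G.Walk a b),
        q.IsPath ∧ a ∈ X s.1 ∧ b ∈ Y ∧ (∀ v ∈ q.support, v ∈ X s.1 ∪ Y → v = a ∨ v = b) ∧
        ∀ v ∈ q.support, Sum.inl v ∈ f i := by
      intro s
      obtain ⟨i, hi⟩ := e1 (Sum.inr s) (by simp [A])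
      have hi := e2 _ _ hi
      refine ⟨i, hi, ?_⟩
      have hc := (f1 i).chain
      obtain ⟨b, hb, u, hu⟩ := (f1 i).lt
      obtain ⟨y, hy, rfl⟩ := (Finset.mem_filter.1 hb).2
      have h2 := fh2 i
      rw [hi] at h2
      rw [hE, h2] at hc
      rw [h2] at hu
      rw [h2]
      generalize ft i = t at *
      cases t with
      | nil =>
        have := congrArg List.getLast? hu
        simp at this
      | cons c t =>
        rw [List.isChain_cons_cons] at hc
        obtain c | c := c
        · have hcX : c ∈ X s.1 := hc.1
          cases u with
          | nil => simp at hu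
          | cons d u =>
            simp only [List.cons_append, List.cons.injEq] at hu
            obtain ⟨p, hp⟩ := m_walk G X y t c u hc.2 hu.2
            obtain ⟨a, b, q, h1, h2, h3, h4, h5⟩ := m_trim G (X s.1) Y _ c y p le_rfl hcX hy
            exact ⟨a, b, q, h1, h2, h3, h4, fun v hv => List.mem_cons_of_mem _ (hp v (h5 v hv))⟩
        · exact hc.1.elim
    choose i hi a b q h1 h2 h3 h4 h5 using main
    refine ⟨fun s t => a (s, t), fun s t => b (s, t), fun s t => q (s, t), fun s t => h1 (s, t),
      fun s t => h2 (s, t), fun s t => h3 (s, t), fun s t => h4 (s, t), ?_⟩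
    intro s t hst v hv hv'
    have := f3 _ _ _ (h5 s v hv) (h5 t v hv')
    apply hst
    have h6 := hi s
    rw [this, hi t] at h6
    exact (Sum.inr_injective h6).symm
  · right
    push Not at hM
    obtain ⟨S, hS, hcard⟩ := hM
    have : ∃ s ∈ A, s ∉ S := by
      by_contra hcon
      push Not at hcon
      have := Finset.card_le_card (show A ⊆ S from hcon)
      omega
    obtain ⟨s, hsA, hsS⟩ := this
    obtain ⟨s, -, rfl⟩ := Finset.mem_image.1 hsA
    refine ⟨{s.1}, by simp, {v | Sum.inl v ∈ S}, ?_, ?_⟩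
    · refine lt_of_le_of_lt ?_ hcard
      rw [← Set.ncard_coe_finset S, ← Set.ncard_image_of_injective _ (Sum.inl_injective (β := Fin ℓ × Fin k))]
      apply Set.ncard_le_ncard _ (Finset.finite_toSet S)
      rintro _ ⟨v, hv, rfl⟩
      exact hv
    · intro x hx y hy p
      simp only [Set.mem_singleton_iff, Set.iUnion_iUnion_eq_left] at hx
      obtain ⟨t, u, t1, t2, t3⟩ := m_unwalk (k := k) G X p
      obtain ⟨v, hv, hvS⟩ := hS (Sum.inr s :: Sum.inl x :: t) ⟨by
        rw [hE, List.isChain_cons_cons]; exact ⟨hx, t3⟩, ⟨_, hsA, _, rfl⟩,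
        ⟨Sum.inl y, Finset.mem_filter.2 ⟨Finset.mem_univ _, y, hy, rfl⟩, Sum.inr s :: u, by rw [t2]; rfl⟩⟩
      rcases List.mem_cons.1 hv with rfl | hv
      · exact absurd hvS hsS
      · rw [← t1] at hv
        obtain ⟨w, hw, rfl⟩ := List.mem_map.1 hv
        exact ⟨w, hw, hvS⟩
end

section
/- Let t and q be positive integers, and let (G,χ) be a q-colorful graph containing p ≥ ⌊(3/2)·tq⌋ + t pairwise vertex-disjoint connected subgraphs G_1,…,G_p such that for all i ≠ j ∈ [p] some edge of G joins G_i and G_j. Then at least one of the following holds: (1) there is a separation (A,B) of G of order less than tq, a non-empty set I ⊆ [q] such that every vertex of G whose palette meets I lies in A, and an index j ∈ [p] with V(G_j) ∩ A = ∅; or (2) with p' = (q+1)t, there exist pairwise vertex-disjoint subgraphs H_1,…,H_{p'} of G such that: for every i ∈ [q] and every j with (i−1)t+1 ≤ j ≤ it, color i appears on some vertex of H_j; for every j ∈ [p'], either H_j is connected, or there is i ∈ [q] with (i−1)t+1 ≤ j ≤ it such that every component of H_j contains a vertex whose palette contains i; and for all i ≠ j ∈ [p'], either some edge of G joins H_i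 and H_j, or both i,j ∈ [tq]. -/
open SimpleGraph

/-- A separation of `G`: a pair of vertex sets covering `V(G)` with no edge
between `A∖B` and `B∖A`. Its order is `|A ∩ B|`. -/
def IsSeparation {V : Type*} (G : SimpleGraph V) (A B : Set V) : Prop :=
  A ∪ B = Set.univ ∧ ∀ a ∈ A \ B, ∀ b ∈ B \ A, ¬ G.Adj a b


namespace LCC

/-- cut-connectedness of a vertex set -/
def Cn {V : Type*} (G : SimpleGraph V) (T : Set V) : Prop :=
  T.Nonempty ∧ ∀ X : Set V, X ⊆ T → X.Nonempty → (T \ X).Nonempty →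
    ∃ x ∈ X, ∃ y ∈ T \ X, G.Adj x y

theorem Cn.single {V : Type*} (G : SimpleGraph V) (v : V) : Cn G {v} := by
  refine ⟨⟨v, rfl⟩, ?_⟩
  rintro X hX ⟨x, hx⟩ ⟨y, hy, hyX⟩
  have h1 := hX hx
  simp only [Set.mem_singleton_iff] at h1 hy
  subst h1; subst hy
  exact absurd hx hyX

theorem Cn.mono {V : Type*} {G G' : SimpleGraph V} {T : Set V} (h : Cn G T)
    (hG : ∀ x ∈ T, ∀ y ∈ T, G.Adj x y → G'.Adj x y) : Cn G' T := by
  refine ⟨h.1, fun X hX h1 h2 => ?_⟩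
  obtain ⟨x, hx, y, hy, hxy⟩ := h.2 X hX h1 h2
  exact ⟨x, hx, y, hy, hG x (hX hx) y hy.1 hxy⟩

theorem Cn.cross {V : Type*} {G : SimpleGraph V} {T : Set V} (h : Cn G T) (X : Set V)
    (h1 : (T ∩ X).Nonempty) (h2 : (T \ X).Nonempty) :
    ∃ x ∈ T, x ∈ X ∧ ∃ y ∈ T, y ∉ X ∧ G.Adj x y := by
  obtain ⟨x, hx, y, hy, hxy⟩ := h.2 (T ∩ X) Set.inter_subset_left h1 (by
    obtain ⟨y, hy, hyX⟩ := h2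
    exact ⟨y, hy, fun h => hyX h.2⟩)
  exact ⟨x, hx.1, hx.2, y, hy.1, fun h => hy.2 ⟨hy.1, h⟩, hxy⟩

theorem Cn.intro {V : Type*} {G : SimpleGraph V} {T : Set V} (h0 : T.Nonempty)
    (h : ∀ X : Set V, (T ∩ X).Nonempty → (T \ X).Nonempty →
      ∃ x ∈ T, x ∈ X ∧ ∃ y ∈ T, y ∉ X ∧ G.Adj x y) : Cn G T := by
  refine ⟨h0, fun X hX h1 h2 => ?_⟩
  obtain ⟨x, hx, hxX, y, hy, hyX, hxy⟩ := h X (by rwa [Set.inter_eq_right.2 hX]) h2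
  exact ⟨x, hxX, y, ⟨hy, hyX⟩, hxy⟩

/-- rooted criterion -/
theorem Cn.intro_root {V : Type*} {G : SimpleGraph V} {T : Set V} (r : V) (hr : r ∈ T)
    (h : ∀ X : Set V, (T ∩ X).Nonempty → r ∉ X →
      ∃ x ∈ T, x ∈ X ∧ ∃ y ∈ T, y ∉ X ∧ G.Adj x y) : Cn G T := by
  refine Cn.intro ⟨r, hr⟩ fun X h1 h2 => ?_
  by_cases hrX : r ∈ X
  · obtain ⟨x, hx, hxX, y, hy, hyX, hxy⟩ := h Xᶜ h2 (by simpa using hrX)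
    exact ⟨y, hy, by simpa using hyX, x, hx, hxX, hxy.symm⟩
  · exact h X h1 hrX

theorem Cn.union {V : Type*} {G : SimpleGraph V} {S T : Set V} (hS : Cn G S) (hT : Cn G T)
    (h : (∃ x ∈ S, x ∈ T) ∨ ∃ x ∈ S, ∃ y ∈ T, G.Adj x y) : Cn G (S ∪ T) := by
  refine Cn.intro (hS.1.mono Set.subset_union_left) fun X h1 h2 => ?_
  by_cases a : (S ∩ X).Nonempty ∧ (S \ X).Nonempty
  · obtain ⟨x, hx, hxX, y, hy, hyX, hxy⟩ := hS.cross X a.1 a.2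
    exact ⟨x, Or.inl hx, hxX, y, Or.inl hy, hyX, hxy⟩
  by_cases b : (T ∩ X).Nonempty ∧ (T \ X).Nonempty
  · obtain ⟨x, hx, hxX, y, hy, hyX, hxy⟩ := hT.cross X b.1 b.2
    exact ⟨x, Or.inr hx, hxX, y, Or.inr hy, hyX, hxy⟩
  have aS : (∀ s ∈ S, s ∈ X) ∨ (∀ s ∈ S, s ∉ X) := by
    by_contra hc
    push Not at hc
    obtain ⟨⟨s, hs, hs'⟩, s2, hs2, hs2'⟩ := hc
    exact a ⟨⟨s2, hs2, hs2'⟩, ⟨s, hs, hs'⟩⟩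
  have aT : (∀ s ∈ T, s ∈ X) ∨ (∀ s ∈ T, s ∉ X) := by
    by_contra hc
    push Not at hc
    obtain ⟨⟨s, hs, hs'⟩, s2, hs2, hs2'⟩ := hc
    exact b ⟨⟨s2, hs2, hs2'⟩, ⟨s, hs, hs'⟩⟩
  obtain ⟨u, hu, huX⟩ := h1
  obtain ⟨v, hv, hvX⟩ := h2
  rcases h with ⟨x, hx, hx'⟩ | ⟨x, hx, y, hy, hxy⟩
  · exfalso
    rcases aS with aS | aS <;> rcases aT with aT | aT <;> rcases hu with hu | hu <;>
      rcases hv with hv | hv <;> grind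
  · rcases aS with aS | aS <;> rcases aT with aT | aT
    · grind
    · exact ⟨x, Or.inl hx, aS x hx, y, Or.inr hy, aT y hy, hxy⟩
    · exact ⟨y, Or.inr hy, aT y hy, x, Or.inl hx, aS x hx, hxy.symm⟩
    · grind

/-- a connected set meeting the separator at most in one vertex, restricted to a side -/
theorem Cn.side {V : Type*} {G : SimpleGraph V} {A B T : Set V} (hs : IsSeparation G A B)
    (hT : Cn G T) (s : V) (hsT : s ∈ T) (hsA : s ∈ A) (h1 : ∀ x ∈ T, x ∈ A → x ∈ B → x = s) :
    Cn G (T ∩ A) := by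
  refine Cn.intro_root s ⟨hsT, hsA⟩ fun X hX hsX => ?_
  obtain ⟨x, ⟨hx, hxA⟩, hxX⟩ := hX
  obtain ⟨x, hx, hxX, y, hy, hyX, hxy⟩ := hT.cross (X ∩ A) ⟨x, hx, hxX, hxA⟩
    ⟨s, hsT, fun h => hsX h.1⟩
  have hxB : x ∉ B := fun hB => hsX (h1 x hx hxX.2 hB ▸ hxX.1)
  have hyA : y ∈ A := by
    by_contra hyA
    have : y ∈ B := by
      have := hs.1.symm ▸ Set.mem_univ y
      exact this.resolve_left hyA
    exact hs.2 x ⟨hxX.2, hxB⟩ y ⟨this, hyA⟩ hxy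
  exact ⟨x, ⟨hx, hxX.2⟩, hxX.1, y, ⟨hy, hyA⟩, fun h => hyX ⟨h, hyA⟩, hxy⟩

theorem sep_symm {V : Type*} {G : SimpleGraph V} {A B : Set V} (hs : IsSeparation G A B) :
    IsSeparation G B A :=
  ⟨by rw [Set.union_comm]; exact hs.1, fun a ha b hb h => hs.2 b hb a ha h.symm⟩

theorem sep_or {V : Type*} {G : SimpleGraph V} {A B : Set V} (hs : IsSeparation G A B) (v : V) :
    v ∈ A ∨ v ∈ B := by
  have := hs.1.symm ▸ Set.mem_univ v
  exact this

/-- half of the Menger step -/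
theorem menger_half {V : Type*} [Finite V] {G G' : SimpleGraph V} (X Y : Set V) (k : ℕ)
    (hk : ∀ A B, IsSeparation G A B → X ⊆ A → Y ⊆ B → k ≤ (A ∩ B).ncard)
    (x y : V) (hG : ∀ a b, G.Adj a b → G'.Adj a b ∨ (a = x ∧ b = y) ∨ (a = y ∧ b = x))
    (A B : Set V) (hs : IsSeparation G' A B) (hX : X ⊆ A) (hY : Y ⊆ B) (hy : y ∈ B)
    (C D : Set V) (hCD : IsSeparation G' C D) (hXC : X ⊆ C) (hSD : insert x (A ∩ B) ⊆ D) :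
    k ≤ (C ∩ D).ncard := by
  have hxD : x ∈ D := hSD (Set.mem_insert _ _)
  have hSD' : ∀ v, v ∈ A → v ∈ B → v ∈ D := fun v h1 h2 => hSD (Set.mem_insert_of_mem _ ⟨h1, h2⟩)
  refine (hk (A ∩ C) (D ∪ B) ⟨?_, ?_⟩ (fun v hv => ⟨hX hv, hXC hv⟩)
    (fun v hv => Or.inr (hY hv))).trans (Set.ncard_le_ncard ?_ (Set.toFinite _))
  · ext v
    have := sep_or hs v
    have := sep_or hCD v
    simp only [Set.mem_union, Set.mem_inter_iff, Set.mem_univ]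
    tauto
  · rintro a ⟨⟨haA, haC⟩, ha⟩ b ⟨hb, hb'⟩ hab
    have haD : a ∉ D := fun h => ha (Or.inl h)
    have haB : a ∉ B := fun h => ha (Or.inr h)
    have hab' : G'.Adj a b := by
      rcases hG a b hab with h | ⟨h, _⟩ | ⟨h, _⟩
      · exact h
      · exact absurd (h ▸ hxD) haD
      · exact absurd (h ▸ hy) haB
    by_cases hbA : b ∈ A
    · have hbC : b ∉ C := fun h => hb' ⟨hbA, h⟩
      exact hCD.2 a ⟨haC, haD⟩ b ⟨(sep_or hCD b).resolve_left hbC, hbC⟩ hab'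
    · exact hs.2 a ⟨haA, haB⟩ b ⟨(sep_or hs b).resolve_left hbA, hbA⟩ hab'
  · rintro v ⟨⟨h1, h2⟩, h3 | h3⟩
    · exact ⟨h2, h3⟩
    · exact ⟨h2, hSD' v h1 h3⟩

/-- reindexing a family of disjoint sets by their vertices in a set of the same size -/
theorem reindex {V : Type*} [Finite V] (k : ℕ) (Y : Set V) (hY : Y.ncard = k)
    (P : Fin k → Set V) (hd : Pairwise fun i j => Disjoint (P i) (P j))
    (hm : ∀ i, ∃ y ∈ P i, y ∈ Y) :
    ∃ Q : V → Set V, (∀ y ∈ Y, ∃ i, Q y = P i) ∧ (∀ y ∈ Y, y ∈ Q y) ∧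
      (∀ y ∈ Y, ∀ y' ∈ Y, y' ∈ Q y → y' = y) ∧
      (∀ y ∈ Y, ∀ y' ∈ Y, y ≠ y' → Disjoint (Q y) (Q y')) := by
  classical
  choose f hf hfY using hm
  have key : ∀ i j v, v ∈ P i → v ∈ P j → i = j := by
    intro i j v h1 h2
    by_contra h
    exact Set.disjoint_left.1 (hd h) h1 h2
  have finj : Function.Injective f := fun i j h => key i j (f i) (hf i) (h ▸ hf j)
  have hr : Set.range f = Y := by
    apply Set.eq_of_subset_of_ncard_le
    · rintro _ ⟨i, rfl⟩; exact hfY i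
    · rw [hY, ← Set.image_univ, Set.ncard_image_of_injective _ finj]
      simp [Set.ncard_univ]
    · exact Set.toFinite _
  have hk : ∀ y, ∃ S : Set V, y ∈ Y → ∃ i, f i = y ∧ S = P i := fun y => by
    by_cases hy : y ∈ Y
    · rw [← hr] at hy
      obtain ⟨i, hi⟩ := hy
      exact ⟨P i, fun _ => ⟨i, hi, rfl⟩⟩
    · exact ⟨∅, fun h => absurd h hy⟩
  choose Q hQ using hk
  refine ⟨Q, ?_, ?_, ?_, ?_⟩
  · intro y hy
    obtain ⟨i, _, h⟩ := hQ y hy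
    exact ⟨i, h⟩
  · intro y hy
    obtain ⟨i, h1, h⟩ := hQ y hy
    rw [h, ← h1]; exact hf i
  · intro y hy y' hy' hyy
    obtain ⟨i, h1, h⟩ := hQ y hy
    obtain ⟨j, h2, h'⟩ := hQ y' hy'
    rw [h] at hyy
    rw [← h1, ← h2, key j i y' (h2 ▸ hf j) hyy]
  · intro y hy y' hy' hne
    obtain ⟨i, h1, h⟩ := hQ y hy
    obtain ⟨j, h2, h'⟩ := hQ y' hy'
    rw [h, h']
    apply hd
    rintro rfl
    exact hne (h1.symm.trans h2)

/-- Menger -/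
theorem menger {V : Type*} [Finite V] (G : SimpleGraph V) : ∀ (X Y : Set V) (k : ℕ),
    (∀ A B, IsSeparation G A B → X ⊆ A → Y ⊆ B → k ≤ (A ∩ B).ncard) →
    ∃ P : Fin k → Set V, (Pairwise fun i j => Disjoint (P i) (P j)) ∧ (∀ i, Cn G (P i)) ∧
      (∀ i, ∃ x ∈ P i, x ∈ X) ∧ (∀ i, ∃ x ∈ P i, x ∈ Y) := by
  classical
  induction G using WellFoundedLT.induction with
  | _ G ih =>
  intro X Y k hk
  by_cases hE : ∃ x y, G.Adj x y
  swap
  · push Not at hE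
    have h := hk X (Xᶜ ∪ Y) ⟨by ext v; simp; tauto, fun a _ b _ => hE a b⟩ subset_rfl
      Set.subset_union_right
    have h2 : X ∩ (Xᶜ ∪ Y) = X ∩ Y := by ext v; simp; tauto
    rw [h2] at h
    obtain ⟨S, hS, hSk⟩ := Set.exists_subset_card_eq h
    have := Fintype.ofFinite S
    have e : Fin k ≃ S := by
      apply Fintype.equivOfCardEq
      rw [← hSk]; simp
    refine ⟨fun i => {(e i : V)}, ?_, fun i => Cn.single _ _, fun i => ⟨_, rfl, (hS (e i).2).1⟩,
      fun i => ⟨_, rfl, (hS (e i).2).2⟩⟩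
    intro i j hij
    simp only [Set.disjoint_singleton]
    intro h
    exact hij (e.injective (Subtype.ext h))
  · obtain ⟨x0, y0, hxy0⟩ := hE
    let G' := G.deleteEdges {s(x0, y0)}
    have hlt : G' < G := by
      refine lt_of_le_of_ne (SimpleGraph.deleteEdges_le _) fun h => ?_
      have : G'.Adj x0 y0 := h ▸ hxy0
      simp [G'] at this
    by_cases hG' : ∀ A B, IsSeparation G' A B → X ⊆ A → Y ⊆ B → k ≤ (A ∩ B).ncard
    · obtain ⟨P, h1, h2, h3⟩ := ih G' hlt X Y k hG'
      exact ⟨P, h1, fun i => (h2 i).mono fun x _ y _ h => hlt.le h, h3⟩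
    push Not at hG'
    obtain ⟨A, B, hs, hXA, hYB, hcard⟩ := hG'
    have hGG : ∀ a b, G.Adj a b → G'.Adj a b ∨ (a = x0 ∧ b = y0) ∨ (a = y0 ∧ b = x0) := by
      intro a b hab
      by_cases h : s(a, b) = s(x0, y0)
      · right; simpa using h
      · left; simp only [G', SimpleGraph.deleteEdges_adj]; exact ⟨hab, h⟩
    have hns : ¬ IsSeparation G A B := fun h => absurd (hk A B h hXA hYB) (by omega)
    obtain ⟨x, y, hxy, hx, hy, hGG⟩ : ∃ x y, G.Adj x y ∧ x ∈ A \ B ∧ y ∈ B \ A ∧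
        ∀ a b, G.Adj a b → G'.Adj a b ∨ (a = x ∧ b = y) ∨ (a = y ∧ b = x) := by
      by_contra hc
      push Not at hc
      apply hns
      refine ⟨hs.1, fun a ha b hb hab => ?_⟩
      rcases hGG a b hab with h | ⟨h, h'⟩ | ⟨h, h'⟩
      · exact hs.2 a ha b hb h
      · subst h h'
        obtain ⟨c, d, h1, h2, h3⟩ := hc a b hab ha hb
        have := hGG c d h1
        tauto
      · subst h h'
        obtain ⟨c, d, h1, h2, h3⟩ := hc a b hab ha hb
        have := hGG c d h1
        tauto
    have hxA := hx.1
    have hxB := hx.2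
    have hyB := hy.1
    have hyA := hy.2
    have hsx : (insert x (A ∩ B)).ncard = k := by
      have h1 : (insert x (A ∩ B)).ncard = (A ∩ B).ncard + 1 :=
        Set.ncard_insert_of_notMem (fun h => hxB h.2) (Set.toFinite _)
      have h2 := hk A (insert x B) ⟨by
          ext v; have := sep_or hs v; simp; tauto, by
          rintro a ⟨ha, ha'⟩ b ⟨hb, hb'⟩ hab
          have hax : a ≠ x := fun h => ha' (Or.inl h)
          have haB : a ∉ B := fun h => ha' (Or.inr h)
          have hbB : b ∈ B := by
            rcases hb with h | h
            · exact absurd (h ▸ hxA) hb'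
            · exact h
          rcases hGG a b hab with h | ⟨h, _⟩ | ⟨h, _⟩
          · exact hs.2 a ⟨ha, haB⟩ b ⟨hbB, hb'⟩ h
          · exact hax h
          · exact haB (h ▸ hyB)⟩ hXA (hYB.trans (Set.subset_insert _ _))
      have h3 : A ∩ insert x B = insert x (A ∩ B) := by
        ext v; simp only [Set.mem_inter_iff, Set.mem_insert_iff]
        constructor
        · tauto
        · rintro (rfl | h)
          · exact ⟨hxA, Or.inl rfl⟩
          · tauto
      rw [h3] at h2
      omega
    have hsy : (insert y (B ∩ A)).ncard = k := by
      have h1 : (insert x (A ∩ B)).ncard = (A ∩ B).ncard + 1 :=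
        Set.ncard_insert_of_notMem (fun h => hxB h.2) (Set.toFinite _)
      have h2 : (insert y (B ∩ A)).ncard = (B ∩ A).ncard + 1 :=
        Set.ncard_insert_of_notMem (fun h => hyA h.2) (Set.toFinite _)
      rw [Set.inter_comm] at h2
      rw [Set.inter_comm]
      omega
    obtain ⟨P, hP1, hP2, hP3, hP4⟩ := ih G' hlt X (insert x (A ∩ B)) k
      (fun C D hCD h1 h2 => menger_half X Y k hk x y hGG A B hs hXA hYB hyB C D hCD h1 h2)
    obtain ⟨Q, hQ1, hQ2, hQ3, hQ4⟩ := ih G' hlt Y (insert y (B ∩ A)) k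
      (fun C D hCD h1 h2 => menger_half Y X k
        (fun A' B' h h1 h2 => by rw [Set.inter_comm]; exact hk B' A' (sep_symm h) h2 h1) y x
        (fun a b hab => by have := hGG a b hab; tauto) B A (sep_symm hs) hYB hXA hxA C D hCD h1 h2)
    obtain ⟨P', hp1, hp2, hp3, hp4⟩ := reindex k _ hsx P hP1 hP4
    obtain ⟨Q', hq1, hq2, hq3, hq4⟩ := reindex k _ hsy Q hQ1 hQ4
    have := Fintype.ofFinite (insert x (A ∩ B) : Set V)
    have e : Fin k ≃ (insert x (A ∩ B) : Set V) := by
      apply Fintype.equivOfCardEq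
      rw [← hsx]; simp
    let m : V → V := fun s => if s = x then y else s
    have hm : ∀ s ∈ insert x (A ∩ B), m s ∈ insert y (B ∩ A) := by
      intro s hs
      by_cases h : s = x
      · simp [m, h]
      · simp only [m, h, if_false]
        rcases hs with h' | h'
        · exact absurd h' h
        · exact Or.inr ⟨h'.2, h'.1⟩
    have hSA : ∀ s ∈ insert x (A ∩ B), s ∈ A := by
      rintro s (h | h)
      · exact h ▸ hxA
      · exact h.1
    have hSB : ∀ s ∈ insert y (B ∩ A), s ∈ B := by
      rintro s (h | h)
      · exact h ▸ hyB
      · exact h.1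
    have hmne : ∀ s ∈ insert x (A ∩ B), ∀ s' ∈ insert x (A ∩ B), s ≠ s' → m s ≠ m s' := by
      intro s hs s' hs' hne
      have a1 : s ≠ y := fun h => hyA (h ▸ hSA s hs)
      have a2 : s' ≠ y := fun h => hyA (h ▸ hSA s' hs')
      simp only [m]
      split_ifs <;> grind
    have hcross : ∀ s ∈ insert x (A ∩ B), ∀ s' ∈ insert x (A ∩ B), s ≠ s' →
        Disjoint (P' s ∩ A) (Q' (m s') ∩ B) := by
      intro s hs s' hs' hne
      rw [Set.disjoint_left]
      rintro v ⟨hv, hvA⟩ ⟨hv', hvB⟩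
      have h1 := hp3 s hs v (Or.inr ⟨hvA, hvB⟩) hv
      have h2 := hq3 (m s') (hm s' hs') v (Or.inr ⟨hvB, hvA⟩) hv'
      have a1 : s ≠ y := fun h => hyA (h ▸ hSA s hs)
      simp only [m] at h2
      split_ifs at h2 <;> grind
    refine ⟨fun i => (P' (e i) ∩ A) ∪ (Q' (m (e i)) ∩ B), ?_, ?_, ?_, ?_⟩
    · intro i j hij
      have hne : ((e i : V)) ≠ e j := fun h => hij (e.injective (Subtype.ext h))
      simp only [Set.disjoint_union_left, Set.disjoint_union_right]
      refine ⟨⟨?_, ?_⟩, ?_, ?_⟩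
      · exact (hp4 _ (e i).2 _ (e j).2 hne).mono Set.inter_subset_left Set.inter_subset_left
      · exact (hcross _ (e j).2 _ (e i).2 hne.symm).symm
      · exact hcross _ (e i).2 _ (e j).2 hne
      · exact (hq4 _ (hm _ (e i).2) _ (hm _ (e j).2) (hmne _ (e i).2 _ (e j).2 hne)).mono
          Set.inter_subset_left Set.inter_subset_left
    · intro i
      have hs' := (e i).2
      dsimp only
      generalize (e i : V) = s at hs' ⊢
      obtain ⟨ip, hip⟩ := hp1 s hs'
      obtain ⟨iq, hiq⟩ := hq1 (m s) (hm s hs')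
      have c1 : Cn G (P' s ∩ A) := by
        refine (Cn.side hs (hip ▸ hP2 ip) s (hp2 s hs') (hSA s hs') ?_).mono
          fun a _ b _ h => hlt.le h
        intro v hv hvA hvB
        exact hp3 s hs' v (Or.inr ⟨hvA, hvB⟩) hv
      have c2 : Cn G (Q' (m s) ∩ B) := by
        refine (Cn.side (sep_symm hs) (hiq ▸ hQ2 iq) (m s) (hq2 _ (hm s hs'))
          (hSB _ (hm s hs')) ?_).mono fun a _ b _ h => hlt.le h
        intro v hv hvB hvA
        exact hq3 _ (hm s hs') v (Or.inr ⟨hvB, hvA⟩) hv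
      refine c1.union c2 ?_
      by_cases h : s = x
      · right
        refine ⟨s, ⟨hp2 s hs', hSA s hs'⟩, m s, ⟨hq2 _ (hm s hs'), hSB _ (hm s hs')⟩, ?_⟩
        simpa [m, h] using hxy
      · left
        have hms : m s = s := by simp [m, h]
        exact ⟨s, ⟨hp2 s hs', hSA s hs'⟩, by
          have := hq2 _ (hm s hs')
          have h3 := hSB _ (hm s hs')
          rw [hms] at *
          exact ⟨this, h3⟩⟩
    · intro i
      obtain ⟨ip, hip⟩ := hp1 _ (e i).2
      obtain ⟨v, hv, hvX⟩ := hP3 ip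
      exact ⟨v, Or.inl ⟨hip ▸ hv, hXA hvX⟩, hvX⟩
    · intro i
      obtain ⟨iq, hiq⟩ := hq1 _ (hm _ (e i).2)
      obtain ⟨v, hv, hvY⟩ := hQ3 iq
      exact ⟨v, Or.inr ⟨hiq ▸ hv, hYB hvY⟩, hvY⟩

end LCC

namespace LCC

theorem Cn.subU {V : Type*} {G : SimpleGraph V} {T U : Set V} (h : Cn G T)
    (hU : ∀ x y, G.Adj x y → x ∈ U ∧ y ∈ U) (z : V) (hz : z ∈ T) (hzU : z ∈ U) : T ⊆ U := by
  intro w hw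
  by_contra hwU
  obtain ⟨x, _, _, y, _, hy, hxy⟩ := h.cross U ⟨z, hz, hzU⟩ ⟨w, hw, hwU⟩
  exact hy (hU x y hxy).2

/-- shrink a connected set to one meeting `Y` exactly once -/
theorem Cn.shrink {V : Type*} [Finite V] {G : SimpleGraph V} {T Y : Set V} (h : Cn G T) (z : V)
    (hz : z ∈ T) (hY : ∃ y ∈ T, y ∈ Y) :
    ∃ S ⊆ T, Cn G S ∧ z ∈ S ∧ ∃ c ∈ S, c ∈ Y ∧ ∀ y ∈ S, y ∈ Y → y = c := by
  by_cases hzY : z ∈ Y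
  · exact ⟨{z}, by simpa using hz, Cn.single _ _, rfl, z, rfl, hzY, fun y hy _ => hy⟩
  -- a maximal connected subset avoiding `Y`
  obtain ⟨K, hK⟩ := Set.Finite.exists_maximal
    (Set.toFinite {K : Set V | K ⊆ T ∧ Cn G K ∧ z ∈ K ∧ ∀ y ∈ K, y ∉ Y})
    ⟨{z}, by simpa using hz, Cn.single _ _, rfl, by rintro y rfl; exact hzY⟩
  obtain ⟨⟨hKT, hKc, hzK, hKY⟩, hmax⟩ := hK
  obtain ⟨y, hy, hyY⟩ := hY
  obtain ⟨a, haT, haK, b, hbT, hbK, hab⟩ := h.cross K ⟨z, hz, hzK⟩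
    ⟨y, hy, fun h => hKY y h hyY⟩
  have hc : Cn G (K ∪ {b}) := hKc.union (Cn.single _ _) (Or.inr ⟨a, haK, b, rfl, hab⟩)
  have hsub : K ∪ {b} ⊆ T := Set.union_subset hKT (by simpa using hbT)
  have hbY : b ∈ Y := by
    by_contra hbY
    apply hbK
    refine hmax (y := K ∪ {b}) ⟨hsub, hc, Or.inl hzK, ?_⟩ Set.subset_union_left (Or.inr rfl)
    rintro v (hv | rfl)
    · exact hKY v hv
    · exact hbY
  refine ⟨K ∪ {b}, hsub, hc, Or.inl hzK, b, Or.inr rfl, hbY, ?_⟩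
  rintro v (hv | hv) hvY
  · exact absurd hvY (hKY v hv)
  · exact hv

/-- the conclusion of the main lemma -/
def Concl {V : Type*} (t : ℕ) {p : ℕ} (G : SimpleGraph V) (U Z : Set V) (Gs : Fin p → Set V) :
    Prop :=
  ∃ (T : V → Set V) (W : Fin t → Set V),
    (∀ z ∈ Z, Cn G (T z)) ∧ (∀ z ∈ Z, z ∈ T z) ∧ (∀ z ∈ Z, T z ⊆ U) ∧
    (∀ z ∈ Z, ∀ z' ∈ Z, z' ∈ T z → z' = z) ∧
    (∀ z ∈ Z, ∀ z' ∈ Z, z ≠ z' → Disjoint (T z) (T z')) ∧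
    (∀ j, Cn G (W j)) ∧ (∀ j, W j ⊆ U) ∧ (∀ j, ∀ z ∈ W j, z ∉ Z) ∧
    (Pairwise fun i j => Disjoint (W i) (W j)) ∧
    (∀ z ∈ Z, ∀ j, Disjoint (T z) (W j)) ∧
    (∀ i j, i ≠ j → ∃ x ∈ W i, ∃ y ∈ W j, G.Adj x y) ∧
    (∀ z ∈ Z, ∀ j, ∃ x ∈ T z, ∃ y ∈ W j, G.Adj x y ∧ (x = z → ∃ i, z ∈ Gs i))

/-- the hypotheses of the main lemma -/
structure Hyp {V : Type*} (k : ℕ) {p : ℕ} (G : SimpleGraph V) (U Z : Set V) (Gs : Fin p → Set V) :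
    Prop where
  hU : ∀ x y, G.Adj x y → x ∈ U ∧ y ∈ U
  hZU : Z ⊆ U
  hGU : ∀ i, Gs i ⊆ U
  hZ : Z.ncard = k
  hcl : ∀ x ∈ Z, ∀ y ∈ Z, x ≠ y → G.Adj x y
  hconn : ∀ i, Cn G (Gs i)
  hdisj : Pairwise fun i j => Disjoint (Gs i) (Gs j)
  hadj : ∀ i j : Fin p, i ≠ j → ∃ x ∈ Gs i, ∃ y ∈ Gs j, G.Adj x y
  hsep : ∀ A B, IsSeparation G A B → Z ⊆ A → (∃ j, Gs j ∩ A = ∅) → k ≤ (A ∩ B).ncard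

theorem base {V : Type*} [Finite V] {k t p : ℕ} (hp : 3 * k / 2 + t ≤ p)
    {G : SimpleGraph V} {U Z : Set V} {Gs : Fin p → Set V} (H : Hyp k G U Z Gs)
    (hno : ∀ i, ∀ u ∈ Gs i, ∀ v ∈ Gs i, G.Adj u v → v ∈ Z) : Concl t G U Z Gs := by
  classical
  have key : ∀ i j v, v ∈ Gs i → v ∈ Gs j → i = j := by
    intro i j v h1 h2
    by_contra h
    exact Set.disjoint_left.1 (H.hdisj h) h1 h2
  -- the singleton sets
  let Y : Set V := {v | ∃ i, Gs i = {v}}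
  have hout : ∀ i v, v ∈ Gs i → v ∉ Z → Gs i = {v} := by
    intro i v hv hvZ
    by_contra hne
    have : (Gs i \ {v}).Nonempty := by
      rw [Set.nonempty_iff_ne_empty]
      intro h
      apply hne
      rw [Set.sdiff_eq_empty] at h
      exact Set.Subset.antisymm h (by simpa using hv)
    obtain ⟨x, hx, hx', y, hy, hy', hxy⟩ := (H.hconn i).cross {v} ⟨v, hv, rfl⟩ this
    have hxv : x = v := hx'
    exact hvZ (hxv ▸ hno i y hy x hx hxy.symm)
  have hYcard : k + t ≤ Y.ncard := by
    let I1 : Finset (Fin p) := Finset.univ.filter fun i => ∃ v, Gs i = {v}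
    have hY1 : I1.card ≤ Y.ncard := by
      have : ∀ i, ∃ v, v ∈ Gs i := fun i => (H.hconn i).1
      choose f hf using this
      have hs : f '' (I1 : Set (Fin p)) ⊆ Y := by
        rintro _ ⟨i, hi, rfl⟩
        obtain ⟨v, hv⟩ := (Finset.mem_filter.1 hi).2
        have := hf i
        rw [hv] at this
        exact ⟨i, by rw [hv, this]⟩
      have h2 := Set.ncard_le_ncard hs (Set.toFinite _)
      have finj : Function.Injective f := fun i j h => key i j (f i) (hf i) (h ▸ hf j)
      rwa [Set.ncard_image_of_injective _ finj,
        Set.ncard_coe_finset] at h2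
    have h2 : ∀ i ∈ I1ᶜ, 2 ≤ (Gs i ∩ Z).ncard := by
      intro i hi
      have hi' : ¬ ∃ v, Gs i = {v} := by simpa [I1] using hi
      have hsub : Gs i ⊆ Z := by
        intro v hv
        by_contra hvZ
        exact hi' ⟨v, hout i v hv hvZ⟩
      rw [Set.inter_eq_left.2 hsub]
      by_contra hlt
      have h1 : (Gs i).ncard ≠ 0 := by
        rw [Ne, Set.ncard_eq_zero (Set.toFinite _)]
        exact (H.hconn i).1.ne_empty
      exact hi' (Set.ncard_eq_one.1 (by omega))
    have h3 : (I1ᶜ.biUnion fun i => (Set.toFinite (Gs i ∩ Z)).toFinset).card ≤ k := by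
      rw [← H.hZ, ← Set.ncard_coe_finset]
      apply Set.ncard_le_ncard _ (Set.toFinite _)
      intro v hv
      simp only [Finset.coe_biUnion, Set.mem_iUnion] at hv
      obtain ⟨i, _, hi⟩ := hv
      simp only [Set.Finite.coe_toFinset] at hi
      exact hi.2
    rw [Finset.card_biUnion] at h3
    swap
    · intro i _ j _ hij
      rw [Function.onFun, Finset.disjoint_left]
      intro v hv hv'
      simp only [Set.Finite.mem_toFinset] at hv hv'
      exact hij (key i j v hv.1 hv'.1)
    have h4 : I1ᶜ.card * 2 ≤ k := by
      refine le_trans ?_ h3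
      rw [← smul_eq_mul]
      apply Finset.card_nsmul_le_sum
      intro i hi
      have := h2 i hi
      rwa [Set.ncard_eq_toFinset_card _ (Set.toFinite _)] at this
    have h5 := Finset.card_add_card_compl I1
    rw [Fintype.card_fin] at h5
    omega
  obtain ⟨P, hP1, hP2, hP3, hP4⟩ := menger G Z Y k (by
    intro A B hs hZA hYB
    by_contra hlt
    have : ¬ Y ⊆ A := fun h => by
      have := Set.ncard_le_ncard (Set.subset_inter h hYB) (Set.toFinite _)
      omega
    obtain ⟨c, ⟨j, hj⟩, hcA⟩ := Set.not_subset.1 this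
    exact hlt (H.hsep A B hs hZA ⟨j, by rw [hj]; simpa using hcA⟩))
  obtain ⟨Q, hq1, hq2, hq3, hq4⟩ := reindex k Z H.hZ P hP1 hP3
  have hS : ∀ z, ∃ (S : Set V) (c : V), z ∈ Z → S ⊆ Q z ∧ Cn G S ∧ z ∈ S ∧ c ∈ S ∧ c ∈ Y ∧
      ∀ y ∈ S, y ∈ Y → y = c := by
    intro z
    by_cases hz : z ∈ Z
    · obtain ⟨i, hi⟩ := hq1 z hz
      obtain ⟨S, h1, h2, h3, c, h4⟩ := Cn.shrink (hi ▸ hP2 i : Cn G (Q z)) z (hq2 z hz)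
        (by rw [hi]; exact hP4 i)
      exact ⟨S, c, fun _ => ⟨h1, h2, h3, h4⟩⟩
    · exact ⟨∅, z, fun h => absurd h hz⟩
  choose T c hT using hS
  have hdis : ∀ z ∈ Z, ∀ z' ∈ Z, z ≠ z' → Disjoint (T z) (T z') := fun z hz z' hz' hne =>
    (hq4 z hz z' hz' hne).mono (hT z hz).1 (hT z' hz').1
  have hDcard : t ≤ (Y \ c '' Z).ncard := by
    have h1 := Set.le_ncard_sdiff (c '' Z) Y (Set.toFinite _)
    have h2 : (c '' Z).ncard ≤ k := H.hZ ▸ Set.ncard_image_le (Set.toFinite _)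
    omega
  obtain ⟨D, hD, hDt⟩ := Set.exists_subset_card_eq hDcard
  have := Fintype.ofFinite D
  have e : Fin t ≃ D := by
    apply Fintype.equivOfCardEq
    rw [← hDt]; simp
  have hadjY : ∀ a ∈ Y, ∀ b ∈ Y, a ≠ b → G.Adj a b := by
    rintro a ⟨i, hi⟩ b ⟨j, hj⟩ hne
    obtain ⟨x, hx, y, hy, hxy⟩ := H.hadj i j (by
      rintro rfl
      exact hne (Set.singleton_injective (hi.symm.trans hj)))
    rw [hi] at hx; rw [hj] at hy
    rw [Set.mem_singleton_iff] at hx hy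
    exact hx ▸ hy ▸ hxy
  have hene : ∀ i j, i ≠ j → (e i : V) ≠ e j := fun i j hij h =>
    hij (e.injective (Subtype.ext h))
  have hcD : ∀ z ∈ Z, ∀ j, c z ≠ e j := fun z hz j h => (hD (e j).2).2 ⟨z, hz, h⟩
  have hYU : Y ⊆ U := by
    rintro v ⟨i, hi⟩
    exact H.hGU i (hi ▸ rfl)
  refine ⟨T, fun j => {(e j : V)}, fun z hz => (hT z hz).2.1, fun z hz => (hT z hz).2.2.1,
    fun z hz => (hT z hz).2.1.subU H.hU z (hT z hz).2.2.1 (H.hZU hz), ?_, hdis,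
    fun j => Cn.single _ _, ?_, ?_, ?_, ?_, ?_, ?_⟩
  · intro z hz z' hz' h
    exact hq3 z hz z' hz' ((hT z hz).1 h)
  · intro j v hv
    rw [Set.mem_singleton_iff] at hv
    exact hYU (hv ▸ (hD (e j).2).1)
  · intro j z hz hzZ
    rw [Set.mem_singleton_iff] at hz
    have hzY : z ∈ Y := hz ▸ (hD (e j).2).1
    have := (hT z hzZ).2.2.2.2.2 z (hT z hzZ).2.2.1 hzY
    exact hcD z hzZ j (this.symm.trans hz)
  · intro i j hij
    simpa using hene i j hij
  · intro z hz j
    rw [Set.disjoint_singleton_right]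
    intro h
    exact hcD z hz j ((hT z hz).2.2.2.2.2 _ h (hD (e j).2).1).symm
  · intro i j hij
    exact ⟨_, rfl, _, rfl, hadjY _ (hD (e i).2).1 _ (hD (e j).2).1 (hene i j hij)⟩
  · intro z hz j
    refine ⟨c z, (hT z hz).2.2.2.1, _, rfl, hadjY _ (hT z hz).2.2.2.2.1 _ (hD (e j).2).1
      (hcD z hz j), fun h => ?_⟩
    obtain ⟨i, hi⟩ := (hT z hz).2.2.2.2.1
    exact ⟨i, by rw [hi, h]; rfl⟩

end LCC

namespace LCC

/-- contraction -/
def ctr {V : Type*} (G : SimpleGraph V) (f : V → V) : SimpleGraph V where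
  Adj x y := x ≠ y ∧ ∃ a b, f a = x ∧ f b = y ∧ G.Adj a b
  symm := ⟨by
    rintro x y ⟨h, a, b, ha, hb, hab⟩
    exact ⟨h.symm, b, a, hb, ha, hab.symm⟩⟩
  loopless := ⟨fun x h => h.1 rfl⟩

/-- restriction to one side, with the separator made a clique -/
def rst {V : Type*} (G : SimpleGraph V) (A B : Set V) : SimpleGraph V where
  Adj x y := x ≠ y ∧ x ∈ B ∧ y ∈ B ∧ (G.Adj x y ∨ (x ∈ A ∧ y ∈ A))
  symm := ⟨by
    rintro x y ⟨h, hx, hy, h'⟩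
    exact ⟨h.symm, hy, hx, h'.imp (fun h => h.symm) fun h => ⟨h.2, h.1⟩⟩⟩
  loopless := ⟨fun x h => h.1 rfl⟩

theorem sep_nbr {V : Type*} {G : SimpleGraph V} {A B : Set V} (hs : IsSeparation G A B) {x y : V}
    (hx : x ∉ A) (h : G.Adj x y) : y ∈ B := by
  by_contra hy
  exact hs.2 y ⟨(sep_or hs y).resolve_right hy, hy⟩ x ⟨(sep_or hs x).resolve_left hx, hx⟩ h.symm

theorem meets {V : Type*} {G : SimpleGraph V} {A B T : Set V} (hs : IsSeparation G A B)
    (hT : Cn G T) (h1 : ∃ x ∈ T, x ∈ A) (h2 : ∃ x ∈ T, x ∈ B) : ∃ x ∈ T, x ∈ A ∧ x ∈ B := by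
  by_contra hc
  push Not at hc
  obtain ⟨a, ha, haA⟩ := h1
  obtain ⟨b, hb, hbB⟩ := h2
  obtain ⟨x, hx, hxA, y, hy, hyA, hxy⟩ := hT.cross A ⟨a, ha, haA⟩ ⟨b, hb, fun h => hc b hb h hbB⟩
  exact hc x hx hxA (sep_nbr hs hyA hxy.symm)

theorem sepHyp {V : Type*} [Finite V] {k p : ℕ}
    {G : SimpleGraph V} {U Z : Set V} {Gs : Fin p → Set V} (H : Hyp k G U Z Gs)
    {A B : Set V} (hs : IsSeparation G A B) (hZA : Z ⊆ A) (hBU : B ⊆ U) (j : Fin p)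
    (hj : Gs j ∩ A = ∅) (hk : (A ∩ B).ncard = k) :
    Hyp k (rst G A B) B (A ∩ B) (fun i => Gs i ∩ B) := by
  have hjA : ∀ x ∈ Gs j, x ∉ A := fun x hx hA => by
    have : x ∈ Gs j ∩ A := ⟨hx, hA⟩
    rw [hj] at this; exact this
  have hjB : ∀ x ∈ Gs j, x ∈ B := fun x hx => (sep_or hs x).resolve_left (hjA x hx)
  have hne : ∀ i, ∃ x ∈ Gs i, x ∈ B := by
    intro i
    by_cases h : i = j
    · subst h
      obtain ⟨x, hx⟩ := (H.hconn i).1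
      exact ⟨x, hx, hjB x hx⟩
    · obtain ⟨x, hx, y, hy, hxy⟩ := H.hadj i j h
      exact ⟨x, hx, sep_nbr hs (hjA y hy) hxy.symm⟩
  have hmeet : ∀ i, (∃ x ∈ Gs i, x ∈ A) → ∃ x ∈ Gs i, x ∈ A ∧ x ∈ B := fun i h =>
    meets hs (H.hconn i) h (hne i)
  refine ⟨fun x y h => ⟨h.2.1, h.2.2.1⟩, Set.inter_subset_right, fun i => Set.inter_subset_right,
    hk, fun x hx y hy h => ⟨h, hx.2, hy.2, Or.inr ⟨hx.1, hy.1⟩⟩, ?_, ?_, ?_, ?_⟩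
  · intro i
    obtain ⟨x, hx, hxB⟩ := hne i
    -- one-sided argument
    have one : ∀ X : Set V, (Gs i ∩ B ∩ X).Nonempty → ((Gs i ∩ B) \ X).Nonempty →
        (∀ v ∈ Gs i ∩ B ∩ X, v ∉ A) →
        ∃ x ∈ Gs i ∩ B, x ∈ X ∧ ∃ y ∈ Gs i ∩ B, y ∉ X ∧ (rst G A B).Adj x y := by
      rintro X ⟨a, ⟨ha, haB⟩, haX⟩ ⟨b, ⟨hb, hbB⟩, hbX⟩ hA
      obtain ⟨x, hx, hxX, y, hy, hyX, hxy⟩ := (H.hconn i).cross (X ∩ B) ⟨a, ha, haX, haB⟩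
        ⟨b, hb, fun h => hbX h.1⟩
      have hyB := sep_nbr hs (hA x ⟨⟨hx, hxX.2⟩, hxX.1⟩) hxy
      exact ⟨x, ⟨hx, hxX.2⟩, hxX.1, y, ⟨hy, hyB⟩, fun h => hyX ⟨h, hyB⟩, hxy.ne, hxX.2, hyB,
        Or.inl hxy⟩
    refine Cn.intro ⟨x, hx, hxB⟩ fun X h1 h2 => ?_
    by_cases c1 : ∀ v ∈ Gs i ∩ B ∩ X, v ∉ A
    · exact one X h1 h2 c1
    by_cases c2 : ∀ v ∈ Gs i ∩ B ∩ Xᶜ, v ∉ A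
    · obtain ⟨x, hx, hxX, y, hy, hyX, hxy⟩ := one Xᶜ h2 (by
        obtain ⟨a, ha, haX⟩ := h1
        exact ⟨a, ha, fun h => h haX⟩) c2
      exact ⟨y, hy, by simpa using hyX, x, hx, hxX, hxy.symm⟩
    push Not at c1 c2
    obtain ⟨a, ⟨ha, haX⟩, haA⟩ := c1
    obtain ⟨b, ⟨hb, hbX⟩, hbA⟩ := c2
    exact ⟨a, ha, haX, b, hb, hbX, fun h => hbX (h ▸ haX), ha.2, hb.2, Or.inr ⟨haA, hbA⟩⟩
  · intro i i' h
    exact (H.hdisj h).mono Set.inter_subset_left Set.inter_subset_left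
  · intro i i' h
    obtain ⟨x, hx, y, hy, hxy⟩ := H.hadj i i' h
    by_cases hB : x ∈ B ∧ y ∈ B
    · exact ⟨x, ⟨hx, hB.1⟩, y, ⟨hy, hB.2⟩, hxy.ne, hB.1, hB.2, Or.inl hxy⟩
    have hxyA : x ∈ A ∧ y ∈ A := by
      by_contra hc
      have h1 := @sep_nbr _ _ _ _ hs x y
      have h2 := @sep_nbr _ _ _ _ hs y x
      have := sep_or hs x
      have := sep_or hs y
      have := hxy.symm
      tauto
    obtain ⟨a, ha, haA, haB⟩ := hmeet i ⟨x, hx, hxyA.1⟩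
    obtain ⟨b, hb, hbA, hbB⟩ := hmeet i' ⟨y, hy, hxyA.2⟩
    exact ⟨a, ⟨ha, haB⟩, b, ⟨hb, hbB⟩, fun hab => Set.disjoint_left.1 (H.hdisj h) ha (hab ▸ hb),
      haB, hbB, Or.inr ⟨haA, hbA⟩⟩
  · rintro A2 B2 hs2 hZ2 ⟨i, hi⟩
    have hi' : ∀ x ∈ Gs i, x ∈ B → x ∉ A2 := fun x h1 h2 h3 => by
      have : x ∈ Gs i ∩ B ∩ A2 := ⟨⟨h1, h2⟩, h3⟩
      rw [hi] at this; exact this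
    refine (H.hsep (A ∪ A2) (B2 ∩ B) ⟨?_, ?_⟩ (fun v hv => Or.inl (hZA hv)) ⟨i, ?_⟩).trans
      (Set.ncard_le_ncard ?_ (Set.toFinite _))
    · ext v
      have := sep_or hs v
      have := sep_or hs2 v
      simp only [Set.mem_union, Set.mem_inter_iff, Set.mem_univ]
      tauto
    · rintro a ⟨ha, ha'⟩ b ⟨⟨hb2, hbB⟩, hb'⟩ hab
      have hbA : b ∉ A := fun h => hb' (Or.inl h)
      have hbA2 : b ∉ A2 := fun h => hb' (Or.inr h)
      have haB : a ∈ B := sep_nbr hs hbA hab.symm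
      have haB2 : a ∉ B2 := fun h => ha' ⟨h, haB⟩
      exact hs2.2 a ⟨(sep_or hs2 a).resolve_right haB2, haB2⟩ b ⟨hb2, hbA2⟩
        ⟨hab.ne, haB, hbB, Or.inl hab⟩
    · rw [Set.eq_empty_iff_forall_notMem]
      rintro x ⟨hx, hxA | hxA⟩
      · obtain ⟨a, ha, haA, haB⟩ := hmeet i ⟨x, hx, hxA⟩
        exact hi' a ha haB (hZ2 ⟨haA, haB⟩)
      · by_cases hxB : x ∈ B
        · exact hi' x hx hxB hxA
        · obtain ⟨a, ha, haA, haB⟩ := hmeet i ⟨x, hx, (sep_or hs x).resolve_right hxB⟩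
          exact hi' a ha haB (hZ2 ⟨haA, haB⟩)
    · rintro v ⟨h1, h2, h3⟩
      refine ⟨?_, h2⟩
      rcases h1 with h1 | h1
      · exact hZ2 ⟨h1, h3⟩
      · exact h1

theorem sepConcl {V : Type*} [Finite V] {k p t : ℕ}
    {G : SimpleGraph V} {U Z : Set V} {Gs : Fin p → Set V} (H : Hyp k G U Z Gs)
    {A B : Set V} (hs : IsSeparation G A B) (hZA : Z ⊆ A) (hBU : B ⊆ U) (j : Fin p)
    (hj : Gs j ∩ A = ∅) (hk : (A ∩ B).ncard = k)
    (C : Concl t (rst G A B) B (A ∩ B) (fun i => Gs i ∩ B)) : Concl t G U Z Gs := by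
  obtain ⟨T, W, hT1, hT2, hT3, hT4, hT5, hW1, hW2, hW3, hW4, hTW, hWW, hA⟩ := C
  obtain ⟨P, hP1, hP2, hP3, hP4⟩ := menger G Z (A ∩ B) k (by
    intro C D hCD hZC hSD
    refine (H.hsep (A ∩ C) (B ∪ D) ⟨?_, ?_⟩ (fun v hv => ⟨hZA hv, hZC hv⟩) ⟨j, ?_⟩).trans
      (Set.ncard_le_ncard ?_ (Set.toFinite _))
    · ext v
      have := sep_or hs v
      have := sep_or hCD v
      simp only [Set.mem_union, Set.mem_inter_iff, Set.mem_univ]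
      tauto
    · rintro a ⟨⟨haA, haC⟩, ha⟩ b ⟨hb, hb'⟩ hab
      have haD : a ∉ D := fun h => ha (Or.inr h)
      have haB : a ∉ B := fun h => ha (Or.inl h)
      have h1 := sep_nbr (sep_symm hs) haB hab
      have h2 := sep_nbr (sep_symm hCD) haD hab
      exact hb' ⟨h1, h2⟩
    · rw [Set.eq_empty_iff_forall_notMem]
      rintro x ⟨hx, hxA, _⟩
      have : x ∈ Gs j ∩ A := ⟨hx, hxA⟩
      rw [hj] at this; exact this
    · rintro v ⟨⟨h1, h2⟩, h3 | h3⟩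
      · exact ⟨h2, hSD ⟨h1, h3⟩⟩
      · exact ⟨h2, h3⟩)
  obtain ⟨Q, hq1, hq2, hq3, hq4⟩ := reindex k Z H.hZ P hP1 hP3
  obtain ⟨R, hr1, hr2, hr3, hr4⟩ := reindex k (A ∩ B) hk P hP1 hP4
  have hg : ∀ z, ∃ c, z ∈ Z → c ∈ A ∩ B ∧ c ∈ Q z ∧ ∀ y ∈ A ∩ B, y ∈ Q z → y = c := by
    intro z
    by_cases hz : z ∈ Z
    · obtain ⟨i, hi⟩ := hq1 z hz
      obtain ⟨c, hc, hc'⟩ := hP4 i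
      refine ⟨c, fun _ => ⟨hc', hi ▸ hc, fun y hy hyQ => ?_⟩⟩
      obtain ⟨i', hi'⟩ := hr1 c hc'
      have h1 := hr2 c hc'
      have : i' = i := by
        by_contra h
        exact Set.disjoint_left.1 (hP1 h) (hi' ▸ h1) hc
      subst this
      exact hr3 c hc' y hy (by rw [hi', ← hi]; exact hyQ)
    · exact ⟨z, fun h => absurd h hz⟩
  choose g hg using hg
  have hginj : ∀ z ∈ Z, ∀ z' ∈ Z, z ≠ z' → g z ≠ g z' := by
    intro z hz z' hz' hne h
    exact Set.disjoint_left.1 (hq4 z hz z' hz' hne) (hg z hz).2.1 (h ▸ (hg z' hz').2.1)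
  have hWA : ∀ i, ∀ v ∈ W i, v ∉ A := fun i v hv hvA => hW3 i v hv ⟨hvA, hW2 i hv⟩
  have hQc : ∀ z ∈ Z, Cn G (Q z) := fun z hz => by
    obtain ⟨i, hi⟩ := hq1 z hz
    exact hi ▸ hP2 i
  have hQU : ∀ z ∈ Z, Q z ⊆ U := fun z hz => (hQc z hz).subU H.hU z (hq2 z hz) (H.hZU hz)
  have hadj' : ∀ x y, (rst G A B).Adj x y → y ∉ A ∩ B ∨ x ∉ A ∩ B → G.Adj x y := by
    rintro x y ⟨hne, hx, hy, h | h⟩ h'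
    · exact h
    · exact absurd h' (by simp [hx, hy, h])
  have hcross : ∀ z ∈ Z, ∀ z' ∈ Z, z ≠ z' → Disjoint (Q z ∩ A) (T (g z')) := by
    intro z hz z' hz' hne
    rw [Set.disjoint_left]
    rintro v ⟨hv, hvA⟩ hv'
    have hg' := hg z' hz'
    have h1 := hT4 _ hg'.1 v ⟨hvA, hT3 _ hg'.1 hv'⟩ hv'
    exact Set.disjoint_left.1 (hq4 z hz z' hz' hne) hv (h1 ▸ hg'.2.1)
  refine ⟨fun z => (Q z ∩ A) ∪ T (g z), W, ?_, ?_, ?_, ?_, ?_, ?_, ?_, ?_, hW4, ?_, ?_, ?_⟩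
  · intro z hz
    have hgz := hg z hz
    refine (Cn.side hs (hQc z hz) (g z) hgz.2.1 hgz.1.1
      fun x hx hxA hxB => hgz.2.2 x ⟨hxA, hxB⟩ hx).union
      ((hT1 _ hgz.1).mono fun x hx y hy hxy => hadj' x y hxy ?_)
      (Or.inl ⟨g z, ⟨hgz.2.1, hgz.1.1⟩, hT2 _ hgz.1⟩)
    by_contra hc
    push Not at hc
    exact hxy.ne ((hT4 _ hgz.1 x hc.2 hx).trans (hT4 _ hgz.1 y hc.1 hy).symm)
  · intro z hz
    exact Or.inl ⟨hq2 z hz, hZA hz⟩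
  · rintro z hz v (hv | hv)
    · exact hQU z hz hv.1
    · exact hBU (hT3 _ (hg z hz).1 hv)
  · rintro z hz z' hz' (h | h)
    · exact hq3 z hz z' hz' h.1
    · have hgz := hg z hz
      have := hT4 _ hgz.1 z' ⟨hZA hz', hT3 _ hgz.1 h⟩ h
      exact hq3 z hz z' hz' (this ▸ hgz.2.1)
  · intro z hz z' hz' hne
    simp only [Set.disjoint_union_left, Set.disjoint_union_right]
    exact ⟨⟨(hq4 z hz z' hz' hne).mono Set.inter_subset_left Set.inter_subset_left,
      (hcross z' hz' z hz hne.symm).symm⟩, hcross z hz z' hz' hne,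
      hT5 _ (hg z hz).1 _ (hg z' hz').1 (hginj z hz z' hz' hne)⟩
  · intro i
    exact (hW1 i).mono fun x hx y hy hxy => hadj' x y hxy (Or.inl (hW3 i y hy))
  · intro i
    exact (hW2 i).trans hBU
  · intro i z hz hzZ
    exact hWA i z hz (hZA hzZ)
  · intro z hz i
    rw [Set.disjoint_union_left]
    refine ⟨?_, hTW _ (hg z hz).1 i⟩
    rw [Set.disjoint_left]
    exact fun v hv hv' => hWA i v hv' hv.2
  · intro i i' h
    obtain ⟨x, hx, y, hy, hxy⟩ := hWW i i' h
    exact ⟨x, hx, y, hy, hadj' x y hxy (Or.inl (hW3 _ y hy))⟩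
  · intro z hz i
    have hgz := hg z hz
    obtain ⟨x, hx, y, hy, hxy, himp⟩ := hA _ hgz.1 i
    refine ⟨x, Or.inr hx, y, hy, hadj' x y hxy (Or.inl (hW3 _ y hy)), ?_⟩
    rintro rfl
    have := hT4 _ hgz.1 x ⟨hZA hz, hT3 _ hgz.1 hx⟩ hx
    obtain ⟨i, hi⟩ := himp this
    exact ⟨i, this ▸ hi.1⟩

theorem main {V : Type*} [Finite V] {k t p : ℕ} (hp : 3 * k / 2 + t ≤ p) (m : ℕ) :
    ∀ (G : SimpleGraph V) (U Z : Set V) (Gs : Fin p → Set V), U.ncard = m → Hyp k G U Z Gs →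
    Concl t G U Z Gs := by
  classical
  induction m using Nat.strong_induction_on with
  | _ m ih =>
  intro G U Z Gs hm H
  by_cases hno : ∀ i, ∀ u ∈ Gs i, ∀ v ∈ Gs i, G.Adj u v → v ∈ Z
  · exact base hp H hno
  push Not at hno
  obtain ⟨i0, u, hu, v, hv, huv, hvZ⟩ := hno
  have key : ∀ i j v, v ∈ Gs i → v ∈ Gs j → i = j := by
    intro i j v h1 h2
    by_contra h
    exact Set.disjoint_left.1 (H.hdisj h) h1 h2
  let f : V → V := fun x => if x = v then u else x
  have fv : f v = u := by simp [f]
  have fo : ∀ x, x ≠ v → f x = x := fun x hx => by simp [f, hx]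
  have fnv : ∀ x, f x ≠ v := fun x => by
    by_cases h : x = v
    · rw [h, fv]; exact huv.ne
    · rw [fo x h]; exact h
  have fG : ∀ i x, x ∈ Gs i → f x ∈ Gs i := fun i x hx => by
    by_cases h : x = v
    · subst h
      rw [fv, key i i0 x hx hv]; exact hu
    · rw [fo x h]; exact hx
  have fG' : ∀ i x, f x ∈ Gs i → x ∈ Gs i := fun i x hx => by
    by_cases h : x = v
    · subst h
      rw [fv] at hx
      rw [key i i0 u hx hu]; exact hv
    · rwa [fo x h] at hx
  have fZ : ∀ z ∈ Z, f z = z := fun z hz => fo z fun h => hvZ (h ▸ hz)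
  have hvU : v ∈ U := (H.hU _ _ huv).2
  have huU : u ∈ U := (H.hU _ _ huv).1
  have fU : ∀ x, x ∈ U → f x ∈ U := fun x hx => by
    by_cases h : x = v
    · rw [h, fv]; exact huU
    · rw [fo x h]; exact hx
  have liftSep : ∀ A B, IsSeparation (ctr G f) A B → IsSeparation G (f ⁻¹' A) (f ⁻¹' B) := by
    intro A B hs
    refine ⟨?_, ?_⟩
    · ext x
      have := sep_or hs (f x)
      simpa using this
    · rintro a ⟨ha, ha'⟩ b ⟨hb, hb'⟩ hab
      refine hs.2 (f a) ⟨ha, ha'⟩ (f b) ⟨hb, hb'⟩ ⟨?_, a, b, rfl, rfl, hab⟩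
      intro h
      exact hb' (show f b ∈ A from h ▸ ha)
  by_cases hsep : ∀ A B, IsSeparation (ctr G f) A B → Z ⊆ A → (∃ j, (f '' Gs j) ∩ A = ∅) →
      k ≤ (A ∩ B).ncard
  · have H' : Hyp k (ctr G f) (U \ {v}) Z (fun i => f '' Gs i) := by
      refine ⟨?_, ?_, ?_, H.hZ, ?_, ?_, ?_, ?_, hsep⟩
      · rintro x y ⟨_, a, b, rfl, rfl, hab⟩
        exact ⟨⟨fU a (H.hU _ _ hab).1, fnv a⟩, ⟨fU b (H.hU _ _ hab).2, fnv b⟩⟩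
      · exact fun z hz => ⟨H.hZU hz, fun h => hvZ (h ▸ hz)⟩
      · rintro i _ ⟨x, hx, rfl⟩
        exact ⟨fU x (H.hGU i hx), fnv x⟩
      · exact fun x hx y hy h => ⟨h, x, y, fZ x hx, fZ y hy, H.hcl x hx y hy h⟩
      · intro i
        refine Cn.intro ((H.hconn i).1.image f) fun X h1 h2 => ?_
        obtain ⟨_, ⟨a, ha, rfl⟩, haX⟩ := h1
        obtain ⟨_, ⟨b, hb, rfl⟩, hbX⟩ := h2
        obtain ⟨x, hx, hxX, y, hy, hyX, hxy⟩ := (H.hconn i).cross (f ⁻¹' X) ⟨a, ha, haX⟩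
          ⟨b, hb, hbX⟩
        exact ⟨f x, ⟨x, hx, rfl⟩, hxX, f y, ⟨y, hy, rfl⟩, hyX, fun h => hyX (h ▸ hxX : f y ∈ X),
          x, y, rfl, rfl, hxy⟩
      · intro i j hij
        rw [Set.disjoint_left]
        rintro _ ⟨a, ha, rfl⟩ ⟨b, hb, hab⟩
        exact hij (key i j (f a) (fG i a ha) (hab ▸ fG j b hb))
      · intro i j hij
        obtain ⟨x, hx, y, hy, hxy⟩ := H.hadj i j hij
        exact ⟨f x, ⟨x, hx, rfl⟩, f y, ⟨y, hy, rfl⟩, fun h =>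
          hij (key i j (f x) (fG i x hx) (h ▸ fG j y hy)), x, y, rfl, rfl, hxy⟩
    have hlt : (U \ {v}).ncard < m := by
      rw [← hm]
      exact Set.ncard_sdiff_singleton_lt_of_mem hvU (Set.toFinite _)
    obtain ⟨T, W, hT1, hT2, hT3, hT4, hT5, hW1, hW2, hW3, hW4, hTW, hWW, hA⟩ :=
      ih _ hlt _ _ _ _ rfl H'
    have lift : ∀ S : Set V, v ∉ S → Cn (ctr G f) S → Cn G (f ⁻¹' S) := by
      intro S hvS hS
      have mem : ∀ x ∈ S, f x = x := fun x hx => fo x fun h => hvS (h ▸ hx)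
      obtain ⟨s0, hs0⟩ := hS.1
      refine Cn.intro ⟨s0, show f s0 ∈ S from (mem s0 hs0).symm ▸ hs0⟩ fun X h1 h2 => ?_
      -- if the contracted edge crosses, done
      by_cases huS : u ∈ S ∧ ¬ (u ∈ X ↔ v ∈ X)
      · obtain ⟨huS, hX⟩ := huS
        have h1 : f u ∈ S := (mem u huS).symm ▸ huS
        have h2 : f v ∈ S := fv.symm ▸ huS
        by_cases huX : u ∈ X
        · exact ⟨u, h1, huX, v, h2, by tauto, huv⟩
        · exact ⟨v, h2, by tauto, u, h1, huX, huv.symm⟩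
      have hX : ∀ x, f x ∈ S → (x ∈ X ↔ f x ∈ X) := by
        intro x hx
        by_cases h : x = v
        · subst h
          rw [fv] at hx ⊢
          tauto
        · rw [fo x h]
      obtain ⟨a, ha, haX⟩ := h1
      obtain ⟨b, hb, hbX⟩ := h2
      obtain ⟨x, hx, hxX, y, hy, hyX, _, x', y', rfl, rfl, hxy⟩ := hS.cross X
        ⟨f a, ha, (hX a ha).1 haX⟩ ⟨f b, hb, fun h => hbX ((hX b hb).2 h)⟩
      exact ⟨x', hx, (hX x' hx).2 hxX, y', hy, fun h => hyX ((hX y' hy).1 h), hxy⟩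
    have pU : ∀ S : Set V, S ⊆ U \ {v} → f ⁻¹' S ⊆ U := by
      intro S hS x hx
      by_cases h : x = v
      · exact h ▸ hvU
      · have : f x ∈ S := hx
        rw [fo x h] at this
        exact (hS this).1
    refine ⟨fun z => f ⁻¹' T z, fun j => f ⁻¹' W j, ?_, ?_, ?_, ?_, ?_, ?_, ?_, ?_, ?_, ?_, ?_, ?_⟩
    · exact fun z hz => lift _ (fun h => (hT3 z hz h).2 rfl) (hT1 z hz)
    · intro z hz
      show f z ∈ T z
      rw [fZ z hz]; exact hT2 z hz
    · exact fun z hz => pU _ (hT3 z hz)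
    · intro z hz z' hz' h
      have h' : f z' ∈ T z := h
      rw [fZ z' hz'] at h'
      exact hT4 z hz z' hz' h'
    · exact fun z hz z' hz' h => (hT5 z hz z' hz' h).preimage f
    · exact fun j => lift _ (fun h => (hW2 j h).2 rfl) (hW1 j)
    · exact fun j => pU _ (hW2 j)
    · intro j z hz hzZ
      have h' : f z ∈ W j := hz
      rw [fZ z hzZ] at h'
      exact hW3 j z h' hzZ
    · exact fun i j h => (hW4 h).preimage f
    · exact fun z hz j => (hTW z hz j).preimage f
    · intro i j h
      obtain ⟨_, hx, _, hy, _, x, y, rfl, rfl, hxy⟩ := hWW i j h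
      exact ⟨x, hx, y, hy, hxy⟩
    · intro z hz j
      obtain ⟨_, hx, _, hy, ⟨_, x, y, rfl, rfl, hxy⟩, himp⟩ := hA z hz j
      refine ⟨x, hx, y, hy, hxy, ?_⟩
      rintro rfl
      obtain ⟨i, a, ha, hax⟩ := himp (fZ x hz)
      exact ⟨i, hax ▸ fG i a ha⟩
  · push Not at hsep
    obtain ⟨A0, B0, hs0, hZA0, ⟨j, hj⟩, hlt⟩ := hsep
    have hs1 := liftSep A0 B0 hs0
    -- restrict to `U`
    let A := f ⁻¹' A0 ∪ Uᶜ
    let B := f ⁻¹' B0 ∩ U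
    have hs : IsSeparation G A B := by
      refine ⟨?_, ?_⟩
      · ext x
        have := sep_or hs1 x
        simp only [A, B, Set.mem_union, Set.mem_inter_iff, Set.mem_univ, Set.mem_compl_iff]
        tauto
      · rintro a ⟨ha, ha'⟩ b ⟨hb, hb'⟩ hab
        have haU := (H.hU _ _ hab).1
        refine hs1.2 a ⟨ha.resolve_right fun h => h haU, fun h => ha' ⟨h, haU⟩⟩ b
          ⟨hb.1, fun h => hb' (Or.inl h)⟩ hab
    have hZA : Z ⊆ A := fun z hz => Or.inl (show f z ∈ A0 from (fZ z hz).symm ▸ hZA0 hz)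
    have hjA : Gs j ∩ A = ∅ := by
      rw [Set.eq_empty_iff_forall_notMem]
      rintro x ⟨hx, hxA | hxA⟩
      · have : f x ∈ f '' Gs j ∩ A0 := ⟨⟨x, hx, rfl⟩, hxA⟩
        rw [hj] at this; exact this
      · exact hxA (H.hGU j hx)
    have hge := H.hsep A B hs hZA ⟨j, hjA⟩
    have hsub : A ∩ B ⊆ insert v (A0 ∩ B0) := by
      rintro x ⟨hxA, hxB, hxU⟩
      have hxA : f x ∈ A0 := hxA.resolve_right fun h => h hxU
      have hxB : f x ∈ B0 := hxB
      by_cases h : x = v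
      · exact Or.inl h
      · rw [fo x h] at hxA hxB
        exact Or.inr ⟨hxA, hxB⟩
    have hvAB : v ∈ A ∩ B := by
      by_contra hvn
      have : A ∩ B ⊆ A0 ∩ B0 := fun x hx => by
        rcases hsub hx with h | h
        · exact absurd (h ▸ hx) hvn
        · exact h
      have := Set.ncard_le_ncard this (Set.toFinite _)
      omega
    have hk : (A ∩ B).ncard = k := by
      have h1 := Set.ncard_le_ncard hsub (Set.toFinite _)
      have h2 := Set.ncard_insert_le v (A0 ∩ B0)
      omega
    have hBU : B ⊆ U := Set.inter_subset_right
    have hBlt : B.ncard < m := by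
      rw [← hm]
      refine Set.ncard_lt_ncard ⟨hBU, fun hUB => ?_⟩ (Set.toFinite _)
      -- then `Z ∪ {v} ⊆ A ∩ B`
      have hsub2 : insert v Z ⊆ A ∩ B := by
        rintro x (rfl | hx)
        · exact hvAB
        · exact ⟨hZA hx, hUB (H.hZU hx)⟩
      have h1 := Set.ncard_le_ncard hsub2 (Set.toFinite _)
      rw [Set.ncard_insert_of_notMem hvZ (Set.toFinite _), H.hZ] at h1
      omega
    exact sepConcl H hs hZA hBU j hjA hk
      (ih _ hBlt _ _ _ _ rfl (sepHyp H hs hZA hBU j hjA hk))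

end LCC

namespace LCC

theorem Cn.ofConn {V : Type*} {G : SimpleGraph V} {S : Set V} (h : (G.induce S).Connected) :
    Cn G S := by
  obtain ⟨⟨s, hs⟩⟩ := h.nonempty
  refine Cn.intro ⟨s, hs⟩ fun X h1 h2 => ?_
  by_contra hc
  push Not at hc
  obtain ⟨a, ha, haX⟩ := h1
  obtain ⟨b, hb, hbX⟩ := h2
  have key : ∀ x y : S, (G.induce S).Walk x y → (x : V) ∈ X → (y : V) ∈ X := by
    intro x y w
    induction w with
    | nil => exact id
    | @cons x y z hxy _ ih =>
      intro hx
      apply ih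
      by_contra hy
      exact hc x x.2 hx y y.2 hy hxy
  obtain ⟨w⟩ := h.preconnected ⟨a, ha⟩ ⟨b, hb⟩
  exact hbX (key _ _ w haX)

/-- The set of vertices reachable from `x` inside `S` -/
def Rch {V : Type*} (G : SimpleGraph V) (S : Set V) (x : V) : Set V :=
  {y | ∃ (hx : x ∈ S) (hy : y ∈ S), (G.induce S).Reachable ⟨x, hx⟩ ⟨y, hy⟩}

theorem Rch.step {V : Type*} {G : SimpleGraph V} {S : Set V} {x y z : V} (h : y ∈ Rch G S x)
    (hz : z ∈ S) (hyz : G.Adj y z) : z ∈ Rch G S x := by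
  obtain ⟨hx, hy, hr⟩ := h
  refine ⟨hx, hz, hr.trans (SimpleGraph.Adj.reachable ?_)⟩
  exact hyz

theorem Cn.toConn {V : Type*} {G : SimpleGraph V} {S : Set V} (h : Cn G S) :
    (G.induce S).Connected := by
  obtain ⟨s, hs⟩ := h.1
  have : Nonempty S := ⟨⟨s, hs⟩⟩
  refine SimpleGraph.Connected.mk ?_
  rintro ⟨a, ha⟩ ⟨b, hb⟩
  by_contra hn
  obtain ⟨x, _, hxX, y, hy, hyX, hxy⟩ := h.cross (Rch G S a) ⟨a, ha, ha, ha, .refl _⟩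
    ⟨b, hb, fun ⟨_, _, h⟩ => hn h⟩
  exact hyX (Rch.step hxX hy hxy)

/-- auxiliary graph -/
def aux {q n : ℕ} (t : ℕ) (G : SimpleGraph (Fin n)) (χ : Fin n → Finset (Fin q)) :
    SimpleGraph (Fin n ⊕ (Fin q × Fin t)) where
  Adj x y := match x, y with
    | .inl a, .inl b => G.Adj a b
    | .inl a, .inr b => b.1 ∈ χ a
    | .inr a, .inl b => a.1 ∈ χ b
    | .inr a, .inr b => a ≠ b
  symm := ⟨by
    rintro (a | a) (b | b) h
    · exact SimpleGraph.Adj.symm (G := G) h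
    · exact h
    · exact h
    · exact Ne.symm h⟩
  loopless := ⟨by
    rintro (a | a) h
    · exact G.loopless.irrefl a h
    · exact h rfl⟩

end LCC

/-- Lemma "link chromatic clique": given `p ≥ ⌊3/2·tq⌋ + t` pairwise disjoint connected
subgraphs of a `q`-colorful graph, pairwise joined by edges, one of the two listed
outcomes holds.  (Colors and blocks are indexed `0`-based: the block of color `i`
consists of the indices `j` with `i·t ≤ j < (i+1)·t`.) -/
theorem link_chromatic_clique (t q : ℕ) (ht : 0 < t) (hq : 0 < q)
    {n : ℕ} (G : SimpleGraph (Fin n)) (χ : Fin n → Finset (Fin q))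
    (p : ℕ) (hp : 3 * t * q / 2 + t ≤ p)
    (Gs : Fin p → Set (Fin n))
    (hconn : ∀ i, (G.induce (Gs i)).Connected)
    (hdisj : Pairwise fun i j => Disjoint (Gs i) (Gs j))
    (hadj : ∀ i j : Fin p, i ≠ j → ∃ x ∈ Gs i, ∃ y ∈ Gs j, G.Adj x y) :
    (∃ A B : Set (Fin n), IsSeparation G A B ∧ (A ∩ B).ncard < t * q ∧
      (∃ I : Finset (Fin q), I.Nonempty ∧ ∀ v : Fin n, (χ v ∩ I).Nonempty → v ∈ A) ∧
      ∃ j : Fin p, Gs j ∩ A = ∅) ∨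
    (∃ H : Fin ((q + 1) * t) → Set (Fin n),
      (Pairwise fun i j => Disjoint (H i) (H j)) ∧
      (∀ (i : Fin q) (j : Fin ((q + 1) * t)),
        i.val * t ≤ j.val → j.val < (i.val + 1) * t → ∃ x ∈ H j, i ∈ χ x) ∧
      (∀ j : Fin ((q + 1) * t),
        (G.induce (H j)).Connected ∨
        ∃ i : Fin q, i.val * t ≤ j.val ∧ j.val < (i.val + 1) * t ∧
          ∀ (x : Fin n) (hx : x ∈ H j), ∃ (y : Fin n) (hy : y ∈ H j),
            i ∈ χ y ∧ (G.induce (H j)).Reachable ⟨x, hx⟩ ⟨y, hy⟩) ∧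
      (∀ i j : Fin ((q + 1) * t), i ≠ j →
        (∃ x ∈ H i, ∃ y ∈ H j, G.Adj x y) ∨ (i.val < t * q ∧ j.val < t * q))) := by
  classical
  by_cases h1 : (∃ A B : Set (Fin n), IsSeparation G A B ∧ (A ∩ B).ncard < t * q ∧
      (∃ I : Finset (Fin q), I.Nonempty ∧ ∀ v : Fin n, (χ v ∩ I).Nonempty → v ∈ A) ∧
      ∃ j : Fin p, Gs j ∩ A = ∅)
  · exact Or.inl h1
  right
  let Z : Set (Fin n ⊕ (Fin q × Fin t)) := Set.range Sum.inr
  have hZc : Z.ncard = t * q := by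
    simp only [Z]
    rw [← Set.image_univ, Set.ncard_image_of_injective _ Sum.inr_injective]
    simp [Set.ncard_univ, mul_comm]
  have H : LCC.Hyp (t * q) (LCC.aux t G χ) Set.univ Z (fun i => Sum.inl '' Gs i) := by
    refine ⟨fun _ _ _ => ⟨trivial, trivial⟩, Set.subset_univ _, fun _ => Set.subset_univ _, hZc,
      ?_, ?_, ?_, ?_, ?_⟩
    · rintro _ ⟨a, rfl⟩ _ ⟨b, rfl⟩ h
      exact fun hab => h (hab ▸ rfl)
    · intro i
      have hc := LCC.Cn.ofConn (hconn i)
      refine LCC.Cn.intro (hc.1.image _) fun X h1 h2 => ?_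
      obtain ⟨_, ⟨a, ha, rfl⟩, haX⟩ := h1
      obtain ⟨_, ⟨b, hb, rfl⟩, hbX⟩ := h2
      obtain ⟨x, hx, hxX, y, hy, hyX, hxy⟩ := hc.cross (Sum.inl ⁻¹' X) ⟨a, ha, haX⟩ ⟨b, hb, hbX⟩
      exact ⟨_, ⟨x, hx, rfl⟩, hxX, _, ⟨y, hy, rfl⟩, hyX, hxy⟩
    · intro i j hij
      exact (Set.disjoint_image_iff Sum.inl_injective).2 (hdisj hij)
    · intro i j hij
      obtain ⟨x, hx, y, hy, hxy⟩ := hadj i j hij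
      exact ⟨_, ⟨x, hx, rfl⟩, _, ⟨y, hy, rfl⟩, hxy⟩
    · rintro A B hs hZA ⟨j, hj⟩
      by_contra hlt
      push Not at hlt
      have hnot : ¬ Z ⊆ B := fun h => by
        have := Set.ncard_le_ncard (Set.subset_inter hZA h) (Set.toFinite _)
        omega
      obtain ⟨_, ⟨⟨i, s⟩, rfl⟩, hzB⟩ := Set.not_subset.1 hnot
      apply h1
      refine ⟨Sum.inl ⁻¹' A, Sum.inl ⁻¹' B, ⟨?_, ?_⟩, ?_, ⟨{i}, by simp, ?_⟩, j, ?_⟩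
      · ext v
        have := LCC.sep_or hs (Sum.inl v)
        simpa using this
      · exact fun a ha b hb hab => hs.2 (Sum.inl a) ha (Sum.inl b) hb hab
      · refine lt_of_le_of_lt ?_ hlt
        rw [← Set.preimage_inter, ← Set.ncard_image_of_injective _ Sum.inl_injective]
        exact Set.ncard_le_ncard (Set.image_preimage_subset _ _) (Set.toFinite _)
      · intro v hv
        have hiv : i ∈ χ v := by
          obtain ⟨c, hc⟩ := hv
          rw [Finset.mem_inter, Finset.mem_singleton] at hc
          exact hc.2 ▸ hc.1
        exact LCC.sep_nbr (LCC.sep_symm hs) hzB (y := Sum.inl v) hiv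
      · rw [Set.eq_empty_iff_forall_notMem]
        rintro x ⟨hx, hxA⟩
        have : Sum.inl x ∈ Sum.inl '' Gs j ∩ A := ⟨⟨x, hx, rfl⟩, hxA⟩
        rw [hj] at this; exact this
  obtain ⟨T, W, hT1, hT2, -, hT4, hT5, hW1, -, hW3, hW4, hTW, hWW, hA⟩ :=
    LCC.main (t := t) (by rw [← mul_assoc]; exact hp) _ _ _ _ _ rfl H
  have hzZ : ∀ c, (Sum.inr c : Fin n ⊕ (Fin q × Fin t)) ∈ Z := fun c => ⟨c, rfl⟩
  -- elements of the trees
  have hTc : ∀ c c', Sum.inr c' ∈ T (Sum.inr c) → c' = c := fun c c' h =>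
    Sum.inr_injective (hT4 _ (hzZ c) _ (hzZ c') h)
  have hAl : ∀ c j, ∃ x, Sum.inl x ∈ T (Sum.inr c) ∧ ∃ y, Sum.inl y ∈ W j ∧ G.Adj x y := by
    intro c j
    obtain ⟨x, hx, y, hy, hxy, himp⟩ := hA _ (hzZ c) j
    rcases y with y | y
    swap
    · exact absurd (hzZ y) (hW3 j _ hy)
    rcases x with x | x
    swap
    · obtain ⟨i, a, _, ha⟩ := himp (by rw [hTc c x hx])
      exact absurd ha (by simp)
    exact ⟨x, hx, y, hy, hxy⟩
  -- the indexing
  let col : ∀ m : ℕ, m < t * q → Fin q × Fin t := fun m hm =>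
    (⟨m / t, Nat.div_lt_of_lt_mul hm⟩, ⟨m % t, Nat.mod_lt _ ht⟩)
  have colinj : ∀ m hm m' hm', col m hm = col m' hm' → m = m' := by
    intro m hm m' hm' h
    simp only [col, Prod.mk.injEq, Fin.mk.injEq] at h
    rw [← Nat.div_add_mod m t, ← Nat.div_add_mod m' t, h.1, h.2]
  have hidx : ∀ j : Fin ((q + 1) * t), ¬ j.val < t * q → j.val - t * q < t := by
    intro j hj
    have := j.2
    have e : (q + 1) * t = t * q + t := by ring
    omega
  let K : Fin ((q + 1) * t) → Set (Fin n ⊕ (Fin q × Fin t)) := fun j =>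
    if h : j.val < t * q then T (Sum.inr (col j h)) else W ⟨j.val - t * q, hidx j h⟩
  have K1 : ∀ j (h : j.val < t * q), K j = T (Sum.inr (col j h)) := fun j h => dif_pos h
  have K2 : ∀ j (h : ¬ j.val < t * q), K j = W ⟨j.val - t * q, hidx j h⟩ := fun j h => dif_neg h
  have hblock : ∀ (i : Fin q) (j : Fin ((q + 1) * t)), i.val * t ≤ j.val →
      j.val < (i.val + 1) * t → ∃ h : j.val < t * q, (col j h).1 = i := by
    intro i j h1 h2
    have h : j.val < t * q := by
      have : (i.val + 1) * t ≤ q * t := Nat.mul_le_mul_right _ i.2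
      rw [mul_comm t q]; omega
    refine ⟨h, Fin.ext ?_⟩
    exact Nat.div_eq_of_lt_le h1 h2
  have hreach : ∀ c x, Sum.inl x ∈ T (Sum.inr c) →
      ∃ y ∈ LCC.Rch G (Sum.inl ⁻¹' T (Sum.inr c)) x, c.1 ∈ χ y := by
    intro c x hx
    obtain ⟨a, ha, haX, b, hb, hbX, hab⟩ := (hT1 _ (hzZ c)).cross
      (Sum.inl '' LCC.Rch G (Sum.inl ⁻¹' T (Sum.inr c)) x)
      ⟨_, hx, x, ⟨hx, hx, .refl _⟩, rfl⟩ ⟨_, hT2 _ (hzZ c), by simp⟩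
    obtain ⟨a, haR, rfl⟩ := haX
    rcases b with b | b
    · exact absurd ⟨b, LCC.Rch.step haR hb hab, rfl⟩ hbX
    · have := hTc c b hb
      subst this
      exact ⟨a, haR, hab⟩
  have hWx : ∀ i j, i ≠ j → ∃ x, Sum.inl x ∈ W i ∧ ∃ y, Sum.inl y ∈ W j ∧ G.Adj x y := by
    intro i j hij
    obtain ⟨x, hx, y, hy, hxy⟩ := hWW i j hij
    rcases x with x | x
    swap
    · exact absurd (hzZ x) (hW3 _ _ hx)
    rcases y with y | y
    swap
    · exact absurd (hzZ y) (hW3 _ _ hy)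
    exact ⟨x, hx, y, hy, hxy⟩
  refine ⟨fun j => Sum.inl ⁻¹' K j, ?_, ?_, ?_, ?_⟩
  · intro i j hij
    refine Disjoint.preimage _ ?_
    by_cases hi : i.val < t * q <;> by_cases hj : j.val < t * q
    · rw [K1 i hi, K1 j hj]
      exact hT5 _ (hzZ _) _ (hzZ _) fun h =>
        hij (Fin.ext (colinj _ hi _ hj (Sum.inr_injective h)))
    · rw [K1 i hi, K2 j hj]
      exact hTW _ (hzZ _) _
    · rw [K2 i hi, K1 j hj]
      exact (hTW _ (hzZ _) _).symm
    · rw [K2 i hi, K2 j hj]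
      apply hW4
      intro h
      rw [Fin.mk.injEq] at h
      exact hij (Fin.ext (by omega))
  · intro i j h1 h2
    obtain ⟨h, hc⟩ := hblock i j h1 h2
    obtain ⟨x, hx, _⟩ := hAl (col j h) ⟨0, ht⟩
    obtain ⟨y, ⟨_, hy, _⟩, hcy⟩ := hreach _ x hx
    refine ⟨y, ?_, hc ▸ hcy⟩
    show Sum.inl y ∈ K j
    rw [K1 j h]; exact hy
  · intro j
    by_cases hj : j.val < t * q
    · right
      refine ⟨(col j hj).1, Nat.div_mul_le_self _ _, ?_, ?_⟩
      · exact (Nat.lt_mul_div_succ j.val ht).trans_eq (mul_comm _ _)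
      · dsimp only
        rw [K1 j hj]
        intro x hx
        obtain ⟨y, ⟨_, hy, hr⟩, hcy⟩ := hreach _ x hx
        exact ⟨y, hy, hcy, hr⟩
    · left
      dsimp only
      rw [K2 j hj]
      apply LCC.Cn.toConn
      generalize (⟨j.val - t * q, hidx j hj⟩ : Fin t) = w
      have hl : ∀ v ∈ W w, ∃ x, v = Sum.inl x := by
        rintro (v | v) hv
        · exact ⟨v, rfl⟩
        · exact absurd (hzZ v) (hW3 _ _ hv)
      obtain ⟨v, hv⟩ := (hW1 w).1
      obtain ⟨x, rfl⟩ := hl v hv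
      refine LCC.Cn.intro ⟨x, hv⟩ fun X h1 h2 => ?_
      obtain ⟨a, ha, haX⟩ := h1
      obtain ⟨b, hb, hbX⟩ := h2
      obtain ⟨x, hx, hxX, y, hy, hyX, hxy⟩ := (hW1 w).cross (Sum.inl '' X)
        ⟨_, ha, a, haX, rfl⟩ ⟨_, hb, by simpa using hbX⟩
      obtain ⟨x, rfl⟩ := hl x hx
      obtain ⟨y, rfl⟩ := hl y hy
      exact ⟨x, hx, by simpa using hxX, y, hy, by simpa using hyX, hxy⟩
  · intro i j hij
    dsimp only
    by_cases hi : i.val < t * q <;> by_cases hj : j.val < t * q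
    · exact Or.inr ⟨hi, hj⟩
    · left
      rw [K1 i hi, K2 j hj]
      obtain ⟨x, hx, y, hy, hxy⟩ := hAl (col i hi) ⟨j.val - t * q, hidx j hj⟩
      exact ⟨x, hx, y, hy, hxy⟩
    · left
      rw [K2 i hi, K1 j hj]
      obtain ⟨x, hx, y, hy, hxy⟩ := hAl (col j hj) ⟨i.val - t * q, hidx i hi⟩
      exact ⟨y, hy, x, hx, hxy.symm⟩
    · left
      rw [K2 i hi, K2 j hj]
      obtain ⟨x, hx, y, hy, hxy⟩ := hWx ⟨i.val - t * q, hidx i hi⟩ ⟨j.val - t * q, hidx j hj⟩ (by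
        intro h
        rw [Fin.mk.injEq] at h
        exact hij (Fin.ext (by omega)))
      exact ⟨x, hx, y, hy, hxy⟩
end

section
/- Let q, t, and k be positive integers with k ≥ ⌊(3/2)·qt⌋ + t, and let (G,χ) be a q-colorful graph such that G contains a minor model X of the complete graph K_k. Then at least one of the following holds: (1) there is a colorful minor model F of the rainbow K_t in (G,χ) such that for every separation (A,B) of G of order less than t, some branch set of F is contained in B∖A if and only if some branch set of X is contained in B∖A; or (2) there exists a set S ⊆ V(G) with |S| ≤ qt−1 such that the X-big component of G−S — the unique component of G−S containing every branch set of X disjoint from S — is restricted. -/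
open SimpleGraph

/-- `C` is a connected component of `G − S`: it avoids `S`, induces a connected
subgraph, and is closed under adjacency outside `S`. -/
def IsComponentAvoiding {V : Type*} (G : SimpleGraph V) (S C : Set V) : Prop :=
  Disjoint C S ∧ (G.induce C).Connected ∧
    ∀ x ∈ C, ∀ y, y ∉ S → G.Adj x y → y ∈ C
def RConn {V : Type} (r : V → V → Prop) (S : Set V) : Prop :=
  S.Nonempty ∧ ∀ T ⊆ S, T.Nonempty → (∀ x ∈ T, ∀ y ∈ S, r x y → y ∈ T) → S ⊆ T

lemma RConn.sub {V : Type} {r : V → V → Prop} {S T : Set V} (h : RConn r S) {x : V}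
    (hx : x ∈ S) (hxT : x ∈ T) (hc : ∀ x ∈ S, x ∈ T → ∀ y ∈ S, r x y → y ∈ T) : S ⊆ T := by
  have := h.2 (S ∩ T) Set.inter_subset_left ⟨x, hx, hxT⟩
    (fun x hx y hy hr => ⟨hy, hc x hx.1 hx.2 y hy hr⟩)
  exact fun y hy => (this hy).2

lemma RConn.mono {V : Type} {r r' : V → V → Prop} {S : Set V} (h : RConn r S)
    (hr : ∀ x ∈ S, ∀ y ∈ S, r x y → r' x y) : RConn r' S := by
  refine ⟨h.1, fun T hT hne hc => h.2 T hT hne fun x hx y hy hxy => hc x hx y hy (hr _ (hT hx) _ hy hxy)⟩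

lemma RConn.single {V : Type} (r : V → V → Prop) (x : V) : RConn r {x} := by
  refine ⟨⟨x, rfl⟩, ?_⟩
  rintro T hT ⟨y, hy⟩ - z rfl
  have : y = z := hT hy
  exact this ▸ hy

lemma RConn.center {V : Type} {r : V → V → Prop} (hr : ∀ x y, r x y → r y x) {S U : Set V}
    (hS : RConn r S) (hSU : S ⊆ U)
    (h : ∀ x ∈ U, ∃ Q ⊆ U, RConn r Q ∧ x ∈ Q ∧ ∃ y ∈ Q, ∃ s ∈ S, y = s ∨ r y s) : RConn r U := by
  refine ⟨hS.1.mono hSU, ?_⟩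
  rintro T hT ⟨x, hx⟩ hc
  have hST : S ⊆ T := by
    obtain ⟨Q, hQU, hQ, hxQ, y, hy, s, hs, hys⟩ := h x (hT hx)
    have hQT : Q ⊆ T := hQ.sub hxQ hx (fun a _ haT b hb hab => hc a haT b (hQU hb) hab)
    have hsT : s ∈ T := by
      rcases hys with rfl | hys
      · exact hQT hy
      · exact hc y (hQT hy) s (hSU hs) hys
    exact hS.sub hs hsT (fun a _ haT b hb hab => hc a haT b (hSU hb) hab)
  intro z hz
  obtain ⟨Q, hQU, hQ, hxQ, y, hy, s, hs, hys⟩ := h z hz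
  have hyT : y ∈ T := by
    rcases hys with rfl | hys
    · exact hST hs
    · exact hc s (hST hs) y (hQU hy) (hr _ _ hys)
  exact hQ.sub hy hyT (fun a _ haT b hb hab => hc a haT b (hQU hb) hab) hxQ

lemma RConn.union {V : Type} {r : V → V → Prop} (hr : ∀ x y, r x y → r y x) {S U : Set V}
    (hS : RConn r S) (hU : RConn r U) {x y : V} (hx : x ∈ S) (hy : y ∈ U) (h : y = x ∨ r y x) :
    RConn r (S ∪ U) := by
  refine RConn.center hr hS Set.subset_union_left ?_
  rintro z (hz | hz)
  · exact ⟨S, Set.subset_union_left, hS, hz, z, hz, z, hz, Or.inl rfl⟩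
  · exact ⟨U, Set.subset_union_right, hU, hz, y, hy, x, hx, h⟩

/-- component of a point within a set -/
lemma RConn.exists_comp {V : Type} {r : V → V → Prop} (hr : ∀ x y, r x y → r y x) {K U : Set V}
    (hK : RConn r K) (hKU : K ⊆ U) :
    ∃ C, K ⊆ C ∧ C ⊆ U ∧ RConn r C ∧ ∀ x ∈ C, ∀ y ∈ U, r x y → y ∈ C := by
  have hC : RConn r {x | ∃ Q, K ⊆ Q ∧ Q ⊆ U ∧ RConn r Q ∧ x ∈ Q} := by
    refine RConn.center hr hK (fun x hx => ⟨K, subset_rfl, hKU, hK, hx⟩) ?_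
    rintro x ⟨Q, h1, h2, h3, h4⟩
    obtain ⟨s, hs⟩ := hK.1
    exact ⟨Q, fun y hy => ⟨Q, h1, h2, h3, hy⟩, h3, h4, s, h1 hs, s, hs, Or.inl rfl⟩
  refine ⟨{x | ∃ Q, K ⊆ Q ∧ Q ⊆ U ∧ RConn r Q ∧ x ∈ Q},
    fun x hx => ⟨K, subset_rfl, hKU, hK, hx⟩, ?_, hC, ?_⟩
  · rintro x ⟨Q, h1, h2, h3, h4⟩
    exact h2 h4
  · rintro x ⟨Q, h1, h2, h3, h4⟩ y hy hxy
    refine ⟨Q ∪ {y}, h1.trans Set.subset_union_left, ?_, ?_, Or.inr rfl⟩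
    · rintro z (hz | rfl)
      · exact h2 hz
      · exact hy
    · exact RConn.union hr h3 (RConn.single r y) h4 rfl (Or.inr (hr _ _ hxy))

lemma RConn.remove {V : Type} {r : V → V → Prop} (hr : ∀ x y, r x y → r y x) {P : Set V}
    (hP : RConn r P) {z y : V} (hz : z ∈ P) (hy : y ∈ P) (hzy : y ≠ z) :
    ∃ Q ⊆ P, z ∉ Q ∧ RConn r Q ∧ y ∈ Q ∧ ∃ x ∈ Q, r z x := by
  obtain ⟨C, h1, h2, h3, h4⟩ := RConn.exists_comp hr (RConn.single r y) (U := P \ {z})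
    (by rintro _ rfl; exact ⟨hy, hzy⟩)
  have hzC : z ∉ C := fun h => (h2 h).2 rfl
  refine ⟨C, fun x hx => (h2 hx).1, hzC, h3, h1 rfl, ?_⟩
  by_contra hcon
  push Not at hcon
  refine hzC (hP.sub hy (h1 rfl) ?_ hz)
  intro a ha haC b hb hab
  by_cases hbz : b = z
  · subst hbz
    exact absurd (hr _ _ hab) (hcon a haC)
  · exact h4 a haC b ⟨hb, hbz⟩ hab

lemma rconn_iff {V : Type} (G : SimpleGraph V) (S : Set V) :
    RConn G.Adj S ↔ (G.induce S).Connected := by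
  constructor
  · intro h
    have : Nonempty S := h.1.to_subtype
    refine SimpleGraph.Connected.mk ?_
    rintro ⟨x, hx⟩ ⟨y, hy⟩
    have := h.sub (T := {y | ∃ hy : y ∈ S, (G.induce S).Reachable ⟨x, hx⟩ ⟨y, hy⟩}) hx
      ⟨hx, SimpleGraph.Reachable.refl _⟩ ?_ hy
    · exact this.2
    · rintro a ha ⟨_, h1⟩ b hb hab
      refine ⟨hb, h1.trans (SimpleGraph.Adj.reachable ?_)⟩
      exact hab
  · intro h
    obtain ⟨⟨x, hx⟩⟩ := h.nonempty
    refine ⟨⟨x, hx⟩, ?_⟩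
    rintro T hT ⟨a, ha⟩ hc b hb
    have hreach := h.preconnected ⟨a, hT ha⟩ ⟨b, hb⟩
    rw [SimpleGraph.reachable_iff_reflTransGen] at hreach
    have : ∀ c : S, Relation.ReflTransGen (G.induce S).Adj ⟨a, hT ha⟩ c → c.1 ∈ T := by
      intro c hcc
      induction hcc with
      | refl => exact ha
      | tail _ h2 ih => exact hc _ ih _ (Subtype.property _) h2
    exact this _ hreach

/-- number of (ordered) edges -/
noncomputable def ecount {V : Type} (H : SimpleGraph V) : ℕ := {p : V × V | H.Adj p.1 p.2}.ncard

def restr {V : Type} (H : SimpleGraph V) (A : Set V) : SimpleGraph V where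
  Adj x y := H.Adj x y ∧ x ∈ A ∧ y ∈ A
  symm := ⟨fun _ _ h => ⟨h.1.symm, h.2.2, h.2.1⟩⟩
  loopless := ⟨fun _ h => H.irrefl h.1⟩

lemma ecount_lt {V : Type} [Finite V] {H H' : SimpleGraph V} (h : ∀ x y, H'.Adj x y → H.Adj x y)
    {a b : V} (hab : H.Adj a b) (hab' : ¬ H'.Adj a b) : ecount H' < ecount H := by
  apply Set.ncard_lt_ncard _ (Set.toFinite _)
  refine ⟨fun p hp => h _ _ hp, fun hh => hab' (hh (a := (a, b)) hab)⟩

theorem menger_sets {V : Type} [Finite V] (N : ℕ) : ∀ (H : SimpleGraph V), ecount H ≤ N →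
    ∀ Z Y : Set V, (∀ A B, IsSeparation H A B → Z ⊆ A → Y ⊆ B → Z.ncard ≤ (A ∩ B).ncard) →
    ∃ P : V → Set V, (∀ z ∈ Z, z ∈ P z ∧ RConn H.Adj (P z) ∧ ∃ y ∈ Y, y ∈ P z) ∧
      ∀ z ∈ Z, ∀ z' ∈ Z, z ≠ z' → Disjoint (P z) (P z') := by
  classical
  induction N using Nat.strong_induction_on with
  | _ N ih =>
  intro H hN Z Y hsep
  by_cases hZY : Z ⊆ Y
  · exact ⟨fun z => {z}, fun z hz => ⟨rfl, RConn.single _ _, z, hZY hz, rfl⟩,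
      fun z _ z' _ hne => by simpa using hne⟩
  by_cases hE : ∃ u v, H.Adj u v
  swap
  · exfalso
    push Not at hE
    have := hsep Z (Y ∪ Zᶜ) ⟨by ext x; simp; tauto, fun a _ b _ => hE a b⟩ subset_rfl
      Set.subset_union_left
    apply hZY
    have h2 : Z ∩ (Y ∪ Zᶜ) = Z := Set.eq_of_subset_of_ncard_le Set.inter_subset_left this
    intro x hx
    rw [← h2] at hx
    rcases hx.2 with h | h
    · exact h
    · exact absurd hx.1 h
  obtain ⟨u, v, huv⟩ := hE
  let H1 : SimpleGraph V :=
    { Adj := fun x y => H.Adj x y ∧ ¬ (x = u ∧ y = v) ∧ ¬ (x = v ∧ y = u)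
      symm := ⟨fun x y h => ⟨h.1.symm, by tauto, by tauto⟩⟩
      loopless := ⟨fun _ h => H.irrefl h.1⟩ }
  have hH1 : ∀ x y, H1.Adj x y → H.Adj x y := fun x y h => h.1
  by_cases hs1 : ∀ A B, IsSeparation H1 A B → Z ⊆ A → Y ⊆ B → Z.ncard ≤ (A ∩ B).ncard
  · have hlt : ecount H1 < ecount H := ecount_lt hH1 huv (fun h => h.2.1 ⟨rfl, rfl⟩)
    obtain ⟨P, hP1, hP2⟩ := ih (ecount H1) (by omega) H1 le_rfl Z Y hs1
    exact ⟨P, fun z hz => ⟨(hP1 z hz).1, (hP1 z hz).2.1.mono (fun x _ y _ => hH1 x y),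
      (hP1 z hz).2.2⟩, hP2⟩
  push Not at hs1
  obtain ⟨A, B, hAB, hZA, hYB, hlt⟩ := hs1
  have hex : ∃ a ∈ A \ B, ∃ b ∈ B \ A, H.Adj a b := by
    by_contra hcon
    push Not at hcon
    have := hsep A B ⟨hAB.1, hcon⟩ hZA hYB
    omega
  obtain ⟨a, ha, b, hb, hab⟩ := hex
  have huniq : ∀ x ∈ A \ B, ∀ y ∈ B \ A, H.Adj x y → x = a ∧ y = b := by
    have key : ∀ x ∈ A \ B, ∀ y ∈ B \ A, H.Adj x y → (x = u ∧ y = v) ∨ (x = v ∧ y = u) := by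
      intro x hx y hy hxy
      by_contra hcon
      exact hAB.2 x hx y hy ⟨hxy, by tauto, by tauto⟩
    intro x hx y hy hxy
    rcases key x hx y hy hxy with ⟨rfl, rfl⟩ | ⟨rfl, rfl⟩ <;>
    rcases key a ha b hb hab with ⟨rfl, rfl⟩ | ⟨rfl, rfl⟩
    · exact ⟨rfl, rfl⟩
    · exact absurd hx.1 hb.2
    · exact absurd hx.1 hb.2
    · exact ⟨rfl, rfl⟩
  have hcov : ∀ x, x ∈ A ∨ x ∈ B := fun x => by
    have : x ∈ A ∪ B := hAB.1 ▸ Set.mem_univ x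
    exact this
  have hY1 : (insert a (A ∩ B)).ncard = (A ∩ B).ncard + 1 :=
    Set.ncard_insert_of_notMem (fun h => ha.2 h.2)
  have hZ1 : (insert b (A ∩ B)).ncard = (A ∩ B).ncard + 1 :=
    Set.ncard_insert_of_notMem (fun h => hb.2 h.1)
  have hm : Z.ncard = (A ∩ B).ncard + 1 := by
    have := hsep A (insert a B) ⟨by ext x; simp; have := hcov x; tauto, ?_⟩ hZA
      (hYB.trans (Set.subset_insert _ _))
    · have h2 : A ∩ insert a B = insert a (A ∩ B) := by
        ext x; simp only [Set.mem_inter_iff, Set.mem_insert_iff]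
        constructor
        · tauto
        · rintro (rfl | h)
          · exact ⟨ha.1, Or.inl rfl⟩
          · tauto
      rw [h2] at this
      omega
    · rintro x ⟨hxA, hxB⟩ y ⟨hyB, hyA⟩ hxy
      simp only [Set.mem_insert_iff, not_or] at hxB hyB
      rcases hyB with rfl | hyB
      · exact hyA ha.1
      · exact hxB.1 (huniq x ⟨hxA, hxB.2⟩ y ⟨hyB, hyA⟩ hxy).1
  -- left
  have hltA : ecount (restr H A) < ecount H := ecount_lt (fun x y h => h.1) hab (fun h => hb.2 h.2.2)
  have hltB : ecount (restr H B) < ecount H := ecount_lt (fun x y h => h.1) hab (fun h => ha.2 h.2.1)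
  obtain ⟨P1, hP1, hP1d⟩ := ih _ (by omega) (restr H A) le_rfl Z (insert a (A ∩ B)) (by
    intro C D hCD hZC hYD
    have hc2 : ∀ x, x ∈ C ∨ x ∈ D := fun x => by
      have : x ∈ C ∪ D := hCD.1 ▸ Set.mem_univ x
      exact this
    have := hsep (C ∩ A) (D ∪ B) ⟨by ext x; have := hc2 x; have := hcov x; simp; tauto, ?_⟩
      (fun x hx => ⟨hZC hx, hZA hx⟩) (hYB.trans Set.subset_union_right)
    · refine this.trans (Set.ncard_le_ncard ?_ (Set.toFinite _))
      rintro x ⟨⟨h1, h2⟩, h3 | h3⟩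
      · exact ⟨h1, h3⟩
      · exact ⟨h1, hYD (Or.inr ⟨h2, h3⟩)⟩
    · rintro x ⟨⟨hxC, hxA⟩, hx⟩ y ⟨hy, hy'⟩ hxy
      have hxD : x ∉ D := fun h => hx (Or.inl h)
      have hxB : x ∉ B := fun h => hx (Or.inr h)
      have hyA : y ∈ A := by
        by_contra hyA
        have := huniq x ⟨hxA, hxB⟩ y ⟨(hcov y).resolve_left hyA, hyA⟩ hxy
        exact hxD (hYD (Or.inl this.1))
      have hyC : y ∉ C := fun h => hy' ⟨h, hyA⟩
      exact hCD.2 x ⟨hxC, hxD⟩ y ⟨(hc2 y).resolve_left hyC, hyC⟩ ⟨hxy, hxA, hyA⟩)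
  obtain ⟨P2, hP2, hP2d⟩ := ih _ (by omega) (restr H B) le_rfl (insert b (A ∩ B)) Y (by
    intro C D hCD hZC hYD
    have hc2 : ∀ x, x ∈ C ∨ x ∈ D := fun x => by
      have : x ∈ C ∪ D := hCD.1 ▸ Set.mem_univ x
      exact this
    have := hsep (C ∪ A) (D ∩ B) ⟨by ext x; have := hc2 x; have := hcov x; simp; tauto, ?_⟩
      (hZA.trans Set.subset_union_right) (fun x hx => ⟨hYD hx, hYB hx⟩) 
    · rw [hZ1, ← hm]
      refine this.trans (Set.ncard_le_ncard ?_ (Set.toFinite _))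
      rintro x ⟨h3 | h3, ⟨h1, h2⟩⟩
      · exact ⟨h3, h1⟩
      · exact ⟨hZC (Or.inr ⟨h3, h2⟩), h1⟩
    · rintro x ⟨hx, hx'⟩ y ⟨⟨hyD, hyB⟩, hy'⟩ hxy
      have hyC : y ∉ C := fun h => hy' (Or.inl h)
      have hyA : y ∉ A := fun h => hy' (Or.inr h)
      have hxB : x ∈ B := by
        by_contra hxB
        have := huniq x ⟨(hcov x).resolve_right hxB, hxB⟩ y ⟨hyB, hyA⟩ hxy
        exact hyC (hZC (Or.inl this.2))
      have hxD : x ∉ D := fun h => hx' ⟨h, hxB⟩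
      exact hCD.2 x ⟨(hc2 x).resolve_right hxD, hxD⟩ y ⟨hyD, hyC⟩ ⟨hxy, hxB, hyB⟩)
  have hP1A : ∀ z ∈ Z, P1 z ⊆ A := fun z hz =>
    (hP1 z hz).2.1.sub (hP1 z hz).1 (hZA hz) (fun x _ _ y _ h => h.2.2)
  have hZ1B : insert b (A ∩ B) ⊆ B := by
    rintro x (rfl | h)
    · exact hb.1
    · exact h.2
  have hP2B : ∀ z ∈ insert b (A ∩ B), P2 z ⊆ B := fun z hz =>
    (hP2 z hz).2.1.sub (hP2 z hz).1 (hZ1B hz) (fun x _ _ y _ h => h.2.2)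
  have hex : ∀ z, ∃ y, z ∈ Z → y ∈ insert a (A ∩ B) ∧ y ∈ P1 z := fun z => by
    by_cases hz : z ∈ Z
    · obtain ⟨y, h1, h2⟩ := (hP1 z hz).2.2
      exact ⟨y, fun _ => ⟨h1, h2⟩⟩
    · exact ⟨z, fun h => absurd h hz⟩
  choose σ hσ using hex
  have hσinj : Set.InjOn σ Z := by
    intro z hz z' hz' he
    by_contra hne
    exact Set.disjoint_left.1 (hP1d z hz z' hz' hne) (hσ z hz).2 (he ▸ (hσ z' hz').2)
  have hσim : σ '' Z = insert a (A ∩ B) := by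
    apply Set.eq_of_subset_of_ncard_le
    · rintro _ ⟨z, hz, rfl⟩
      exact (hσ z hz).1
    · rw [hσinj.ncard_image, hm, hY1]
    · exact Set.toFinite _
  have hσu : ∀ z ∈ Z, ∀ y ∈ insert a (A ∩ B), y ∈ P1 z → y = σ z := by
    intro z hz y hy hyz
    rw [← hσim] at hy
    obtain ⟨z', hz', rfl⟩ := hy
    by_contra hne
    have hne' : z ≠ z' := fun h => hne (by rw [h])
    exact Set.disjoint_left.1 (hP1d z hz z' hz' hne') hyz (hσ z' hz').2
  let τ : V → V := fun y => if y = a then b else y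
  have hτ : ∀ y ∈ insert a (A ∩ B), τ y ∈ insert b (A ∩ B) := by
    intro y hy
    by_cases h : y = a
    · simp [τ, h]
    · have : τ y = y := by simp [τ, h]
      rw [this]
      exact Or.inr (hy.resolve_left h)
  have hτi : ∀ y ∈ insert a (A ∩ B), ∀ y' ∈ insert a (A ∩ B), τ y = τ y' → y = y' := by
    intro y hy y' hy' he
    by_cases h : y = a <;> by_cases h' : y' = a <;> simp only [τ, h, h', if_true, if_false] at he ⊢
    · exact absurd (he ▸ (hy'.resolve_left h').1) hb.2
    · exact absurd (he ▸ (hy.resolve_left h).1) hb.2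
    · exact he
  have hcross : ∀ z ∈ Z, ∀ z' ∈ Z, z ≠ z' → Disjoint (P1 z) (P2 (τ (σ z'))) := by
    intro z hz z' hz' hne
    rw [Set.disjoint_left]
    intro x hx hx'
    have hxA := hP1A z hz hx
    have hxB := hP2B _ (hτ _ (hσ z' hz').1) hx'
    have h1 := hσu z hz x (Or.inr ⟨hxA, hxB⟩) hx
    have hxa : x ≠ a := fun h => ha.2 (h ▸ hxB)
    have h2 : τ (σ z) = x := by rw [← h1]; simp [τ, hxa]
    have hne2 : τ (σ z) ≠ τ (σ z') := fun h =>
      hne (hσinj hz hz' (hτi _ (hσ z hz).1 _ (hσ z' hz').1 h))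
    refine Set.disjoint_left.1 (hP2d _ (hτ _ (hσ z hz).1) _ (hτ _ (hσ z' hz').1) hne2) ?_ hx'
    have := (hP2 _ (hτ _ (hσ z hz).1)).1
    rwa [h2] at this ⊢
  refine ⟨fun z => P1 z ∪ P2 (τ (σ z)), ?_, ?_⟩
  · intro z hz
    have hσz := hσ z hz
    have hP2z := hP2 _ (hτ _ hσz.1)
    refine ⟨Or.inl (hP1 z hz).1, ?_, ?_⟩
    · refine RConn.union (fun x y h => h.symm) ((hP1 z hz).2.1.mono fun x _ y _ h => h.1)
        (hP2z.2.1.mono fun x _ y _ h => h.1) hσz.2 hP2z.1 ?_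
      by_cases h : σ z = a
      · right
        simp only [τ, h, if_true]
        exact hab.symm
      · left
        simp [τ, h]
    · obtain ⟨y, h1, h2⟩ := hP2z.2.2
      exact ⟨y, h1, Or.inr h2⟩
  · intro z hz z' hz' hne
    rw [Set.disjoint_union_left, Set.disjoint_union_right, Set.disjoint_union_right]
    refine ⟨⟨hP1d z hz z' hz' hne, hcross z hz z' hz' hne⟩, (hcross z' hz' z hz hne.symm).symm, ?_⟩
    refine hP2d _ (hτ _ (hσ z hz).1) _ (hτ _ (hσ z' hz').1) fun h =>
      hne (hσinj hz hz' (hτi _ (hσ z hz).1 _ (hσ z' hz').1 h))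

def aug {V : Type} (H : SimpleGraph V) (Z : Set V) (x y : V) : Prop :=
  H.Adj x y ∨ (x ∈ Z ∧ y ∈ Z)

structure GoodModel {V : Type} {k : ℕ} (H : SimpleGraph V) (Z : Set V) (X : Fin k → Set V) :
    Prop where
  conn : ∀ i, RConn (aug H Z) (X i)
  disj : ∀ i j, i ≠ j → Disjoint (X i) (X j)
  adj : ∀ i j, i ≠ j → ∃ x ∈ X i, ∃ y ∈ X j, aug H Z x y
  indep : ∀ x ∈ Z, ∀ y ∈ Z, ¬ H.Adj x y
  sep : ∀ A B, IsSeparation H A B → Z ⊆ A → ∀ i, X i ⊆ B \ A → Z.ncard ≤ (A ∩ B).ncard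

def Concl {V : Type} {k : ℕ} (t : ℕ) (H : SimpleGraph V) (Z : Set V) (X : Fin k → Set V)
    (g : V → Fin t) : Prop :=
  ∃ (F : Fin t → Set V) (h : Fin t → Fin k), (∀ j, RConn H.Adj (F j)) ∧
    (∀ j j', j ≠ j' → Disjoint (F j) (F j')) ∧ (∀ j, Disjoint (F j) Z) ∧
    (∀ j, X (h j) ⊆ F j) ∧ ∀ z ∈ Z, ∃ x ∈ F (g z), H.Adj z x

def delIn {V : Type} (H : SimpleGraph V) (B Z : Set V) : SimpleGraph V where
  Adj x y := H.Adj x y ∧ x ∈ B ∧ y ∈ B ∧ ¬ (x ∈ Z ∧ y ∈ Z)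
  symm := ⟨fun _ _ h => ⟨h.1.symm, h.2.2.1, h.2.1, fun h' => h.2.2.2 ⟨h'.2, h'.1⟩⟩⟩
  loopless := ⟨fun _ h => H.irrefl h.1⟩

lemma case_one {V : Type} [Finite V] {k t : ℕ} {H : SimpleGraph V} {Z : Set V}
    {X : Fin k → Set V} (hG : GoodModel H Z X) (g : V → Fin t) {A B : Set V}
    (hAB : IsSeparation H A B) (hZA : Z ⊆ A) (i0 : Fin k) (hi0 : X i0 ⊆ B \ A)
    (hcard : (A ∩ B).ncard = Z.ncard)
    (ih : ∀ g', GoodModel (delIn H B (A ∩ B)) (A ∩ B) (fun i => X i ∩ B) →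
      Concl t (delIn H B (A ∩ B)) (A ∩ B) (fun i => X i ∩ B) g') : Concl t H Z X g := by
  classical
  have hcov : ∀ x, x ∈ A ∨ x ∈ B := fun x => by
    have : x ∈ A ∪ B := hAB.1 ▸ Set.mem_univ x
    exact this
  have hedge : ∀ x y, H.Adj x y → y ∈ B → y ∉ A → x ∈ B := by
    intro x y hxy hyB hyA
    by_contra hx
    exact hAB.2 x ⟨(hcov x).resolve_right hx, hx⟩ y ⟨hyB, hyA⟩ hxy
  have haug : ∀ x y, aug H Z x y → y ∈ B → y ∉ A → H.Adj x y := by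
    rintro x y (h | h) hyB hyA
    · exact h
    · exact absurd (hZA h.2) hyA
  have haug' : ∀ x y, aug H Z x y → x ∈ B → x ∉ A → H.Adj x y := by
    rintro x y (h | h) hyB hyA
    · exact h
    · exact absurd (hZA h.1) hyA
  have hne : ∀ i, (X i ∩ B).Nonempty := by
    intro i
    by_cases h : i = i0
    · subst h
      obtain ⟨x, hx⟩ := (hG.conn i).1
      exact ⟨x, hx, (hi0 hx).1⟩
    · obtain ⟨x, hx, y, hy, hxy⟩ := hG.adj i i0 h
      have hyy := hi0 hy
      exact ⟨x, hx, hedge x y (haug x y hxy hyy.1 hyy.2) hyy.1 hyy.2⟩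
  -- if X i misses A ∩ B then X i ⊆ B \ A
  have hmiss : ∀ i, Disjoint (X i) (A ∩ B) → X i ⊆ B \ A := by
    intro i hd
    obtain ⟨x, hx, hxB⟩ := hne i
    have hxA : x ∉ A := fun h => Set.disjoint_left.1 hd hx ⟨h, hxB⟩
    refine (hG.conn i).sub hx ⟨hxB, hxA⟩ ?_
    intro a ha haB b hb hab
    have hbB := hedge b a (haug' a b hab haB.1 haB.2).symm haB.1 haB.2
    exact ⟨hbB, fun h => Set.disjoint_left.1 hd hb ⟨h, hbB⟩⟩
  have hgood : GoodModel (delIn H B (A ∩ B)) (A ∩ B) (fun i => X i ∩ B) := by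
    refine ⟨?_, ?_, ?_, ?_, ?_⟩
    · intro i
      refine ⟨hne i, ?_⟩
      rintro T hT ⟨x, hx⟩ hc
      by_cases hTZ : ∃ z ∈ T, z ∈ A ∩ B
      · obtain ⟨z, hzT, hzZ⟩ := hTZ
        have hall : ∀ y ∈ X i, y ∈ A ∩ B → y ∈ T := fun y hy hyZ =>
          hc z hzT y ⟨hy, hyZ.2⟩ (Or.inr ⟨hzZ, hyZ⟩)
        have := (hG.conn i).sub (T := T ∪ (X i ∩ A)) (hT hx).1 (Or.inl hx) (by
          intro a haX ha b hb hab
          by_cases hbA : b ∈ A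
          · exact Or.inr ⟨hb, hbA⟩
          have hbB := (hcov b).resolve_left hbA
          have hH := haug a b hab hbB hbA
          have haB := hedge a b hH hbB hbA
          have haT : a ∈ T := by
            rcases ha with ha | ha
            · exact ha
            · exact hall a haX ⟨ha.2, haB⟩
          exact Or.inl (hc a haT b ⟨hb, hbB⟩ (Or.inl ⟨hH, haB, hbB, fun h => hbA h.2.1⟩)))
        rintro y ⟨hy, hyB⟩
        rcases this hy with h | h
        · exact h
        · exact hall y hy ⟨h.2, hyB⟩
      · push Not at hTZ
        have := (hG.conn i).sub (T := T) (hT hx).1 hx (by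
          intro a haX ha b hb hab
          have haB := (hT ha).2
          have haA : a ∉ A := fun h => hTZ a ha ⟨h, haB⟩
          have hH := haug' a b hab haB haA
          have hbB := hedge b a hH.symm haB haA
          exact hc a ha b ⟨hb, hbB⟩ (Or.inl ⟨hH, haB, hbB, fun h => haA h.1.1⟩))
        exact fun y hy => this hy.1
    · intro i j hij
      exact (hG.disj i j hij).mono Set.inter_subset_left Set.inter_subset_left
    · intro i j hij
      by_cases hi : Disjoint (X i) (A ∩ B)
      · obtain ⟨x, hx, y, hy, hxy⟩ := hG.adj i j hij
        have hxx := hmiss i hi hx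
        have hH := haug' x y hxy hxx.1 hxx.2
        have hyB := hedge y x hH.symm hxx.1 hxx.2
        exact ⟨x, ⟨hx, hxx.1⟩, y, ⟨hy, hyB⟩, Or.inl ⟨hH, hxx.1, hyB, fun h => hxx.2 h.1.1⟩⟩
      by_cases hj : Disjoint (X j) (A ∩ B)
      · obtain ⟨x, hx, y, hy, hxy⟩ := hG.adj i j hij
        have hxx := hmiss j hj hy
        have hH := haug x y hxy hxx.1 hxx.2
        have hyB := hedge x y hH hxx.1 hxx.2
        exact ⟨x, ⟨hx, hyB⟩, y, ⟨hy, hxx.1⟩, Or.inl ⟨hH, hyB, hxx.1, fun h => hxx.2 h.2.1⟩⟩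
      obtain ⟨x, hx, hx'⟩ := Set.not_disjoint_iff.1 hi
      obtain ⟨y, hy, hy'⟩ := Set.not_disjoint_iff.1 hj
      exact ⟨x, ⟨hx, hx'.2⟩, y, ⟨hy, hy'.2⟩, Or.inr ⟨hx', hy'⟩⟩
    · intro x hx y hy h
      exact h.2.2.2 ⟨hx, hy⟩
    · intro C D hCD hZC i hi
      have hc2 : ∀ x, x ∈ C ∨ x ∈ D := fun x => by
        have : x ∈ C ∪ D := hCD.1 ▸ Set.mem_univ x
        exact this
      have hd : Disjoint (X i) (A ∩ B) := by
        rw [Set.disjoint_left]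
        intro x hx hxx
        exact (hi ⟨hx, hxx.2⟩).2 (hZC hxx)
      have hXi := hmiss i hd
      rw [hcard]
      refine (hG.sep (A ∪ (C ∩ B)) (D ∩ B) ⟨?_, ?_⟩ (hZA.trans Set.subset_union_left) i ?_).trans
        (Set.ncard_le_ncard ?_ (Set.toFinite _))
      · ext x; have := hc2 x; have := hcov x; simp; tauto
      · rintro x ⟨hx, hx'⟩ y ⟨⟨hyD, hyB⟩, hy'⟩ hxy
        have hyA : y ∉ A := fun h => hy' (Or.inl h)
        have hyC : y ∉ C := fun h => hy' (Or.inr ⟨h, hyB⟩)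
        have hxB := hedge x y hxy hyB hyA
        have hxD : x ∉ D := fun h => hx' ⟨h, hxB⟩
        exact hCD.2 x ⟨(hc2 x).resolve_right hxD, hxD⟩ y ⟨hyD, hyC⟩
          ⟨hxy, hxB, hyB, fun h => hyA h.2.1⟩
      · intro x hx
        have h1 := hXi hx
        have h2 := hi ⟨hx, h1.1⟩
        refine ⟨⟨h2.1, h1.1⟩, ?_⟩
        rintro (h | h)
        · exact h1.2 h
        · exact h2.2 h.1
      · rintro x ⟨h | h, h'⟩
        · exact ⟨hZC ⟨h, h'.2⟩, h'.1⟩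
        · exact ⟨h.1, h'.1⟩
  obtain ⟨P, hP, hPd⟩ := menger_sets _ (restr H A) le_rfl Z (A ∩ B) (by
    intro C D hCD hZC hYD
    have hc2 : ∀ x, x ∈ C ∨ x ∈ D := fun x => by
      have : x ∈ C ∪ D := hCD.1 ▸ Set.mem_univ x
      exact this
    refine (hG.sep (C ∩ A) (D ∪ B) ⟨?_, ?_⟩ (fun x hx => ⟨hZC hx, hZA hx⟩) i0 ?_).trans
        (Set.ncard_le_ncard ?_ (Set.toFinite _))
    · ext x; have := hc2 x; have := hcov x; simp; tauto
    · rintro x ⟨⟨hxC, hxA⟩, hx⟩ y ⟨hy, hy'⟩ hxy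
      have hxD : x ∉ D := fun h => hx (Or.inl h)
      have hxB : x ∉ B := fun h => hx (Or.inr h)
      have hyA : y ∈ A := by
        by_contra hyA
        exact hxB (hedge x y hxy ((hcov y).resolve_left hyA) hyA)
      have hyC : y ∉ C := fun h => hy' ⟨h, hyA⟩
      exact hCD.2 x ⟨hxC, hxD⟩ y ⟨(hc2 y).resolve_left hyC, hyC⟩ ⟨hxy, hxA, hyA⟩
    · intro x hx
      exact ⟨Or.inr (hi0 hx).1, fun h => (hi0 hx).2 h.2⟩
    · rintro x ⟨⟨h1, h2⟩, h3 | h3⟩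
      · exact ⟨h1, h3⟩
      · exact ⟨h1, hYD ⟨h2, h3⟩⟩)
  have hPA : ∀ z ∈ Z, P z ⊆ A := fun z hz =>
    (hP z hz).2.1.sub (hP z hz).1 (hZA hz) (fun x _ _ y _ h => h.2.2)
  have hex : ∀ z, ∃ y, z ∈ Z → y ∈ A ∩ B ∧ y ∈ P z := fun z => by
    by_cases hz : z ∈ Z
    · obtain ⟨y, h1, h2⟩ := (hP z hz).2.2
      exact ⟨y, fun _ => ⟨h1, h2⟩⟩
    · exact ⟨z, fun h => absurd h hz⟩
  choose σ hσ using hex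
  have hσinj : Set.InjOn σ Z := by
    intro z hz z' hz' he
    by_contra hne
    exact Set.disjoint_left.1 (hPd z hz z' hz' hne) (hσ z hz).2 (he ▸ (hσ z' hz').2)
  have hex2 : ∀ z, ∃ Q : Set V, z ∈ Z → Q ⊆ P z ∧ z ∉ Q ∧
      ((σ z = z ∧ Q = ∅) ∨ (RConn H.Adj Q ∧ σ z ∈ Q ∧ ∃ x ∈ Q, H.Adj z x)) := by
    intro z
    by_cases hz : z ∈ Z
    swap
    · exact ⟨∅, fun h => absurd h hz⟩
    by_cases h : σ z = z
    · exact ⟨∅, fun _ => ⟨Set.empty_subset _, fun h => h, Or.inl ⟨h, rfl⟩⟩⟩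
    · obtain ⟨Q, h1, h2, h3, h4, h5⟩ := RConn.remove (fun x y (h : H.Adj x y) => h.symm)
        ((hP z hz).2.1.mono (r' := H.Adj) fun x _ y _ h => h.1) (hP z hz).1 (hσ z hz).2 h
      exact ⟨Q, fun _ => ⟨h1, h2, Or.inr ⟨h3, h4, h5⟩⟩⟩
  choose Q hQ using hex2
  have : t = 0 ∨ Nonempty V := by
    obtain ⟨x, -⟩ := (hG.conn i0).1
    exact Or.inr ⟨x⟩
  have hV : Nonempty V := by
    obtain ⟨x, -⟩ := (hG.conn i0).1
    exact ⟨x⟩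
  obtain ⟨F, h, hF1, hF2, hF3, hF4, hF5⟩ := ih (fun y => g (Function.invFunOn σ Z y)) hgood
  have hFBA : ∀ j, F j ⊆ B \ A := by
    intro j
    obtain ⟨x, hx⟩ := hne (h j)
    have hxF := hF4 j hx
    have hB : F j ⊆ B := (hF1 j).sub hxF hx.2 (fun a _ _ b _ hab => hab.2.2.1)
    exact fun y hy => ⟨hB hy, fun hA => Set.disjoint_left.1 (hF3 j) hy ⟨hA, hB hy⟩⟩
  have hQA : ∀ z ∈ Z, Q z ⊆ A := fun z hz => (hQ z hz).1.trans (hPA z hz)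
  have hσF : ∀ z ∈ Z, ∃ x ∈ F (g z), H.Adj (σ z) x := by
    intro z hz
    obtain ⟨x, hx, hxx⟩ := hF5 (σ z) (hσ z hz).1
    have : Function.invFunOn σ Z (σ z) = z := hσinj.leftInvOn_invFunOn hz
    simp only [this] at hx
    exact ⟨x, hx, hxx.1⟩
  refine ⟨fun j => F j ∪ {x | ∃ z ∈ Z, g z = j ∧ x ∈ Q z}, h, ?_, ?_, ?_, ?_, ?_⟩
  · intro j
    refine RConn.center (fun x y (h : H.Adj x y) => h.symm) ((hF1 j).mono (r' := H.Adj) fun x _ y _ h => h.1)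
      Set.subset_union_left ?_
    rintro x (hx | ⟨z, hz, rfl, hxQ⟩)
    · exact ⟨{x}, by rintro _ rfl; exact Or.inl hx, RConn.single _ _, rfl, x, rfl, x, hx, Or.inl rfl⟩
    · refine ⟨Q z, fun y hy => Or.inr ⟨z, hz, rfl, hy⟩, ?_⟩
      obtain ⟨-, -, ⟨-, h2⟩ | ⟨h1, h2, h3⟩⟩ := hQ z hz
      · rw [h2] at hxQ
        exact absurd hxQ (Set.notMem_empty _)
      · obtain ⟨y, hy, hyy⟩ := hσF z hz
        exact ⟨h1, hxQ, σ z, h2, y, hy, Or.inr hyy⟩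
  · intro j j' hjj
    rw [Set.disjoint_left]
    rintro x (hx | ⟨z, hz, rfl, hxQ⟩) (hx' | ⟨z', hz', rfl, hxQ'⟩)
    · exact Set.disjoint_left.1 (hF2 j j' hjj) hx hx'
    · exact (hFBA _ hx).2 (hQA _ hz' hxQ')
    · exact (hFBA _ hx').2 (hQA _ hz hxQ)
    · have hzz : z ≠ z' := fun h => hjj (by rw [h])
      exact Set.disjoint_left.1 (hPd z hz z' hz' hzz) ((hQ z hz).1 hxQ) ((hQ z' hz').1 hxQ')
  · intro j
    rw [Set.disjoint_left]
    rintro x (hx | ⟨z, hz, rfl, hxQ⟩) hxZ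
    · exact (hFBA _ hx).2 (hZA hxZ)
    · by_cases hxz : x = z
      · exact (hQ z hz).2.1 (hxz ▸ hxQ)
      · exact Set.disjoint_left.1 (hPd x hxZ z hz hxz) (hP x hxZ).1 ((hQ z hz).1 hxQ)
  · intro j x hx
    have hd : Disjoint (X (h j)) (A ∩ B) := by
      rw [Set.disjoint_left]
      intro y hy hyy
      exact Set.disjoint_left.1 (hF3 j) (hF4 j ⟨hy, hyy.2⟩) hyy
    exact Or.inl (hF4 j ⟨hx, (hmiss _ hd hx).1⟩)
  · intro z hz
    obtain ⟨-, -, ⟨h1, -⟩ | ⟨-, -, x, hx, hxx⟩⟩ := hQ z hz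
    · obtain ⟨y, hy, hyy⟩ := hσF z hz
      exact ⟨y, Or.inl hy, h1 ▸ hyy⟩
    · exact ⟨x, Or.inr ⟨z, hz, rfl, hx⟩, hxx⟩

def contr {V : Type} (H : SimpleGraph V) (Z : Set V) (f : V → V) : SimpleGraph V where
  Adj x y := x ≠ y ∧ ¬ (x ∈ Z ∧ y ∈ Z) ∧ ∃ a b, H.Adj a b ∧ f a = x ∧ f b = y
  symm := ⟨fun _ _ ⟨h1, h2, a, b, h3, h4, h5⟩ =>
    ⟨h1.symm, fun h => h2 ⟨h.2, h.1⟩, b, a, h3.symm, h5, h4⟩⟩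
  loopless := ⟨fun _ h => h.1 rfl⟩

lemma ecount_contr {V : Type} [Finite V] {H : SimpleGraph V} (Z : Set V) (f : V → V) {u v : V}
    (huv : H.Adj u v) (hf : f u = f v) : ecount (contr H Z f) < ecount H := by
  have h1 : {p : V × V | (contr H Z f).Adj p.1 p.2} ⊆
      Prod.map f f '' ({p : V × V | H.Adj p.1 p.2} \ {(u, v)}) := by
    rintro ⟨x, y⟩ ⟨hne, -, a, b, hab, rfl, rfl⟩
    refine ⟨(a, b), ⟨hab, ?_⟩, rfl⟩
    intro h
    simp only [Set.mem_singleton_iff, Prod.mk.injEq] at h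
    apply hne
    simp only
    rw [h.1, h.2, hf]
  have h2 := Set.ncard_le_ncard h1 (Set.toFinite _)
  have h3 := Set.ncard_image_le (f := Prod.map f f)
    (Set.toFinite ({p : V × V | H.Adj p.1 p.2} \ {(u, v)}))
  have h4 : ({p : V × V | H.Adj p.1 p.2} \ {(u, v)}).ncard < {p : V × V | H.Adj p.1 p.2}.ncard :=
    Set.ncard_sdiff_singleton_lt_of_mem (by exact huv) (Set.toFinite _)
  unfold ecount
  omega

lemma case_two {V : Type} [Finite V] {k t : ℕ} {H : SimpleGraph V} {Z : Set V}
    {X : Fin k → Set V} (hG : GoodModel H Z X) (g : V → Fin t)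
    (hno : ∀ A B, IsSeparation H A B → Z ⊆ A → ∀ i, X i ⊆ B \ A → (A ∩ B).ncard = Z.ncard →
      ∀ x y, H.Adj x y → x ∈ B)
    {u v : V} (huv : H.Adj u v) (hv : v ∉ Z) (hXuv : ∀ i j, u ∈ X i → v ∈ X j → i = j)
    {f : V → V} (hfv : f v = u) (hf : ∀ x, x ≠ v → f x = x)
    (ih : GoodModel (contr H Z f) Z (fun i => f '' X i) →
      Concl t (contr H Z f) Z (fun i => f '' X i) g) : Concl t H Z X g := by
  classical
  have hfu : f u = u := hf u huv.ne
  have hfZ : ∀ z ∈ Z, f z = z := fun z hz => hf z (fun h => hv (h ▸ hz))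
  have hfib : ∀ x y, f x = f y → x = y ∨ H.Adj x y := by
    intro x y h
    by_cases hx : x = v <;> by_cases hy : y = v
    · left; rw [hx, hy]
    · right; rw [hx, hfv, hf y hy] at h; rw [hx, ← h]; exact huv.symm
    · right; rw [hy, hfv, hf x hx] at h; rw [hy, h]; exact huv
    · left; rwa [hf x hx, hf y hy] at h
  have hlab : ∀ i j x y, x ∈ X i → y ∈ X j → f x = f y → i = j := by
    intro i j x y hx hy h
    by_contra hij
    by_cases hxv : x = v <;> by_cases hyv : y = v
    · exact Set.disjoint_left.1 (hG.disj i j hij) hx (by rwa [hxv, ← hyv])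
    · rw [hxv, hfv, hf y hyv] at h
      exact hij (hXuv j i (h ▸ hy) (hxv ▸ hx)).symm
    · rw [hyv, hfv, hf x hxv] at h
      exact hij (hXuv i j (h ▸ hx) (hyv ▸ hy))
    · rw [hf x hxv, hf y hyv] at h
      exact Set.disjoint_left.1 (hG.disj i j hij) hx (h ▸ hy)
  have hpush : ∀ x y, aug H Z x y → f x ≠ f y → aug (contr H Z f) Z (f x) (f y) := by
    rintro x y (h | h) hne
    · by_cases hZ : f x ∈ Z ∧ f y ∈ Z
      · exact Or.inr hZ
      · exact Or.inl ⟨hne, hZ, x, y, h, rfl, rfl⟩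
    · right
      rw [hfZ x h.1, hfZ y h.2]
      exact h
  have hgood : GoodModel (contr H Z f) Z (fun i => f '' X i) := by
    refine ⟨?_, ?_, ?_, ?_, ?_⟩
    · intro i
      refine ⟨(hG.conn i).1.image f, ?_⟩
      rintro T hT ⟨y, hy⟩ hc
      obtain ⟨x, hx, rfl⟩ := hT hy
      have := (hG.conn i).sub (T := f ⁻¹' T) hx hy (by
        intro a ha haT b hb hab
        by_cases hfab : f a = f b
        · change f b ∈ T
          rw [← hfab]; exact haT
        · exact hc (f a) haT (f b) ⟨b, hb, rfl⟩ (hpush a b hab hfab))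
      rintro _ ⟨z, hz, rfl⟩
      exact this hz
    · intro i j hij
      rw [Set.disjoint_left]
      rintro _ ⟨x, hx, rfl⟩ ⟨y, hy, hxy⟩
      exact hij (hlab i j x y hx hy hxy.symm)
    · intro i j hij
      obtain ⟨x, hx, y, hy, hxy⟩ := hG.adj i j hij
      exact ⟨f x, ⟨x, hx, rfl⟩, f y, ⟨y, hy, rfl⟩, hpush x y hxy
        (fun h => hij (hlab i j x y hx hy h))⟩
    · intro x hx y hy h
      exact h.2.1 ⟨hx, hy⟩
    · intro C D hCD hZC i hi
      have hsepH : IsSeparation H (f ⁻¹' C) (f ⁻¹' D) := by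
        refine ⟨by rw [← Set.preimage_union, hCD.1, Set.preimage_univ], ?_⟩
        rintro a ⟨haC, haD⟩ b ⟨hbD, hbC⟩ hab
        refine hCD.2 (f a) ⟨haC, haD⟩ (f b) ⟨hbD, hbC⟩ ⟨?_, ?_, a, b, hab, rfl, rfl⟩
        · intro h
          exact hbC (by change f b ∈ C; rw [← h]; exact haC)
        · intro h
          exact hbC (hZC h.2)
      have hZA : Z ⊆ f ⁻¹' C := fun z hz => by
        change f z ∈ C
        rw [hfZ z hz]; exact hZC hz
      have hXi : X i ⊆ f ⁻¹' D \ f ⁻¹' C := fun x hx => hi ⟨x, hx, rfl⟩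
      have h1 := hG.sep _ _ hsepH hZA i hXi
      by_contra hlt
      push Not at hlt
      have hsub : f ⁻¹' C ∩ f ⁻¹' D ⊆ insert v (C ∩ D) := by
        rintro x ⟨hx, hx'⟩
        by_cases hxv : x = v
        · exact Or.inl hxv
        · right
          change f x ∈ C at hx
          change f x ∈ D at hx'
          rw [hf x hxv] at hx hx'
          exact ⟨hx, hx'⟩
      have h2 := Set.ncard_le_ncard hsub (Set.toFinite _)
      have h3 := Set.ncard_insert_le v (C ∩ D)
      have heq : (f ⁻¹' C ∩ f ⁻¹' D).ncard = Z.ncard := by omega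
      have hvAB : v ∈ f ⁻¹' C ∩ f ⁻¹' D := by
        by_contra hvn
        have : f ⁻¹' C ∩ f ⁻¹' D ⊆ C ∩ D := by
          intro x hx
          refine (hsub hx).resolve_left ?_
          rintro rfl
          exact hvn hx
        have := Set.ncard_le_ncard this (Set.toFinite _)
        omega
      have hedge := hno _ _ hsepH hZA i hXi heq
      have hz : ∃ z ∈ Z, z ∉ f ⁻¹' D := by
        by_contra hcon
        push Not at hcon
        have hZs : Z ⊆ f ⁻¹' C ∩ f ⁻¹' D := fun z hz => ⟨hZA hz, hcon z hz⟩
        have := Set.eq_of_subset_of_ncard_le hZs heq.le (Set.toFinite _)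
        exact hv (this ▸ hvAB)
      obtain ⟨z, hz, hzD⟩ := hz
      have h4 := hG.sep Z {z}ᶜ ⟨by ext x; simp; by_cases hx : x = z <;> simp [hx, hz], ?_⟩ subset_rfl
        i ?_
      · have : Z ∩ {z}ᶜ = Z \ {z} := rfl
        rw [this] at h4
        have := Set.ncard_sdiff_singleton_lt_of_mem hz (Set.toFinite _)
        omega
      · rintro a ⟨haZ, ha⟩ b - hab
        simp only [Set.mem_compl_iff, Set.mem_singleton_iff, not_not] at ha
        subst ha
        exact hzD (hedge _ _ hab)
      · intro x hx
        have hxZ : x ∉ Z := fun h => (hXi hx).2 (hZA h)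
        exact ⟨fun h => hxZ (by rw [Set.mem_singleton_iff.1 h]; exact hz), hxZ⟩
  obtain ⟨F, h, hF1, hF2, hF3, hF4, hF5⟩ := ih hgood
  have hconn : ∀ j, RConn H.Adj (f ⁻¹' F j) := by
    intro j
    obtain ⟨x, hx⟩ := (hG.conn (h j)).1
    refine ⟨⟨x, hF4 j ⟨x, hx, rfl⟩⟩, ?_⟩
    rintro T hT ⟨a, ha⟩ hc
    have hfibT : ∀ x ∈ T, ∀ y, f x = f y → y ∈ T := by
      intro x hx y hxy
      rcases hfib x y hxy with rfl | hadj
      · exact hx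
      · exact hc x hx y (by change f y ∈ F j; rw [← hxy]; exact hT hx) hadj
    have := (hF1 j).sub (T := f '' T) (hT ha) ⟨a, ha, rfl⟩ (by
      rintro _ - ⟨x, hx, rfl⟩ y hy ⟨-, -, c, d, hcd, hcx, rfl⟩
      exact ⟨d, hc c (hfibT x hx c hcx.symm) d hy hcd, rfl⟩)
    intro y hy
    obtain ⟨x, hx, hxy⟩ := this hy
    exact hfibT x hx y hxy
  have hZd : ∀ j, Disjoint (f ⁻¹' F j) Z := by
    intro j
    rw [Set.disjoint_left]
    intro x hx hxZ
    change f x ∈ F j at hx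
    rw [hfZ x hxZ] at hx
    exact Set.disjoint_left.1 (hF3 j) hx hxZ
  have hdd : ∀ j j', j ≠ j' → Disjoint (f ⁻¹' F j) (f ⁻¹' F j') := fun j j' hjj =>
    (hF2 j j' hjj).preimage f
  have hhub : ∀ j, X (h j) ⊆ f ⁻¹' F j := fun j x hx => hF4 j ⟨x, hx, rfl⟩
  have hnb : ∀ z ∈ Z, (∃ x ∈ f ⁻¹' F (g z), H.Adj z x) ∨
      (z = u ∧ ∃ x ∈ f ⁻¹' F (g z), H.Adj v x) := by
    intro z hz
    obtain ⟨x, hx, -, -, a, b, hab, haz, rfl⟩ := hF5 z hz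
    by_cases hav : a = v
    · right
      subst hav
      exact ⟨by rw [← haz, hfv], b, hx, hab⟩
    · left
      rw [hf a hav] at haz
      subst haz
      exact ⟨b, hx, hab⟩
  by_cases huZ : u ∈ Z ∧ ∃ x ∈ f ⁻¹' F (g u), H.Adj v x
  swap
  · refine ⟨fun j => f ⁻¹' F j, h, hconn, hdd, hZd, hhub, ?_⟩
    intro z hz
    rcases hnb z hz with h | ⟨rfl, h⟩
    · exact h
    · exact absurd ⟨hz, h⟩ huZ
  obtain ⟨huZ, x0, hx0, hvx0⟩ := huZ
  have hvF : ∀ j, v ∉ f ⁻¹' F j := by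
    intro j hvj
    change f v ∈ F j at hvj
    rw [hfv] at hvj
    exact Set.disjoint_left.1 (hF3 j) hvj huZ
  refine ⟨fun j => f ⁻¹' F j ∪ {x | x = v ∧ j = g u}, h, ?_, ?_, ?_, ?_, ?_⟩
  · intro j
    refine RConn.center (fun x y (h : H.Adj x y) => h.symm) (hconn j) Set.subset_union_left ?_
    rintro x (hx | ⟨rfl, rfl⟩)
    · exact ⟨{x}, by rintro _ rfl; exact Or.inl hx, RConn.single _ _, rfl, x, rfl, x, hx, Or.inl rfl⟩
    · exact ⟨{x}, by rintro _ rfl; exact Or.inr ⟨rfl, rfl⟩, RConn.single _ _, rfl, x, rfl, x0, hx0,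
        Or.inr hvx0⟩
  · intro j j' hjj
    rw [Set.disjoint_left]
    rintro x (hx | ⟨rfl, rfl⟩) (hx' | ⟨hxv, rfl⟩)
    · exact Set.disjoint_left.1 (hdd j j' hjj) hx hx'
    · exact hvF j (hxv ▸ hx)
    · exact hvF _ hx'
    · exact hjj rfl
  · intro j
    rw [Set.disjoint_left]
    rintro x (hx | ⟨rfl, rfl⟩) hxZ
    · exact Set.disjoint_left.1 (hZd j) hx hxZ
    · exact hv hxZ
  · intro j x hx
    exact Or.inl (hhub j hx)
  · intro z hz
    rcases hnb z hz with ⟨x, hx, hzx⟩ | ⟨rfl, -⟩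
    · exact ⟨x, Or.inl hx, hzx⟩
    · exact ⟨v, Or.inr ⟨rfl, rfl⟩, huv⟩

lemma case_three {V : Type} [Finite V] {k t : ℕ} (ht : 0 < t) {H : SimpleGraph V} {Z : Set V}
    {X : Fin k → Set V} (hG : GoodModel H Z X) (hk : 3 * Z.ncard / 2 + t ≤ k) (g : V → Fin t)
    (hE : ∀ u v, H.Adj u v → ∃ i j, i ≠ j ∧ u ∈ X i ∧ v ∈ X j) : Concl t H Z X g := by
  classical
  have hlab : ∀ i j x, x ∈ X i → x ∈ X j → i = j := by
    intro i j x hi hj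
    by_contra h
    exact Set.disjoint_left.1 (hG.disj i j h) hi hj
  have hsing : ∀ i x, x ∈ X i → x ∉ Z → X i = {x} := by
    intro i x hx hxZ
    apply Set.Subset.antisymm
    · refine (hG.conn i).sub hx rfl ?_
      rintro a ha rfl b hb (hab | hab)
      · obtain ⟨i', j', hij, h1, h2⟩ := hE _ _ hab
        exact absurd ((hlab _ _ _ h1 ha).trans (hlab _ _ _ hb h2)) hij
      · exact absurd hab.1 hxZ
    · rintro _ rfl; exact hx
  have hin : ∀ i x, x ∈ X i → x ∈ Z → X i ⊆ Z := by
    intro i x hx hxZ y hy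
    by_contra hyZ
    rw [hsing i y hy hyZ] at hx
    exact hyZ (Set.mem_singleton_iff.1 hx ▸ hxZ)
  have hrep : ∀ i, ∃ x, x ∈ X i := fun i => (hG.conn i).1
  choose w hw using hrep
  let W : Finset (Fin k) := Finset.univ.filter fun i => w i ∉ Z
  have hW : ∀ i, i ∈ W ↔ w i ∉ Z := fun i => by simp [W]
  have hWs : ∀ i ∈ W, X i = {w i} := fun i hi => hsing i _ (hw i) ((hW i).1 hi)
  have hWof : ∀ i x, x ∈ X i → x ∉ Z → i ∈ W ∧ x = w i := by
    intro i x hx hxZ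
    have h1 := hsing i x hx hxZ
    have h2 : w i = x := by
      have := hw i
      rw [h1] at this
      exact this
    exact ⟨(hW i).2 (by rwa [h2]), h2.symm⟩
  let S1 : Finset (Fin k) := Finset.univ.filter fun i => w i ∈ Z ∧ X i = {w i}
  let S2 : Finset (Fin k) := Finset.univ.filter fun i => w i ∈ Z ∧ X i ≠ {w i}
  let Sg : Set V := {z ∈ Z | ∃ i, X i = {z}}
  have hcount : W.card + S1.card + S2.card = k := by
    have h1 : Disjoint W S1 := by
      rw [Finset.disjoint_left]; intro i; simp [W, S1]; tauto
    have h2 : Disjoint (W ∪ S1) S2 := by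
      rw [Finset.disjoint_left]; intro i; simp [W, S1, S2]; tauto
    rw [← Finset.card_union_of_disjoint h1, ← Finset.card_union_of_disjoint h2]
    have : W ∪ S1 ∪ S2 = Finset.univ := by
      ext i; simp [W, S1, S2]; tauto
    rw [this, Finset.card_fin]
  have hwinj : Function.Injective w := fun i j h => hlab i j _ (hw i) (h ▸ hw j)
  have hS1 : S1.card ≤ Sg.ncard := by
    rw [← Set.ncard_coe_finset, ← Set.InjOn.ncard_image (f := w) hwinj.injOn]
    apply Set.ncard_le_ncard _ (Set.toFinite _)
    rintro _ ⟨i, hi, rfl⟩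
    have : w i ∈ Z ∧ X i = {w i} := by simpa [S1] using hi
    exact ⟨this.1, i, this.2⟩
  have hS2 : 2 * S2.card ≤ Z.ncard := by
    have hex : ∀ i, ∃ y, i ∈ S2 → y ∈ X i ∧ y ≠ w i := by
      intro i
      by_cases hi : i ∈ S2
      · have h2 : w i ∈ Z ∧ X i ≠ {w i} := by simpa [S2] using hi
        by_contra hcon
        push Not at hcon
        apply h2.2
        apply Set.Subset.antisymm
        · intro y hy
          by_contra hyw
          have := (hcon y).2 hy
          exact hyw this
        · rintro _ rfl; exact hw i
      · exact ⟨w i, fun h => absurd h hi⟩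
    choose w' hw' using hex
    have hd : Disjoint (w '' S2) (w' '' S2) := by
      rw [Set.disjoint_left]
      rintro _ ⟨i, hi, rfl⟩ ⟨j, hj, hji⟩
      have h1 := hw' j hj
      have : j = i := hlab j i _ h1.1 (hji ▸ hw i)
      subst this
      exact h1.2 hji
    have hinj' : Set.InjOn w' (S2 : Set (Fin k)) := by
      intro i hi j hj h
      exact hlab i j _ (hw' i hi).1 (h ▸ (hw' j hj).1)
    have h1 := Set.ncard_union_eq hd (Set.toFinite _) (Set.toFinite _)
    rw [hwinj.injOn.ncard_image, hinj'.ncard_image, Set.ncard_coe_finset] at h1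
    have h2 : w '' S2 ∪ w' '' S2 ⊆ Z := by
      have hz : ∀ i ∈ S2, w i ∈ Z := fun i hi => by
        have h2 : w i ∈ Z ∧ X i ≠ {w i} := by simpa [S2] using hi
        exact h2.1
      rintro _ (⟨i, hi, rfl⟩ | ⟨i, hi, rfl⟩)
      · exact hz i hi
      · exact hin i _ (hw i) (hz i hi) (hw' i hi).1
    have h3 := Set.ncard_le_ncard h2 (Set.toFinite _)
    omega
  have hR : (Z \ Sg).ncard + Sg.ncard = Z.ncard :=
    Set.ncard_sdiff_add_ncard_of_subset (fun z hz => hz.1) (Set.toFinite _)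
  have hWcard : (Z \ Sg).ncard + t ≤ W.card := by omega
  have : Fintype V := Fintype.ofFinite V
  let N : ↥(Z \ Sg) → Finset (Fin k) := fun z => W.filter fun i => H.Adj z.1 (w i)
  have hhall : ∀ s : Finset ↥(Z \ Sg), s.card ≤ (s.biUnion N).card := by
    intro s
    have hsc : (Subtype.val '' (s : Set ↥(Z \ Sg))).ncard = s.card := by
      rw [Subtype.val_injective.injOn.ncard_image, Set.ncard_coe_finset]
    have hsub : Subtype.val '' (s : Set ↥(Z \ Sg)) ⊆ Z \ Sg := by
      rintro _ ⟨x, -, rfl⟩; exact x.2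
    by_cases hfull : W ⊆ s.biUnion N
    · have h1 := Finset.card_le_card hfull
      have h2 := Set.ncard_le_ncard hsub (Set.toFinite _)
      omega
    · obtain ⟨i, hi, hiN⟩ := Finset.not_subset.1 hfull
      have hsubZ : Subtype.val '' (s : Set ↥(Z \ Sg)) ⊆ Z := fun x hx => (hsub hx).1
      have hNW : ∀ j ∈ s.biUnion N, j ∈ W := by
        intro j hj
        obtain ⟨z, -, hz⟩ := Finset.mem_biUnion.1 hj
        exact (Finset.mem_filter.1 hz).1
      have h1 := hG.sep (Z ∪ w '' (s.biUnion N : Set (Fin k)))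
        (Subtype.val '' (s : Set ↥(Z \ Sg)))ᶜ ⟨?_, ?_⟩ Set.subset_union_left i ?_
      · have h2 : (Z ∪ w '' (s.biUnion N : Set (Fin k))) ∩ (Subtype.val '' (s : Set ↥(Z \ Sg)))ᶜ ⊆
            (Z \ Subtype.val '' (s : Set ↥(Z \ Sg))) ∪ w '' (s.biUnion N : Set (Fin k)) := by
          rintro x ⟨hx | hx, hx'⟩
          · exact Or.inl ⟨hx, hx'⟩
          · exact Or.inr hx
        have h3 := Set.ncard_le_ncard h2 (Set.toFinite _)
        have h4 := Set.ncard_union_le (Z \ Subtype.val '' (s : Set ↥(Z \ Sg)))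
          (w '' (s.biUnion N : Set (Fin k)))
        have h5 := Set.ncard_sdiff_add_ncard_of_subset hsubZ (Set.toFinite _)
        have h6 := Set.ncard_image_le (f := w) (Set.toFinite (s.biUnion N : Set (Fin k)))
        rw [Set.ncard_coe_finset] at h6
        omega
      · ext x
        by_cases hx : x ∈ Subtype.val '' (s : Set ↥(Z \ Sg))
        · simp only [Set.mem_union, Set.mem_univ, iff_true]
          exact Or.inl (Or.inl (hsubZ hx))
        · simp only [Set.mem_union, Set.mem_univ, iff_true]
          exact Or.inr hx
      · rintro a ⟨-, ha⟩ b ⟨-, hb⟩ hab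
        have ha' := not_not.1 ha
        have haZ := hsubZ ha'
        have hbZ : b ∉ Z := fun h => hb (Or.inl h)
        obtain ⟨i', j', -, -, h2⟩ := hE _ _ hab
        obtain ⟨h3, rfl⟩ := hWof j' b h2 hbZ
        obtain ⟨z, hz, rfl⟩ := ha'
        refine hb (Or.inr ⟨j', ?_, rfl⟩)
        exact Finset.mem_coe.2 (Finset.mem_biUnion.2 ⟨z, hz, Finset.mem_filter.2 ⟨h3, hab⟩⟩)
      · rw [hWs i hi]
        rintro _ rfl
        have hwZ := (hW i).1 hi
        refine ⟨fun h => hwZ (hsubZ h), ?_⟩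
        rintro (h | ⟨j, hj, hji⟩)
        · exact hwZ h
        · exact hiN (hwinj hji ▸ hj)
  obtain ⟨μ, hμ, hμN⟩ := (Finset.all_card_le_biUnion_card_iff_exists_injective N).1 hhall
  have hμW : ∀ z, μ z ∈ W := fun z => (Finset.mem_filter.1 (hμN z)).1
  have hμA : ∀ z, H.Adj z.1 (w (μ z)) := fun z => (Finset.mem_filter.1 (hμN z)).2
  have hrem : t ≤ (W \ Finset.univ.image μ).card := by
    have h1 := Finset.le_card_sdiff (Finset.univ.image μ) W
    have h2 : (Finset.univ.image μ).card ≤ (Z \ Sg).ncard := by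
      refine Finset.card_image_le.trans ?_
      rw [Finset.card_univ, ← Nat.card_eq_fintype_card, Nat.card_coe_set_eq]
    omega
  let h := Finset.orderEmbOfCardLe _ hrem
  have hh : ∀ j, h j ∈ W \ Finset.univ.image μ := fun j => Finset.orderEmbOfCardLe_mem _ hrem j
  have hhW : ∀ j, h j ∈ W := fun j => (Finset.mem_sdiff.1 (hh j)).1
  have hhμ : ∀ j z, μ z ≠ h j := fun j z he =>
    (Finset.mem_sdiff.1 (hh j)).2 (Finset.mem_image.2 ⟨z, Finset.mem_univ _, he⟩)
  have hadjW : ∀ i ∈ W, ∀ j, i ≠ j → ∃ y ∈ X j, H.Adj (w i) y := by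
    intro i hi j hij
    obtain ⟨x, hx, y, hy, hxy⟩ := hG.adj i j hij
    rw [hWs i hi] at hx
    obtain rfl : x = w i := hx
    rcases hxy with hxy | hxy
    · exact ⟨y, hy, hxy⟩
    · exact absurd hxy.1 ((hW i).1 hi)
  refine ⟨fun j => {w (h j)} ∪ {x | ∃ z : ↥(Z \ Sg), g z = j ∧ x = w (μ z)}, h, ?_, ?_, ?_, ?_, ?_⟩
  · intro j
    refine RConn.center (fun x y (h : H.Adj x y) => h.symm) (RConn.single _ (w (h j)))
      Set.subset_union_left ?_
    rintro x (rfl | ⟨z, rfl, rfl⟩)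
    · exact ⟨{w (h j)}, Set.subset_union_left, RConn.single _ _, rfl, _, rfl, _, rfl, Or.inl rfl⟩
    · refine ⟨{w (μ z)}, ?_, RConn.single _ _, rfl, _, rfl, _, rfl, Or.inr ?_⟩
      · rintro _ rfl; exact Or.inr ⟨z, rfl, rfl⟩
      · obtain ⟨y, hy, hyy⟩ := hadjW (μ z) (hμW z) (h (g z)) (hhμ _ z)
        rw [hWs _ (hhW _)] at hy
        exact (Set.mem_singleton_iff.1 hy) ▸ hyy
  · intro j j' hjj
    rw [Set.disjoint_left]
    rintro x (rfl | ⟨z, rfl, rfl⟩) (hx | ⟨z', rfl, hx⟩)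
    · exact hjj (h.injective (hwinj hx))
    · exact hhμ _ _ (hwinj hx).symm
    · exact hhμ _ _ (hwinj hx)
    · exact hjj (by rw [hμ (hwinj hx)])
  · intro j
    rw [Set.disjoint_left]
    rintro x (rfl | ⟨z, rfl, rfl⟩)
    · exact (hW _).1 (hhW j)
    · exact (hW _).1 (hμW z)
  · intro j x hx
    rw [hWs _ (hhW _)] at hx
    exact Or.inl hx
  · intro z hz
    by_cases hzS : z ∈ Sg
    · obtain ⟨-, i, hi⟩ := hzS
      have hne : h (g z) ≠ i := by
        rintro rfl
        have := hw (h (g z))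
        rw [hi] at this
        have hwz : w (h (g z)) = z := this
        exact (hW _).1 (hhW (g z)) (by rw [hwz]; exact hz)
      obtain ⟨y, hy, hyy⟩ := hadjW _ (hhW (g z)) i hne
      rw [hi] at hy
      exact ⟨_, Or.inl rfl, ((Set.mem_singleton_iff.1 hy) ▸ hyy).symm⟩
    · exact ⟨_, Or.inr ⟨⟨z, hz, hzS⟩, rfl, rfl⟩, hμA ⟨z, hz, hzS⟩⟩

theorem linkage {V : Type} [Finite V] {k t : ℕ} (ht : 0 < t) (M : ℕ) :
    ∀ (H : SimpleGraph V), ecount H ≤ M → ∀ (Z : Set V) (X : Fin k → Set V) (g : V → Fin t),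
      GoodModel H Z X → 3 * Z.ncard / 2 + t ≤ k → Concl t H Z X g := by
  classical
  induction M using Nat.strong_induction_on with
  | _ M ih =>
  intro H hM Z X g hG hk
  by_cases h1 : ∃ A B, IsSeparation H A B ∧ Z ⊆ A ∧ (∃ i, X i ⊆ B \ A) ∧
      (A ∩ B).ncard = Z.ncard ∧ ∃ x y, H.Adj x y ∧ x ∉ B
  · obtain ⟨A, B, hAB, hZA, ⟨i, hi⟩, hc, x, y, hxy, hxB⟩ := h1
    refine case_one hG g hAB hZA i hi hc ?_
    intro g' hG'
    have hlt : ecount (delIn H B (A ∩ B)) < ecount H :=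
      ecount_lt (fun _ _ h => h.1) hxy (fun h => hxB h.2.1)
    exact ih (ecount (delIn H B (A ∩ B))) (by omega) _ le_rfl _ _ g' hG' (by rwa [hc])
  by_cases h2 : ∃ u v, H.Adj u v ∧ v ∉ Z ∧ ∀ i j, u ∈ X i → v ∈ X j → i = j
  · obtain ⟨u, v, huv, hv, hl⟩ := h2
    have hf : ∃ f : V → V, f v = u ∧ ∀ x, x ≠ v → f x = x :=
      ⟨fun x => if x = v then u else x, by simp, fun x hx => by simp [hx]⟩
    obtain ⟨f, hfv, hf⟩ := hf
    refine case_two hG g ?_ huv hv hl hfv hf ?_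
    · intro A B hAB hZA i hi hc x y hxy
      by_contra hx
      exact h1 ⟨A, B, hAB, hZA, ⟨i, hi⟩, hc, x, y, hxy, hx⟩
    · intro hG'
      have hlt := ecount_contr Z f huv (by rw [hf u huv.ne, hfv])
      exact ih _ (by omega) _ le_rfl _ _ g hG' hk
  · refine case_three ht hG hk g ?_
    intro u v huv
    by_contra hcon
    have hz : u ∉ Z ∨ v ∉ Z := by
      by_contra hz
      exact hG.indep u (by tauto) v (by tauto) huv
    rcases hz with hz | hz
    · refine h2 ⟨v, u, huv.symm, hz, fun i j hi hj => ?_⟩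
      by_contra hij
      exact hcon ⟨j, i, Ne.symm hij, hj, hi⟩
    · refine h2 ⟨u, v, huv, hz, fun i j hi hj => ?_⟩
      by_contra hij
      exact hcon ⟨i, j, hij, hi, hj⟩

def extG {n q t : ℕ} (G : SimpleGraph (Fin n)) (χ : Fin n → Finset (Fin q)) :
    SimpleGraph (Fin n ⊕ (Fin q × Fin t)) where
  Adj x y := match x, y with
    | Sum.inl a, Sum.inl b => G.Adj a b
    | Sum.inl a, Sum.inr c => c.1 ∈ χ a
    | Sum.inr c, Sum.inl a => c.1 ∈ χ a
    | Sum.inr _, Sum.inr _ => False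
  symm := ⟨fun x y h => by
    rcases x with x | x <;> rcases y with y | y
    · exact h.symm
    · exact h
    · exact h
    · exact h⟩
  loopless := ⟨fun x h => by
    rcases x with x | x
    · exact G.irrefl h
    · exact h⟩

/-- If a `q`-colorful graph contains a minor model `X` of `K_k` with
`k ≥ ⌊3/2·qt⌋ + t`, then either it contains a colorful minor model `F` of the rainbow
`K_t` whose tangle is the truncation of that of `X` (expressed via separations of
order `< t`), or there is a set `S` of at most `qt − 1` vertices such that the `X`-big
component of `G − S` is restricted (misses some color). -/
theorem rainbow_clique_from_clique (q t k : ℕ) (hq : 0 < q) (ht : 0 < t) (hk0 : 0 < k)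
    (hk : 3 * q * t / 2 + t ≤ k)
    {n : ℕ} (G : SimpleGraph (Fin n)) (χ : Fin n → Finset (Fin q))
    (X : Fin k → Set (Fin n))
    (hXconn : ∀ i, (G.induce (X i)).Connected)
    (hXdisj : Pairwise fun i j => Disjoint (X i) (X j))
    (hXadj : ∀ i j, i ≠ j → ∃ x ∈ X i, ∃ y ∈ X j, G.Adj x y) :
    (∃ F : Fin t → Set (Fin n),
      (∀ i, (G.induce (F i)).Connected) ∧
      (Pairwise fun i j => Disjoint (F i) (F j)) ∧
      (∀ i j, i ≠ j → ∃ x ∈ F i, ∃ y ∈ F j, G.Adj x y) ∧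
      (∀ i, ∀ c : Fin q, ∃ x ∈ F i, c ∈ χ x) ∧
      (∀ A B : Set (Fin n), IsSeparation G A B → (A ∩ B).ncard < t →
        ((∃ i, F i ⊆ B \ A) ↔ ∃ j, X j ⊆ B \ A))) ∨
    (∃ S : Set (Fin n), S.ncard ≤ q * t - 1 ∧
      ∃ C : Set (Fin n), IsComponentAvoiding G S C ∧
        (∀ i, Disjoint (X i) S → X i ⊆ C) ∧
        ∃ c : Fin q, ∀ x ∈ C, c ∉ χ x) := by
  classical
  have hXc : ∀ i, RConn G.Adj (X i) := fun i => (rconn_iff G (X i)).2 (hXconn i)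
  let H := extG (t := t) G χ
  let Z : Set (Fin n ⊕ (Fin q × Fin t)) := Set.range Sum.inr
  let X' : Fin k → Set (Fin n ⊕ (Fin q × Fin t)) := fun i => Sum.inl '' X i
  have hZc : Z.ncard = q * t := by
    have h1 : (Set.range (Sum.inr : Fin q × Fin t → Fin n ⊕ (Fin q × Fin t))).ncard = q * t := by
      rw [← Set.image_univ, Sum.inr_injective.injOn.ncard_image, Set.ncard_univ]
      simp
    exact h1
  by_cases hsep : ∀ A B, IsSeparation H A B → Z ⊆ A → ∀ i, X' i ⊆ B \ A →
      Z.ncard ≤ (A ∩ B).ncard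
  · left
    have hG : GoodModel H Z X' := by
      refine ⟨?_, ?_, ?_, ?_, hsep⟩
      · intro i
        refine ⟨(hXc i).1.image _, ?_⟩
        rintro T hT ⟨y, hy⟩ hc
        obtain ⟨x, hx, rfl⟩ := hT hy
        have := (hXc i).sub (T := Sum.inl ⁻¹' T) hx hy (by
          intro a ha haT b hb hab
          exact hc _ haT _ ⟨b, hb, rfl⟩ (Or.inl hab))
        rintro _ ⟨z, hz, rfl⟩
        exact this hz
      · intro i j hij
        rw [Set.disjoint_left]
        rintro _ ⟨x, hx, rfl⟩ ⟨y, hy, hxy⟩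
        exact Set.disjoint_left.1 (hXdisj hij) hx (Sum.inl_injective hxy ▸ hy)
      · intro i j hij
        obtain ⟨x, hx, y, hy, hxy⟩ := hXadj i j hij
        exact ⟨_, ⟨x, hx, rfl⟩, _, ⟨y, hy, rfl⟩, Or.inl hxy⟩
      · rintro _ ⟨x, rfl⟩ _ ⟨y, rfl⟩ h
        exact h
    obtain ⟨F, h, hF1, hF2, hF3, hF4, hF5⟩ := linkage ht _ H le_rfl Z X'
      (fun x => Sum.elim (fun _ => ⟨0, ht⟩) Prod.snd x) hG (by
        rw [hZc, ← mul_assoc]; exact hk)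
    have hinl : ∀ j y, y ∈ F j → ∃ a, y = Sum.inl a := by
      rintro j (a | c) hy
      · exact ⟨a, rfl⟩
      · exact absurd ⟨c, rfl⟩ (Set.disjoint_left.1 (hF3 j) hy)
    have hconn : ∀ j, RConn G.Adj (Sum.inl ⁻¹' F j) := by
      intro j
      obtain ⟨y, hy⟩ := (hF1 j).1
      obtain ⟨a, rfl⟩ := hinl j y hy
      refine ⟨⟨a, hy⟩, ?_⟩
      rintro T hT ⟨b, hb⟩ hc
      have := (hF1 j).sub (T := Sum.inl '' T) (hT hb) ⟨b, hb, rfl⟩ (by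
        rintro _ - ⟨x, hx, rfl⟩ y hy hxy
        obtain ⟨c, rfl⟩ := hinl j y hy
        exact ⟨c, hc x hx c hy hxy, rfl⟩)
      intro c hcF
      obtain ⟨d, hd, hdc⟩ := this hcF
      exact Sum.inl_injective hdc ▸ hd
    have hhub : ∀ j, X (h j) ⊆ Sum.inl ⁻¹' F j := fun j x hx => hF4 j ⟨x, hx, rfl⟩
    have hdisj : ∀ i j, i ≠ j → Disjoint (Sum.inl ⁻¹' F i : Set (Fin n)) (Sum.inl ⁻¹' F j) :=
      fun i j hij => (hF2 i j hij).preimage _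
    have hhinj : ∀ i j, i ≠ j → h i ≠ h j := by
      intro i j hij he
      obtain ⟨x, hx⟩ := (hXc (h i)).1
      exact Set.disjoint_left.1 (hdisj i j hij) (hhub i hx) (hhub j (he ▸ hx))
    refine ⟨fun j => Sum.inl ⁻¹' F j, fun j => (rconn_iff _ _).1 (hconn j), fun i j hij =>
      hdisj i j hij, ?_, ?_, ?_⟩
    · intro i j hij
      obtain ⟨x, hx, y, hy, hxy⟩ := hXadj _ _ (hhinj i j hij)
      exact ⟨x, hhub i hx, y, hhub j hy, hxy⟩
    · intro j c
      obtain ⟨x, hx, hxx⟩ := hF5 (Sum.inr (c, j)) ⟨_, rfl⟩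
      obtain ⟨a, rfl⟩ := hinl _ x hx
      exact ⟨a, hx, hxx⟩
    · intro A B hAB hlt
      have hcov : ∀ x, x ∈ A ∨ x ∈ B := fun x => by
        have : x ∈ A ∪ B := hAB.1 ▸ Set.mem_univ x
        exact this
      have hside : ∀ K : Set (Fin n), RConn G.Adj K → Disjoint K (A ∩ B) →
          ∀ x ∈ K, x ∈ B \ A → K ⊆ B \ A := by
        intro K hK hd x hx hxB
        refine hK.sub hx hxB ?_
        intro a ha haB b hb hab
        by_cases hbA : b ∈ A
        · by_cases hbB : b ∈ B
          · exact absurd ⟨hbA, hbB⟩ (Set.disjoint_left.1 hd hb)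
          · exact absurd hab.symm (hAB.2 b ⟨hbA, hbB⟩ a haB)
        · exact ⟨(hcov b).resolve_left hbA, hbA⟩
      constructor
      · rintro ⟨i, hi⟩
        exact ⟨h i, (hhub i).trans hi⟩
      · rintro ⟨j, hj⟩
        have hfree : ∃ i, Disjoint (Sum.inl ⁻¹' F i : Set (Fin n)) (A ∩ B) := by
          by_contra hcon
          push Not at hcon
          have hex : ∀ i, ∃ x, x ∈ (Sum.inl ⁻¹' F i : Set (Fin n)) ∧ x ∈ A ∩ B := fun i =>
            Set.not_disjoint_iff.1 (hcon i)
          choose p hp using hex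
          have hpinj : Function.Injective p := by
            intro i j he
            by_contra hij
            exact Set.disjoint_left.1 (hdisj i j hij) (hp i).1 (he ▸ (hp j).1)
          have h1 : Set.range p ⊆ A ∩ B := by
            rintro _ ⟨i, rfl⟩; exact (hp i).2
          have h2 := Set.ncard_le_ncard h1 (Set.toFinite _)
          rw [← Set.image_univ, hpinj.injOn.ncard_image, Set.ncard_univ, Nat.card_fin] at h2
          omega
        obtain ⟨i, hi⟩ := hfree
        refine ⟨i, ?_⟩
        by_cases hij : h i = j
        · obtain ⟨x, hx⟩ := (hXc (h i)).1
          exact hside _ (hconn i) hi x (hhub i hx) (hj (hij ▸ hx))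
        · obtain ⟨x, hx, y, hy, hxy⟩ := hXadj _ _ hij
          have hxF := hhub i hx
          refine hside _ (hconn i) hi x hxF ?_
          have hyB := hj hy
          by_cases hxA : x ∈ A
          · by_cases hxB : x ∈ B
            · exact absurd ⟨hxA, hxB⟩ (Set.disjoint_left.1 hi hxF)
            · exact absurd hxy (hAB.2 x ⟨hxA, hxB⟩ y hyB)
          · exact ⟨(hcov x).resolve_left hxA, hxA⟩
  · right
    push Not at hsep
    obtain ⟨A, B, hAB, hZA, i, hi, hlt⟩ := hsep
    have hcov : ∀ x, x ∈ A ∨ x ∈ B := fun x => by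
      have : x ∈ A ∪ B := hAB.1 ▸ Set.mem_univ x
      exact this
    have hz : ∃ z ∈ Z, z ∉ B := by
      by_contra hcon
      push Not at hcon
      have hZs : Z ⊆ A ∩ B := fun z hz => ⟨hZA hz, hcon z hz⟩
      have := Set.ncard_le_ncard hZs (Set.toFinite _)
      omega
    obtain ⟨_, ⟨⟨c, j⟩, rfl⟩, hzB⟩ := hz
    have hzA : Sum.inr (c, j) ∈ A := hZA ⟨_, rfl⟩
    let S : Set (Fin n) := Sum.inl ⁻¹' (A ∩ B)
    have hS : S.ncard ≤ (A ∩ B).ncard := by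
      rw [← Sum.inl_injective.injOn.ncard_image (f := (Sum.inl : _ → Fin n ⊕ (Fin q × Fin t)))]
      exact Set.ncard_le_ncard (Set.image_preimage_subset _ _) (Set.toFinite _)
    have hXiS : X i ⊆ Sᶜ := fun x hx hxS => (hi ⟨x, hx, rfl⟩).2 hxS.1
    obtain ⟨C, h1, h2, h3, h4⟩ := RConn.exists_comp (fun x y (h : G.Adj x y) => h.symm) (hXc i) hXiS
    refine ⟨S, by omega, C, ⟨?_, (rconn_iff _ _).1 h3, fun x hx y hy hxy => h4 x hx y hy hxy⟩, ?_, c, ?_⟩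
    · rw [Set.disjoint_left]
      exact fun x hx => h2 hx
    · intro i' hd
      by_cases hii : i = i'
      · exact hii ▸ h1
      obtain ⟨x, hx, y, hy, hxy⟩ := hXadj _ _ hii
      have hyC := h4 x (h1 hx) y (Set.disjoint_left.1 hd hy) hxy
      exact (hXc i').sub hy hyC (fun a _ haC b hb hab =>
        h4 a haC b (Set.disjoint_left.1 hd hb) hab)
    · have hCB : C ⊆ Sum.inl ⁻¹' (B \ A) := by
        obtain ⟨x, hx⟩ := (hXc i).1
        refine h3.sub (h1 hx) (hi ⟨x, hx, rfl⟩) ?_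
        intro a ha haB b hb hab
        by_cases hbA : Sum.inl b ∈ A
        · by_cases hbB : Sum.inl b ∈ B
          · exact absurd ⟨hbA, hbB⟩ (h2 hb)
          · exact absurd hab.symm (hAB.2 (Sum.inl b) ⟨hbA, hbB⟩ (Sum.inl a) haB)
        · exact ⟨(hcov _).resolve_left hbA, hbA⟩
      intro x hx hcx
      exact hAB.2 (Sum.inr (c, j)) ⟨hzA, hzB⟩ (Sum.inl x) (hCB hx) hcx
end
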